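/- arXiv:1712.07191 — 3 statements merged into one kernel-verified Lean document; each statement's English description precedes it below -/
import Mathlib

section
/- For every integer m > 2 and every ε > 0 there exists C such that for every integer n > C coprime to m there exists a permutation f of ℤ/nℤ with f⁴ = id and f(x+1) = m·f(x) for at least (1−ε)n elements x ∈ ℤ/nℤ. -/
namespace HJ

section Fn
variable {p : ℕ} [Fact p.Prime]

/-- the prepending operator -/
def PF (f : ℕ → ZMod p) (g : List ℕ → ZMod p) : List ℕ → ZMod p
  | [] => 0
  | y :: v => PF f g v + f y * g v

/-- binomial function -/
def ch (p j : ℕ) : ℕ → ZMod p := fun y => (y.choose j : ZMod p)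

def beta (p : ℕ) [Fact p.Prime] : List ℕ → List ℕ → ZMod p
  | [] => fun _ => 1
  | j :: J => PF (ch p j) (beta p J)

def wt : List ℕ → ℕ
  | [] => 0
  | j :: J => j + 1 + wt J

def PS (p : ℕ) [Fact p.Prime] (n : ℕ) : Submodule (ZMod p) (List ℕ → ZMod p) :=
  Submodule.span (ZMod p) (beta p '' {J | wt J < n})

theorem PF_add (f : ℕ → ZMod p) (g h : List ℕ → ZMod p) : PF f (g + h) = PF f g + PF f h := by
  funext v
  induction v with
  | nil => simp [PF]
  | cons y v ih => simp only [PF, ih, Pi.add_apply]; ring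

theorem PF_smul (f : ℕ → ZMod p) (c : ZMod p) (g : List ℕ → ZMod p) :
    PF f (c • g) = c • PF f g := by
  funext v
  induction v with
  | nil => simp [PF]
  | cons y v ih => simp only [PF, ih, Pi.smul_apply, smul_eq_mul]; ring

theorem PF_zero (f : ℕ → ZMod p) : PF f 0 = 0 := by
  funext v
  induction v with
  | nil => simp [PF]
  | cons y v ih => simp [PF, ih]

theorem PF_sub (f : ℕ → ZMod p) (g h : List ℕ → ZMod p) : PF f (g - h) = PF f g - PF f h := by
  funext v
  induction v with
  | nil => simp [PF]
  | cons y v ih => simp only [PF, ih, Pi.sub_apply]; ring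

theorem PF_add_left (f f' : ℕ → ZMod p) (g : List ℕ → ZMod p) :
    PF (f + f') g = PF f g + PF f' g := by
  funext v
  induction v with
  | nil => simp [PF]
  | cons y v ih => simp only [PF, ih, Pi.add_apply]; ring

theorem PF_smul_left (c : ZMod p) (f : ℕ → ZMod p) (g : List ℕ → ZMod p) :
    PF (c • f) g = c • PF f g := by
  funext v
  induction v with
  | nil => simp [PF]
  | cons y v ih => simp only [PF, ih, Pi.smul_apply, smul_eq_mul]; ring

theorem PF_sum_left {ι : Type*} (s : Finset ι) (F : ι → ℕ → ZMod p) (g : List ℕ → ZMod p) :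
    PF (∑ i ∈ s, F i) g = ∑ i ∈ s, PF (F i) g := by
  funext v
  rw [Finset.sum_apply]
  induction v with
  | nil => simp [PF]
  | cons y v ih => simp only [PF, ih, Finset.sum_apply, Finset.sum_add_distrib, Finset.sum_mul]

theorem PS_mono {a b : ℕ} (h : a ≤ b) : PS p a ≤ PS p b :=
  Submodule.span_mono (Set.image_mono fun _ hJ => lt_of_lt_of_le hJ h)

theorem beta_mem {J : List ℕ} {n : ℕ} (h : wt J < n) : beta p J ∈ PS p n :=
  Submodule.subset_span ⟨J, h, rfl⟩

/-- induction principle: linear statements on `PS` -/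
theorem PS_map {n k : ℕ} (A : (List ℕ → ZMod p) →ₗ[ZMod p] (List ℕ → ZMod p))
    (h : ∀ J, wt J < n → A (beta p J) ∈ PS p k) {g : List ℕ → ZMod p} (hg : g ∈ PS p n) :
    A g ∈ PS p k := by
  have : PS p n ≤ (PS p k).comap A := by
    refine Submodule.span_le.2 ?_
    rintro _ ⟨J, hJ, rfl⟩
    exact h J hJ
  exact this hg

theorem PS_zero {g : List ℕ → ZMod p} (hg : g ∈ PS p 0) : g = 0 := by
  simpa [PS] using hg

theorem wt_eq_zero {J : List ℕ} (h : wt J < 1) : J = [] := by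
  cases J with
  | nil => rfl
  | cons a l => simp [wt] at h

theorem PS_one {g : List ℕ → ZMod p} (hg : g ∈ PS p 1) (v : List ℕ) : g v = g [] := by
  have : PS p 1 ≤ LinearMap.ker ((LinearMap.proj v : (List ℕ → ZMod p) →ₗ[ZMod p] ZMod p)
      - LinearMap.proj []) := by
    refine Submodule.span_le.2 ?_
    rintro _ ⟨J, hJ, rfl⟩
    obtain rfl := wt_eq_zero hJ
    simp [beta]
  have := this hg
  simpa [sub_eq_zero] using this

theorem const_mem (c : ZMod p) {n : ℕ} (hn : 0 < n) : (fun _ => c) ∈ PS p n := by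
  have h : beta p [] ∈ PS p n := beta_mem (by simpa [wt] using hn)
  have := (PS p n).smul_mem c h
  convert this using 1
  funext v
  simp [beta]

def PFl (f : ℕ → ZMod p) : (List ℕ → ZMod p) →ₗ[ZMod p] (List ℕ → ZMod p) where
  toFun := PF f
  map_add' := PF_add f
  map_smul' := PF_smul f

theorem PF_ch_mem {j k : ℕ} {g : List ℕ → ZMod p} (hg : g ∈ PS p k) :
    PF (ch p j) g ∈ PS p (k + j + 1) := by
  refine PS_map (PFl (ch p j)) (fun J hJ => ?_) hg
  exact beta_mem (J := j :: J) (by simp only [wt]; omega)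

/-- degree of functions `ℕ → ZMod p` -/
def Dg (d : ℕ) (f : ℕ → ZMod p) : Prop := (fwdDiff 1)^[d] f = 0

theorem Dg_zero_fun (d : ℕ) : Dg d (0 : ℕ → ZMod p) := by
  induction d with
  | zero => rfl
  | succ d ih =>
    unfold Dg at *
    rw [Function.iterate_succ_apply', ih]
    funext y; simp [fwdDiff]

theorem Dg_mono {d e : ℕ} (h : d ≤ e) {f : ℕ → ZMod p} (hf : Dg d f) : Dg e f := by
  obtain ⟨k, rfl⟩ := Nat.exists_eq_add_of_le' h
  unfold Dg at *
  rw [Function.iterate_add_apply, hf]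
  exact Dg_zero_fun k

theorem Dg_succ {d : ℕ} {f : ℕ → ZMod p} : Dg (d + 1) f ↔ Dg d (fwdDiff 1 f) := by
  unfold Dg
  rw [Function.iterate_succ_apply]

theorem Dg_add {d : ℕ} {f g : ℕ → ZMod p} (hf : Dg d f) (hg : Dg d g) : Dg d (f + g) := by
  unfold Dg at *
  rw [fwdDiff_iter_add, hf, hg, add_zero]

theorem Dg_shift {d : ℕ} {f : ℕ → ZMod p} (hf : Dg d f) : Dg d (fun y => f (y + 1)) := by
  have h : (fun y => f (y + 1)) = f + fwdDiff 1 f := by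
    funext y; simp [fwdDiff]
  rw [h]
  refine Dg_add hf ?_
  rw [← Dg_succ]
  exact Dg_mono (Nat.le_succ d) hf

theorem Dg_mul (s : ℕ) : ∀ (d e : ℕ) (f g : ℕ → ZMod p), d + e = s → Dg (d + 1) f → Dg (e + 1) g →
    Dg (d + e + 1) (f * g) := by
  induction s with
  | zero =>
    intro d e f g hs hf hg
    obtain ⟨rfl, rfl⟩ : d = 0 ∧ e = 0 := by omega
    rw [Dg_succ] at *
    unfold Dg at *
    simp only [Nat.add_zero, Function.iterate_zero, id] at *
    funext y
    have h1 := congrFun hf y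
    have h2 := congrFun hg y
    simp only [fwdDiff, Pi.zero_apply, Pi.mul_apply, sub_eq_zero] at *
    rw [h1, h2]
  | succ s ih =>
    intro d e f g hs hf hg
    have key : fwdDiff 1 (f * g) = fwdDiff 1 f * g + (fun y => f (y + 1)) * fwdDiff 1 g := by
      funext y; simp only [fwdDiff, Pi.mul_apply, Pi.add_apply]; ring
    rw [Dg_succ, key]
    have z1 : ∀ f' g' : ℕ → ZMod p, Dg 0 f' → f' * g' = 0 := by
      intro f' g' h; unfold Dg at h; simp only [Function.iterate_zero, id] at h; rw [h, zero_mul]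
    have z2 : ∀ f' g' : ℕ → ZMod p, Dg 0 g' → f' * g' = 0 := by
      intro f' g' h; unfold Dg at h; simp only [Function.iterate_zero, id] at h; rw [h, mul_zero]
    refine Dg_add ?_ ?_
    · cases d with
      | zero => rw [z1 _ _ (Dg_succ.1 hf)]; exact Dg_zero_fun _
      | succ d =>
        have := ih d e _ g (by omega) (Dg_succ.1 hf) hg
        exact Dg_mono (by omega) this
    · cases e with
      | zero => rw [z2 _ _ (Dg_succ.1 hg)]; exact Dg_zero_fun _
      | succ e =>
        have := ih d e _ _ (by omega) (Dg_shift hf) (Dg_succ.1 hg)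
        exact Dg_mono (by omega) this

theorem Dg_ch (j : ℕ) : Dg (j + 1) (ch p j) := by
  induction j with
  | zero =>
    rw [Dg_succ]; unfold Dg; funext y; simp [fwdDiff, ch]
  | succ j ih =>
    rw [Dg_succ]
    convert ih using 1
    funext y
    simp [fwdDiff, ch, Nat.choose_succ_succ]

theorem Dg_expand {d : ℕ} {f : ℕ → ZMod p} (hf : Dg d f) :
    f = ∑ k ∈ Finset.range d, ((fwdDiff 1)^[k] f 0) • ch p k := by
  funext y
  have h := shift_eq_sum_fwdDiff_iter 1 f y 0
  have z : ∀ k, d ≤ k → (fwdDiff 1)^[k] f 0 = 0 := by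
    intro k hk
    have := Dg_mono hk hf
    unfold Dg at this
    rw [this]; rfl
  simp only [zero_add, smul_eq_mul, mul_one] at h
  rw [h, Finset.sum_apply]
  have e1 : ∑ k ∈ Finset.range (y+1), y.choose k • (fwdDiff 1)^[k] f 0
    = ∑ k ∈ Finset.range (max (y+1) d), y.choose k • (fwdDiff 1)^[k] f 0 := by
    refine Finset.sum_subset (by simp) ?_
    intro k _ hk
    simp only [Finset.mem_range, not_lt] at hk
    rw [Nat.choose_eq_zero_of_lt (by omega), zero_smul]
  have e2 : ∑ k ∈ Finset.range d, y.choose k • (fwdDiff 1)^[k] f 0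
    = ∑ k ∈ Finset.range (max (y+1) d), y.choose k • (fwdDiff 1)^[k] f 0 := by
    refine Finset.sum_subset (by simp) ?_
    intro k _ hk
    simp only [Finset.mem_range, not_lt] at hk
    rw [z k hk, smul_zero]
  rw [e1, ← e2]
  refine Finset.sum_congr rfl fun k _ => ?_
  simp [ch, mul_comm]

theorem PF_mem {d k : ℕ} {f : ℕ → ZMod p} (hf : Dg (d + 1) f) {g : List ℕ → ZMod p}
    (hg : g ∈ PS p k) : PF f g ∈ PS p (k + d + 1) := by
  rw [Dg_expand hf, PF_sum_left]
  refine Submodule.sum_mem _ fun i hi => ?_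
  rw [PF_smul_left]
  refine Submodule.smul_mem _ _ (PS_mono ?_ (PF_ch_mem hg))
  have := Finset.mem_range.1 hi
  omega

/-- binomial theorem for endomorphisms in characteristic `p` -/
theorem End_sub_one_pow {M : Type*} [AddCommGroup M] [Module (ZMod p) M]
    (U : Module.End (ZMod p) M) (r : ℕ) : (U - 1) ^ p ^ r = U ^ p ^ r - 1 := by
  rcases subsingleton_or_nontrivial M with h | h
  · exact Subsingleton.elim _ _
  · have : CharP (Module.End (ZMod p) M) p :=
      charP_of_injective_algebraMap (algebraMap (ZMod p) (Module.End (ZMod p) M)).injective p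
    rw [sub_pow_char_pow_of_commute p r (Commute.one_right U), one_pow]

theorem Dg_pow_iff {r : ℕ} {f : ℕ → ZMod p} : Dg (p ^ r) f ↔ ∀ y, f (y + p ^ r) = f y := by
  let E : Module.End (ZMod p) (ℕ → ZMod p) := LinearMap.funLeft (ZMod p) (ZMod p) Nat.succ
  have h1 : ∀ k (g : ℕ → ZMod p), (fwdDiff 1)^[k] g = ((E - 1) ^ k) g := by
    intro k
    induction k with
    | zero => intro g; rfl
    | succ k ih =>
      intro g
      rw [Function.iterate_succ_apply, ih, pow_succ, Module.End.mul_apply]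
      congr 1
  have h2 : ∀ k (g : ℕ → ZMod p) y, (E ^ k) g y = g (y + k) := by
    intro k
    induction k with
    | zero => intro g y; rfl
    | succ k ih =>
      intro g y
      rw [pow_succ, Module.End.mul_apply, ih]
      rfl
  unfold Dg
  rw [h1, End_sub_one_pow]
  constructor
  · intro h y
    have := congrFun h y
    simpa [h2, sub_eq_zero] using this
  · intro hf
    funext y
    simp [h2, hf]

end Fn
end HJ

namespace HJ

section Fn
variable {p : ℕ} [Fact p.Prime]

abbrev EndH (p : ℕ) [Fact p.Prime] := Module.End (ZMod p) (List ℕ → ZMod p)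

def TT (p : ℕ) [Fact p.Prime] : EndH p := LinearMap.funLeft (ZMod p) (ZMod p) (List.map Nat.succ)
def lam (p : ℕ) [Fact p.Prime] (y : ℕ) : EndH p :=
  LinearMap.funLeft (ZMod p) (ZMod p) (fun v => y :: v)
def phi (m : ℕ) (v : List ℕ) : List ℕ := v.flatMap fun y => List.replicate (m ^ m ^ y) y
def Phi (p : ℕ) [Fact p.Prime] (m : ℕ) : EndH p := LinearMap.funLeft (ZMod p) (ZMod p) (phi m)

theorem TT_apply (h : List ℕ → ZMod p) (v) : TT p h v = h (v.map Nat.succ) := rfl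
theorem lam_apply (y : ℕ) (h : List ℕ → ZMod p) (v) : lam p y h v = h (y :: v) := rfl
theorem Phi_apply (m : ℕ) (h : List ℕ → ZMod p) (v) : Phi p m h v = h (phi m v) := rfl

def Low (U : EndH p) : Prop := ∀ n, ∀ h ∈ PS p (n + 1), U h - h ∈ PS p n

theorem Low_of {U : EndH p} (hU : ∀ J, U (beta p J) - beta p J ∈ PS p (wt J)) : Low U := by
  intro n h hh
  have h1 : ∀ J, wt J < n + 1 → (U - 1) (beta p J) ∈ PS p n := fun J hJ =>
    PS_mono (a := wt J) (by omega) (by simpa using hU J)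
  simpa using PS_map (U - 1) h1 hh

theorem Low.mem {U : EndH p} (hU : Low U) {n : ℕ} {h : List ℕ → ZMod p} (hh : h ∈ PS p n) :
    U h ∈ PS p n := by
  cases n with
  | zero => rw [PS_zero hh, map_zero]; exact Submodule.zero_mem _
  | succ n =>
    have := Submodule.add_mem _ (PS_mono (Nat.le_succ n) (hU n h hh)) hh
    simpa using this

theorem Low.pow_mem {U : EndH p} (hU : Low U) {n : ℕ} (k : ℕ) {h : List ℕ → ZMod p}
    (hh : h ∈ PS p n) : (U ^ k) h ∈ PS p n := by
  induction k with
  | zero => exact hh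
  | succ k ih => rw [pow_succ', Module.End.mul_apply]; exact hU.mem ih

theorem Low.nil {U : EndH p} (hU : Low U) (k : ℕ) : ∀ {n : ℕ} {h : List ℕ → ZMod p},
    h ∈ PS p n → n ≤ k → ((U - 1) ^ k) h = 0 := by
  induction k with
  | zero =>
    intro n h hh hn
    obtain rfl : n = 0 := by omega
    rw [PS_zero hh, map_zero]
  | succ k ih =>
    intro n h hh hn
    cases n with
    | zero => rw [PS_zero hh, map_zero]
    | succ n =>
      rw [pow_succ, Module.End.mul_apply]
      refine ih (n := n) ?_ (by omega)
      simpa using hU n h hh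

theorem Low.pow_eq {U : EndH p} (hU : Low U) {n r : ℕ} {h : List ℕ → ZMod p}
    (hh : h ∈ PS p n) (hn : n ≤ p ^ r) : (U ^ p ^ r) h = h := by
  have := hU.nil _ hh hn
  rw [End_sub_one_pow] at this
  simpa [sub_eq_zero] using this

theorem lam_beta (y j : ℕ) (J : List ℕ) :
    lam p y (beta p (j :: J)) = beta p (j :: J) + ch p j y • beta p J := by
  funext v
  simp [lam_apply, beta, PF]

theorem lam_PF (y : ℕ) (f : ℕ → ZMod p) (g : List ℕ → ZMod p) :
    lam p y (PF f g) = PF f g + f y • g := by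
  funext v
  simp [lam_apply, PF]

theorem lam_low (y : ℕ) : Low (lam p y) := by
  refine Low_of fun J => ?_
  cases J with
  | nil =>
    have : lam p y (beta p []) - beta p [] = 0 := by funext v; simp [lam_apply, beta]
    rw [this]; exact Submodule.zero_mem _
  | cons j J =>
    rw [lam_beta, add_sub_cancel_left]
    exact Submodule.smul_mem _ _ (beta_mem (by simp only [wt]; omega))

theorem TT_PF (f : ℕ → ZMod p) (g : List ℕ → ZMod p) :
    TT p (PF f g) = PF (fun y => f (y + 1)) (TT p g) := by
  funext v
  rw [TT_apply]
  induction v with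
  | nil => simp [PF]
  | cons y v ih => simp only [List.map_cons, PF, ih]; rfl

theorem ch_succ_shift (j : ℕ) : (fun y => ch p (j + 1) (y + 1)) = ch p (j + 1) + ch p j := by
  funext y
  simp [ch, Nat.choose_succ_succ, add_comm]

theorem TT_PF_succ (j : ℕ) (g : List ℕ → ZMod p) :
    TT p (PF (ch p (j + 1)) g) = PF (ch p (j + 1)) (TT p g) + PF (ch p j) (TT p g) := by
  rw [TT_PF, ch_succ_shift, PF_add_left]

theorem TT_PF_zero (g : List ℕ → ZMod p) : TT p (PF (ch p 0) g) = PF (ch p 0) (TT p g) := by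
  rw [TT_PF]; congr 1; funext y; simp [ch]

theorem TT_low : Low (TT p) := by
  refine Low_of fun J => ?_
  induction J with
  | nil =>
    have : TT p (beta p []) - beta p [] = 0 := by funext v; simp [TT_apply, beta]
    rw [this]; exact Submodule.zero_mem _
  | cons j J ih =>
    have hT : TT p (beta p J) ∈ PS p (wt J + 1) := by
      have := Submodule.add_mem _ (PS_mono (Nat.le_succ _) ih) (beta_mem (p := p) (Nat.lt_succ_self (wt J)))
      simpa using this
    have h1 : PF (ch p j) (TT p (beta p J) - beta p J) ∈ PS p (wt (j :: J)) :=
      PS_mono (by simp only [wt]; omega) (PF_ch_mem (j := j) ih)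
    rw [PF_sub] at h1
    cases j with
    | zero => simpa only [beta, TT_PF_zero] using h1
    | succ j =>
      have h2 : PF (ch p j) (TT p (beta p J)) ∈ PS p (wt ((j + 1) :: J)) :=
        PS_mono (by simp only [wt]; omega) (PF_ch_mem (j := j) hT)
      have := Submodule.add_mem _ h1 h2
      simp only [beta, TT_PF_succ]
      convert this using 1
      abel

def pr (p y : ℕ) (J : List ℕ) : ZMod p := (J.map fun j => ch p j y).prod

theorem beta_replicate (y s : ℕ) (v : List ℕ) : ∀ J : List ℕ,
    beta p J (List.replicate s y ++ v) = ∑ l ∈ Finset.range (J.length + 1),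
      (s.choose l : ZMod p) * pr p y (J.take l) * beta p (J.drop l) v := by
  induction s with
  | zero =>
    intro J
    rw [Finset.sum_range_succ']
    simp [pr]
  | succ s ih =>
    intro J
    cases J with
    | nil => simp [beta, pr]
    | cons j J =>
      have e : beta p (j :: J) (List.replicate (s + 1) y ++ v)
          = beta p (j :: J) (List.replicate s y ++ v)
            + ch p j y * beta p J (List.replicate s y ++ v) := by
        simp [List.replicate_succ, beta, PF]
      rw [e, ih, ih, List.length_cons, Finset.sum_range_succ', Finset.sum_range_succ' _ (J.length + 1),
        Finset.mul_sum, add_right_comm, ← Finset.sum_add_distrib]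
      congr 1
      · refine Finset.sum_congr rfl fun l _ => ?_
        simp only [List.take_succ_cons, List.drop_succ_cons, pr, List.map_cons, List.prod_cons,
          Nat.choose_succ_succ, Nat.cast_add]
        ring
      · simp

theorem Phi_beta (m j : ℕ) (J : List ℕ) :
    Phi p m (beta p (j :: J)) = ∑ l ∈ Finset.range (J.length + 1),
      PF (fun y => ((m ^ m ^ y).choose (l + 1) : ZMod p) * pr p y ((j :: J).take (l + 1)))
        (Phi p m (beta p (J.drop l))) := by
  funext v
  rw [Phi_apply, Finset.sum_apply]
  induction v with
  | nil => simp [phi, beta, PF]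
  | cons y v ih =>
    have e : phi m (y :: v) = List.replicate (m ^ m ^ y) y ++ phi m v := by simp [phi]
    rw [e, beta_replicate, List.length_cons, Finset.sum_range_succ']
    simp only [PF, Finset.sum_add_distrib, ← ih]
    rw [add_comm]
    congr 1
    simp [pr]

theorem one_pow_modEq {m : ℕ} (hm : m ≡ 1 [MOD p]) (i : ℕ) : m ^ p ^ i ≡ 1 [MOD p ^ (i + 1)] := by
  have h1 : (p : ℤ) ∣ (m : ℤ) - 1 := by
    have := (Nat.modEq_iff_dvd.1 hm.symm); simpa using this
  have h2 := dvd_sub_pow_of_dvd_sub h1 i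
  refine (Nat.modEq_iff_dvd.2 ?_).symm
  push_cast
  simpa using h2

theorem ch_modEq {l r a b : ℕ} (hl : l < p ^ r) (hab : a ≡ b [MOD p ^ r]) :
    ch p l a = ch p l b := by
  have h := Dg_pow_iff.1 (Dg_mono (Nat.succ_le_of_lt hl) (Dg_ch (p := p) l))
  have h' : ∀ c y, ch p l (y + p ^ r * c) = ch p l y := by
    intro c
    induction c with
    | zero => intro y; simp
    | succ c ih => intro y; rw [Nat.mul_succ, ← add_assoc, h, ih]
  rw [← Nat.mod_add_div a (p ^ r), ← Nat.mod_add_div b (p ^ r), h', h', hab]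

theorem pow_pow_modEq {m : ℕ} (hm : m ≡ 1 [MOD p]) (i y : ℕ) :
    m ^ m ^ (y + p ^ i) ≡ m ^ m ^ y [MOD p ^ (i + 1)] := by
  have hm0 : 0 < p := (Fact.out : p.Prime).pos
  have h1 : m ^ y ≡ m ^ (y + p ^ i) [MOD p ^ i] := by
    have := (one_pow_modEq hm i).mul_left (m ^ y)
    rw [← pow_add, mul_one] at this
    exact (this.of_dvd (pow_dvd_pow p (Nat.le_succ i))).symm
  rcases Nat.eq_zero_or_pos m with rfl | hpos
  · have : p ∣ 1 := by
      have := (Nat.modEq_iff_dvd' (by norm_num)).1 hm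
      simpa using this
    have := (Fact.out : p.Prime).one_lt
    have := Nat.le_of_dvd one_pos ‹p ∣ 1›
    omega
  have hle : m ^ y ≤ m ^ (y + p ^ i) := Nat.pow_le_pow_right hpos (by omega)
  obtain ⟨c, hc⟩ := (Nat.modEq_iff_dvd' hle).1 h1
  have e : m ^ (y + p ^ i) = m ^ y + p ^ i * c := by omega
  rw [e, pow_add m, pow_mul]
  have := ((one_pow_modEq hm i).pow c).mul_left (m ^ m ^ y)
  simpa using this

theorem Dg_choose {m : ℕ} (hm : m ≡ 1 [MOD p]) (l : ℕ) :
    Dg (l + 1) (fun y => ((m ^ m ^ y).choose (l + 1) : ZMod p)) := by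
  have hp := (Fact.out : p.Prime).one_lt
  set i := Nat.log p (l + 1)
  have h1 : p ^ i ≤ l + 1 := Nat.pow_log_le_self p (by omega)
  have h2 : l + 1 < p ^ (i + 1) := Nat.lt_pow_succ_log_self hp _
  refine Dg_mono h1 (Dg_pow_iff.2 fun y => ?_)
  exact ch_modEq h2 (pow_pow_modEq hm i y)

theorem Dg_pr (J : List ℕ) : Dg (J.sum + 1) (fun y => pr p y J) := by
  induction J with
  | nil =>
    have : (fun y => pr p y []) = ch p 0 := by funext y; simp [pr, ch]
    rw [this]; exact Dg_ch 0
  | cons j J ih =>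
    have : (fun y => pr p y (j :: J)) = ch p j * fun y => pr p y J := by
      funext y; simp [pr]
    rw [this, List.sum_cons]
    exact Dg_mul _ _ _ _ _ rfl (Dg_ch j) ih

theorem wt_eq (J : List ℕ) : wt J = J.length + J.sum := by
  induction J with
  | nil => rfl
  | cons j J ih => simp only [wt, ih, List.length_cons, List.sum_cons]; omega

theorem wt_append (J K : List ℕ) : wt (J ++ K) = wt J + wt K := by
  simp only [wt_eq, List.length_append, List.sum_append]; omega

theorem Phi_beta_mem {m : ℕ} (hm : m ≡ 1 [MOD p]) : ∀ (N : ℕ) (J : List ℕ), J.length ≤ N →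
    Phi p m (beta p J) ∈ PS p (wt J + 1) := by
  intro N
  induction N with
  | zero =>
    intro J hJ
    obtain rfl : J = [] := List.length_eq_zero_iff.1 (by omega)
    exact const_mem 1 (by omega)
  | succ N ih =>
    intro J hJ
    cases J with
    | nil => exact const_mem 1 (by omega)
    | cons j J =>
      rw [Phi_beta]
      refine Submodule.sum_mem _ fun l hl => ?_
      have hl' : l ≤ J.length := by have := Finset.mem_range.1 hl; omega
      have hJ' : J.length ≤ N := by simpa using hJ
      have h1 := ih (J.drop l) (by rw [List.length_drop]; omega)
      have h2 := Dg_mul _ _ _ _ _ rfl (Dg_choose hm l) (Dg_pr ((j :: J).take (l + 1)))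
      have h3 := PF_mem h2 h1
      refine PS_mono ?_ h3
      have e := wt_append ((j :: J).take (l + 1)) ((j :: J).drop (l + 1))
      rw [List.take_append_drop, wt_eq ((j :: J).take (l + 1)), List.length_take] at e
      rw [List.drop_succ_cons] at e
      simp only [List.length_cons] at e
      omega

theorem Phi_mem {m : ℕ} (hm : m ≡ 1 [MOD p]) {n : ℕ} {h : List ℕ → ZMod p} (hh : h ∈ PS p n) :
    Phi p m h ∈ PS p n :=
  PS_map (Phi p m) (fun J hJ => PS_mono hJ (Phi_beta_mem hm _ J le_rfl)) hh

end Fn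
end HJ

namespace HJ

section Fn
variable {p : ℕ} [Fact p.Prime]

theorem lam_pow_apply (y k : ℕ) (h : List ℕ → ZMod p) (v : List ℕ) :
    (lam p y ^ k) h v = h (List.replicate k y ++ v) := by
  induction k generalizing v with
  | zero => rfl
  | succ k ih =>
    rw [pow_succ', Module.End.mul_apply, lam_apply, ih]
    congr 1
    rw [List.replicate_succ', List.append_assoc]
    rfl

theorem TT_pow_apply (k : ℕ) (h : List ℕ → ZMod p) (v : List ℕ) :
    (TT p ^ k) h v = h (v.map fun y => y + k) := by
  induction k generalizing v with
  | zero => simp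
  | succ k ih =>
    rw [pow_succ', Module.End.mul_apply, TT_apply, ih, List.map_map]
    congr 2
    funext y
    simp only [Function.comp]; omega

theorem replicate_eq {n r c y : ℕ} (hc : c ≡ 1 [MOD p ^ r]) (hn : n ≤ p ^ r)
    {h : List ℕ → ZMod p} (hh : h ∈ PS p n) (hc1 : 1 ≤ c) (v : List ℕ) :
    h (List.replicate c y ++ v) = h (y :: v) := by
  obtain ⟨d, hd⟩ := (Nat.modEq_iff_dvd' hc1).1 hc.symm
  have e : c = p ^ r * d + 1 := by omega
  have h1 : ∀ d, (lam p y ^ (p ^ r * d)) h = h := by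
    intro d
    induction d with
    | zero => simp
    | succ d ih =>
      rw [Nat.mul_succ, pow_add, Module.End.mul_apply, (lam_low y).pow_eq hh hn, ih]
  have h2 := lam_pow_apply y c h v
  rw [e, pow_succ', Module.End.mul_apply, h1, lam_apply] at h2
  rw [e, h2]

theorem flat_eq {n r : ℕ} (c : ℕ → ℕ) (hc : ∀ y, c y ≡ 1 [MOD p ^ r]) (hc1 : ∀ y, 1 ≤ c y)
    (hn : n ≤ p ^ r) (v : List ℕ) : ∀ {h : List ℕ → ZMod p}, h ∈ PS p n →
    h (v.flatMap fun y => List.replicate (c y) y) = h v := by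
  induction v with
  | nil => intro h _; rfl
  | cons y v ih =>
    intro h hh
    rw [List.flatMap_cons, replicate_eq (hc y) hn hh (hc1 y)]
    exact ih ((lam_low y).mem hh)

theorem flat_replicate (k y : ℕ) (c : ℕ → ℕ) :
    ((List.replicate k y).flatMap fun y => List.replicate (c y) y) = List.replicate (k * c y) y := by
  induction k with
  | zero => simp
  | succ k ih =>
    rw [List.replicate_succ, List.flatMap_cons, ih, List.replicate_append_replicate]
    congr 1; ring

theorem Phi_pow_apply (m k : ℕ) (h : List ℕ → ZMod p) (v : List ℕ) :
    (Phi p m ^ k) h v = h (v.flatMap fun y => List.replicate ((m ^ m ^ y) ^ k) y) := by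
  induction k generalizing v with
  | zero => simp
  | succ k ih =>
    rw [pow_succ', Module.End.mul_apply, Phi_apply, ih]
    congr 1
    unfold phi
    rw [List.flatMap_assoc]
    congr 1
    funext y
    rw [flat_replicate, pow_succ']

theorem Phi_pow_eq {m : ℕ} (hm : m ≡ 1 [MOD p]) (hm0 : 0 < m) {n r : ℕ} (hn : n ≤ p ^ r)
    {h : List ℕ → ZMod p} (hh : h ∈ PS p n) : (Phi p m ^ p ^ r) h = h := by
  funext v
  rw [Phi_pow_apply]
  refine flat_eq (r := r) (fun y => (m ^ m ^ y) ^ p ^ r) (fun y => ?_) (fun y => ?_) hn v hh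
  · have h1 : m ^ m ^ y ≡ 1 [MOD p] := by simpa using hm.pow (m ^ y)
    exact (one_pow_modEq h1 r).of_dvd (pow_dvd_pow p (Nat.le_succ r))
  · exact Nat.one_le_pow _ _ (by positivity)

theorem lam_Phi (m : ℕ) (h : List ℕ → ZMod p) :
    lam p 0 (Phi p m h) = Phi p m ((lam p 0 ^ m) h) := by
  funext v
  rw [lam_apply, Phi_apply, Phi_apply, lam_pow_apply]
  simp [phi]

theorem TT_Phi (m : ℕ) (h : List ℕ → ZMod p) :
    TT p (Phi p m h) = (Phi p m ^ m) (TT p h) := by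
  funext v
  rw [TT_apply, Phi_apply, Phi_pow_apply, TT_apply]
  congr 1
  unfold phi
  rw [List.flatMap_map, List.map_flatMap]
  congr 1
  funext y
  simp only [Function.comp, List.map_replicate]
  congr 1
  rw [← pow_mul, Nat.succ_eq_add_one, pow_succ]

theorem periodic {n r : ℕ} (hn : n ≤ p ^ r) (y : ℕ) {h : List ℕ → ZMod p} (hh : h ∈ PS p n)
    (v : List ℕ) : h ((y * p ^ r) :: v) = h (0 :: v) := by
  have h1 : ∀ J, wt J < n → (lam p (y * p ^ r) - lam p 0) (beta p J) ∈ PS p 0 := by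
    intro J hJ
    have : (lam p (y * p ^ r) - lam p 0) (beta p J) = 0 := by
      cases J with
      | nil => funext v; simp [lam_apply, beta]
      | cons j J =>
        have hj : j < p ^ r := by simp only [wt] at hJ; omega
        have : ch p j (y * p ^ r) = ch p j 0 := ch_modEq hj (by simp [Nat.ModEq])
        simp [lam_beta, this]
    rw [this]; exact Submodule.zero_mem _
  have h2 := PS_zero (PS_map _ h1 hh)
  have h3 := congrFun h2 v
  simpa [lam_apply, sub_eq_zero] using h3

theorem const_of {n r : ℕ} (hn : n ≤ p ^ r) {h : List ℕ → ZMod p} (hh : h ∈ PS p n)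
    (h0 : lam p 0 h = h) (h1 : TT p h = h) (v : List ℕ) : h v = h [] := by
  have hk : ∀ k, (TT p ^ k) h = h := by
    intro k
    induction k with
    | zero => rfl
    | succ k ih => rw [pow_succ, Module.End.mul_apply, h1, ih]
  have hk' : ∀ k v, h (v.map fun y => y + k) = h v := by
    intro k v
    have := TT_pow_apply k h v
    rw [hk] at this
    exact this.symm
  induction v with
  | nil => rfl
  | cons y v ih =>
    have hp : 1 ≤ p ^ r := Nat.one_le_pow _ _ (Fact.out : p.Prime).pos
    obtain ⟨k, hk2⟩ : ∃ k, y + k = y * p ^ r :=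
      ⟨y * p ^ r - y, Nat.add_sub_cancel' (Nat.le_mul_of_pos_right y hp)⟩
    rw [← hk' k, List.map_cons, hk2, periodic hn y hh]
    have := congrFun h0 (v.map fun y => y + k)
    rw [lam_apply] at this
    rw [this, hk', ih]

def op (p : ℕ) [Fact p.Prime] : Bool → EndH p
  | true => lam p 0 - 1
  | false => TT p - 1

def Th (p : ℕ) [Fact p.Prime] : List Bool → ((List ℕ → ZMod p) →ₗ[ZMod p] ZMod p)
  | [] => (LinearMap.proj ([0] : List ℕ) : (List ℕ → ZMod p) →ₗ[ZMod p] ZMod p)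
      - LinearMap.proj ([] : List ℕ)
  | c :: w => Th p w ∘ₗ op p c

theorem op_mem (c : Bool) {n : ℕ} {h : List ℕ → ZMod p} (hh : h ∈ PS p (n + 1)) :
    op p c h ∈ PS p n := by
  cases c with
  | true => simpa [op] using lam_low 0 n h hh
  | false => simpa [op] using TT_low n h hh

theorem Th_vanish (w : List Bool) : ∀ {n : ℕ} {h : List ℕ → ZMod p}, h ∈ PS p (n + 1) →
    n ≤ w.length → Th p w h = 0 := by
  induction w with
  | nil =>
    intro n h hh hn
    obtain rfl : n = 0 := by simpa using hn
    simp [Th, PS_one hh [0]]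
  | cons c w ih =>
    intro n h hh hn
    rw [Th, LinearMap.comp_apply]
    have h1 := op_mem c hh
    cases n with
    | zero => rw [PS_zero h1, map_zero]
    | succ n => exact ih h1 (by simpa using hn)

theorem Th_inj {r : ℕ} : ∀ (n : ℕ), n + 1 ≤ p ^ r → ∀ {h : List ℕ → ZMod p}, h ∈ PS p (n + 1) →
    (∀ w, Th p w h = 0) → ∀ v, h v = h [] := by
  intro n
  induction n with
  | zero => intro _ h hh _ v; exact PS_one hh v
  | succ n ih =>
    intro hn h hh hw
    have hX := ih (by omega) (op_mem true hh) (fun w => hw (true :: w))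
    have hZ := ih (by omega) (op_mem false hh) (fun w => hw (false :: w))
    have e1 := hw []
    simp only [Th, LinearMap.sub_apply, LinearMap.proj_apply] at e1
    refine const_of hn hh ?_ ?_
    · funext v
      have := hX v
      simp only [op, LinearMap.sub_apply, Pi.sub_apply, Module.End.one_apply, lam_apply] at this ⊢
      rw [e1] at this
      exact sub_eq_zero.1 this
    · funext v
      have := hZ v
      simp only [op, LinearMap.sub_apply, Pi.sub_apply, Module.End.one_apply, TT_apply,
        List.map_nil, sub_self] at this ⊢
      exact sub_eq_zero.1 this

theorem solve_PF (k : ℕ) : ∀ (j : ℕ) (g : List ℕ → ZMod p), g ∈ PS p k →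
    ∃ h ∈ PS p (k + j + 2), op p true h = 0 ∧ op p false h = PF (ch p j) g := by
  induction k with
  | zero =>
    intro j g hg
    rw [PS_zero hg]
    exact ⟨0, Submodule.zero_mem _, map_zero _, by rw [map_zero, PF_zero]⟩
  | succ k ih =>
    intro j g hg
    obtain ⟨r, hr⟩ : ∃ r, k + 1 ≤ p ^ r := ⟨k + 1, (Nat.lt_pow_self (Fact.out : p.Prime).one_lt).le⟩
    obtain ⟨g', hg', e⟩ : ∃ g' ∈ PS p (k + 1), TT p g' = g := by
      refine ⟨(TT p ^ (p ^ r - 1)) g, TT_low.pow_mem _ hg, ?_⟩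
      rw [← Module.End.mul_apply, ← pow_succ', Nat.sub_add_cancel (by omega), TT_low.pow_eq hg hr]
    obtain ⟨h2, hh2, a2, b2⟩ := ih (j + 1) _ (TT_low k g' hg')
    refine ⟨PF (ch p (j + 1)) g' - h2, ?_, ?_, ?_⟩
    · refine Submodule.sub_mem _ (PS_mono ?_ (PF_ch_mem hg')) (PS_mono ?_ hh2) <;> omega
    · rw [map_sub, a2, sub_zero]
      simp [op, lam_PF, ch]
    · rw [map_sub, b2]
      simp only [op, LinearMap.sub_apply, Module.End.one_apply, TT_PF_succ, PF_sub, e]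
      abel

theorem solve {n : ℕ} {g : List ℕ → ZMod p} (hg : g ∈ PS p n) :
    ∃ h ∈ PS p (n + 1), op p true h = 0 ∧ op p false h = g - fun _ => g [] := by
  induction hg using Submodule.span_induction with
  | mem x hx =>
    obtain ⟨J, hJ, rfl⟩ := hx
    cases J with
    | nil =>
      refine ⟨0, Submodule.zero_mem _, map_zero _, ?_⟩
      funext v; simp [beta]
    | cons j J =>
      obtain ⟨h, hh, a, b⟩ := solve_PF (wt J + 1) j (beta p J) (beta_mem (Nat.lt_succ_self _))
      refine ⟨h, PS_mono ?_ hh, a, ?_⟩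
      · simp only [Set.mem_ofPred_eq, wt] at hJ; omega
      · rw [b]; funext v; simp [beta, PF]
  | zero => exact ⟨0, Submodule.zero_mem _, map_zero _, by funext v; simp⟩
  | add x y _ _ hx hy =>
    obtain ⟨h, hh, a, b⟩ := hx
    obtain ⟨h', hh', a', b'⟩ := hy
    refine ⟨h + h', Submodule.add_mem _ hh hh', by rw [map_add, a, a', add_zero], ?_⟩
    rw [map_add, b, b']; funext v; simp only [Pi.add_apply, Pi.sub_apply]; ring
  | smul c x _ hx =>
    obtain ⟨h, hh, a, b⟩ := hx
    refine ⟨c • h, Submodule.smul_mem _ _ hh, by rw [map_smul, a, smul_zero], ?_⟩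
    rw [map_smul, b]; funext v; simp only [Pi.smul_apply, Pi.sub_apply, smul_eq_mul]; ring

theorem Th_const (c : ZMod p) (w : List Bool) : Th p w (fun _ => c) = 0 :=
  Th_vanish w (n := 0) (const_mem c (by omega)) (by omega)

theorem Th_surj (n : ℕ) : ∀ q : List Bool → ZMod p, (∀ w, n ≤ w.length → q w = 0) →
    ∃ h ∈ PS p (n + 1), ∀ w, Th p w h = q w := by
  induction n with
  | zero =>
    intro q hq
    exact ⟨0, Submodule.zero_mem _, fun w => by rw [map_zero, hq w (Nat.zero_le _)]⟩
  | succ n ih =>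
    intro q hq
    obtain ⟨hX, mX, eX⟩ := ih (fun w => q (true :: w)) (fun w hw => hq _ (by simpa using hw))
    obtain ⟨hZ, mZ, eZ⟩ := ih (fun w => q (false :: w)) (fun w hw => hq _ (by simpa using hw))
    set g1 : List ℕ → ZMod p := hX + fun _ => (q [] - hX []) with hg1
    have m1 : g1 ∈ PS p (n + 1) := Submodule.add_mem _ mX (const_mem _ (by omega))
    set h1 := PF (ch p 0) g1 with hh1
    have mh1 : h1 ∈ PS p (n + 2) := PS_mono (by omega) (PF_ch_mem (j := 0) m1)
    obtain ⟨h2, mh2, a, b⟩ := solve (Submodule.sub_mem _ mZ (op_mem false mh1))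
    have aX : op p true (h1 + h2) = g1 := by
      rw [map_add, a, add_zero, hh1]
      simp [op, lam_PF, ch]
    have aZ : ∃ c : ZMod p, op p false (h1 + h2) = hZ + fun _ => c := by
      refine ⟨- (hZ - op p false h1) [], ?_⟩
      rw [map_add, b]; funext v; simp only [Pi.add_apply, Pi.sub_apply]; ring
    obtain ⟨c, aZ⟩ := aZ
    refine ⟨h1 + h2, Submodule.add_mem _ mh1 mh2, fun w => ?_⟩
    cases w with
    | nil =>
      have := congrFun aX []
      simp only [op, LinearMap.sub_apply, Pi.sub_apply, Module.End.one_apply, lam_apply] at this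
      simp only [Th, LinearMap.sub_apply, LinearMap.proj_apply]
      rw [this]
      simp [hg1]
    | cons c' w =>
      rw [Th, LinearMap.comp_apply]
      cases c' with
      | true => rw [aX, map_add, eX, Th_const, add_zero]
      | false => rw [aZ, map_add, eZ, Th_const, add_zero]

end Fn
end HJ

namespace HJ

section Gp
variable {p : ℕ} [Fact p.Prime]

def WW (p : ℕ) [Fact p.Prime] (n : ℕ) : Submodule (ZMod p) (List Bool → ZMod p) where
  carrier := {q | ∀ w, n ≤ w.length → q w = 0}
  add_mem' := by
    intro a b ha hb w hw
    rw [Pi.add_apply, ha w hw, hb w hw, add_zero]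
  zero_mem' := fun _ _ => rfl
  smul_mem' := by
    intro c a ha w hw
    rw [Pi.smul_apply, ha w hw, smul_zero]

theorem WW_finite (n : ℕ) : Finite (WW p n) := by
  have : Finite {w : List Bool // w.length < n} := (List.finite_length_lt Bool n).to_subtype
  refine Finite.of_injective
    (fun (q : WW p n) (w : {w : List Bool // w.length < n}) => q.1 w.1) ?_
  intro q q' h
  ext w
  by_cases hw : w.length < n
  · exact congrFun h ⟨w, hw⟩
  · rw [q.2 w (by omega), q'.2 w (by omega)]

theorem WWEnd_finite (n : ℕ) : Finite (Module.End (ZMod p) (WW p n))ˣ := by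
  have := WW_finite (p := p) n
  have : Finite (Module.End (ZMod p) (WW p n)) :=
    Finite.of_injective (fun f => (f : WW p n → WW p n)) DFunLike.coe_injective
  infer_instance

/-- shift by a letter -/
def sh (p : ℕ) [Fact p.Prime] (n : ℕ) (c : Bool) : Module.End (ZMod p) (WW p n) where
  toFun q := ⟨fun w => q.1 (c :: w), fun w hw => q.2 _ (by simp; omega)⟩
  map_add' _ _ := rfl
  map_smul' _ _ := rfl

def sw (p : ℕ) [Fact p.Prime] (n : ℕ) : Module.End (ZMod p) (WW p n) where
  toFun q := ⟨fun w => q.1 (w.map not), fun w hw => q.2 _ (by simpa using hw)⟩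
  map_add' _ _ := rfl
  map_smul' _ _ := rfl

theorem sw_sw (n : ℕ) : sw p n * sw p n = 1 := by
  ext q w
  simp only [sw, Module.End.mul_apply, LinearMap.coe_mk, AddHom.coe_mk, Module.End.one_apply,
    List.map_map]
  congr 1
  have : not ∘ not = id := by funext b; simp
  rw [this, List.map_id]

theorem sw_sh (n : ℕ) (c : Bool) : sw p n * sh p n c = sh p n (!c) * sw p n := by
  ext q w
  simp [sw, sh, Module.End.mul_apply]

theorem sh_pow (n k : ℕ) (c : Bool) (q : WW p n) (w : List Bool) :
    ((sh p n c ^ k) q).1 w = q.1 (List.replicate k c ++ w) := by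
  induction k generalizing w with
  | zero => rfl
  | succ k ih =>
    rw [pow_succ', Module.End.mul_apply]
    refine (ih (c :: w)).trans ?_
    congr 1
    rw [List.replicate_succ', List.append_assoc]
    rfl

theorem sh_pow_eq_zero {n k : ℕ} (h : n ≤ k) (c : Bool) : sh p n c ^ k = 0 := by
  ext q w
  rw [sh_pow]
  exact q.2 _ (by simp; omega)

theorem sh_pow_ne_zero {n k : ℕ} (h : k < n) (c : Bool) : sh p n c ^ k ≠ 0 := by
  classical
  intro h0
  let q : WW p n := ⟨fun w => if w = List.replicate k c then 1 else 0, fun w hw => by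
    refine if_neg ?_
    rintro rfl
    simp at hw; omega⟩
  have h1 := sh_pow n k c q []
  rw [h0] at h1
  simp [q] at h1

theorem add_sh_pow (n r : ℕ) (c : Bool) :
    (1 + sh p n c) ^ p ^ r = 1 + sh p n c ^ p ^ r := by
  have := End_sub_one_pow (1 + sh p n c) r
  rw [add_sub_cancel_left] at this
  rw [this]; abel

/-- the quotient map -/
def Theta (p : ℕ) [Fact p.Prime] (n : ℕ) : PS p (n + 1) →ₗ[ZMod p] WW p n where
  toFun h := ⟨fun w => Th p w h.1, fun w hw => Th_vanish w h.2 hw⟩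
  map_add' _ _ := by ext w; exact map_add _ _ _
  map_smul' _ _ := by ext w; exact map_smul _ _ _

theorem Theta_surj (n : ℕ) : Function.Surjective (Theta p n) := by
  intro q
  obtain ⟨h, hh, e⟩ := Th_surj n q.1 q.2
  exact ⟨⟨h, hh⟩, by ext w; exact e w⟩

theorem Theta_ker {n r : ℕ} (hr : n + 1 ≤ p ^ r) {h : PS p (n + 1)} (h0 : Theta p n h = 0)
    (v : List ℕ) : h.1 v = h.1 [] :=
  Th_inj n hr h.2 (fun w => congrFun (congrArg Subtype.val h0) w) v

/-- restriction to `PS` -/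
def res {n : ℕ} (U : EndH p) (hU : ∀ h ∈ PS p n, U h ∈ PS p n) :
    Module.End (ZMod p) (PS p n) := U.restrict hU

theorem res_pow {n : ℕ} (U : EndH p) (hU : ∀ h ∈ PS p n, U h ∈ PS p n) (k : ℕ) (h : PS p n) :
    ((res U hU ^ k) h).1 = (U ^ k) h.1 := by
  induction k generalizing h with
  | zero => rfl
  | succ k ih =>
    rw [pow_succ, pow_succ, Module.End.mul_apply, Module.End.mul_apply, ih]
    rfl

theorem ops (m n r : ℕ) (hm : m ≡ 1 [MOD p]) (hm0 : 0 < m) (hr : n + 1 ≤ p ^ r) :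
    ∃ F : Module.End (ZMod p) (WW p n), F ^ p ^ r = 1 ∧
      (1 + sh p n true) * F = F * (1 + sh p n true) ^ m ∧
      (1 + sh p n false) * F = F ^ m * (1 + sh p n false) := by
  obtain ⟨Ψ, hΨ⟩ := (Theta p n).exists_rightInverse_of_surjective
    (LinearMap.range_eq_top.2 (Theta_surj n))
  have hΨ' : ∀ q, Theta p n (Ψ q) = q := fun q => LinearMap.congr_fun hΨ q
  let P := res (n := n + 1) (Phi p m) (fun h hh => Phi_mem hm hh)
  let A := res (n := n + 1) (lam p 0) (fun h hh => (lam_low 0).mem hh)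
  let Z := res (n := n + 1) (TT p) (fun h hh => TT_low.mem hh)
  let F : Module.End (ZMod p) (WW p n) := Theta p n ∘ₗ P ∘ₗ Ψ
  have hA : ∀ h, Theta p n (A h) = (1 + sh p n true) (Theta p n h) := by
    intro h; ext w
    have : Th p (true :: w) h.1 = Th p w (lam p 0 h.1) - Th p w h.1 := by
      rw [← map_sub]; rfl
    change Th p w (lam p 0 h.1) = Th p w h.1 + Th p (true :: w) h.1
    rw [this]; abel
  have hZ : ∀ h, Theta p n (Z h) = (1 + sh p n false) (Theta p n h) := by
    intro h; ext w
    have : Th p (false :: w) h.1 = Th p w (TT p h.1) - Th p w h.1 := by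
      rw [← map_sub]; rfl
    change Th p w (TT p h.1) = Th p w h.1 + Th p (false :: w) h.1
    rw [this]; abel
  have hF : ∀ h, Theta p n (P h) = F (Theta p n h) := by
    intro h
    have h1 : Theta p n (h - Ψ (Theta p n h)) = 0 := by rw [map_sub, hΨ', sub_self]
    have h2 := Theta_ker hr h1
    have h3 : P (h - Ψ (Theta p n h)) = h - Ψ (Theta p n h) := by
      ext v
      change (h - Ψ (Theta p n h)).1 (phi m v) = _
      rw [h2, ← h2 v]
    have h4 := congrArg (Theta p n) h3
    rw [h1, map_sub, map_sub, sub_eq_zero] at h4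
    exact h4
  have powT : ∀ (U : Module.End (ZMod p) (PS p (n + 1))) (V : Module.End (ZMod p) (WW p n)),
      (∀ h, Theta p n (U h) = V (Theta p n h)) →
      ∀ k h, Theta p n ((U ^ k) h) = (V ^ k) (Theta p n h) := by
    intro U V hUV k
    induction k with
    | zero => intro h; rfl
    | succ k ih => intro h; rw [pow_succ, pow_succ, Module.End.mul_apply, Module.End.mul_apply,
        ih, hUV]
  have key : ∀ V V' : Module.End (ZMod p) (WW p n),
      (∀ h, V (Theta p n h) = V' (Theta p n h)) → V = V' := by
    intro V V' hV
    refine LinearMap.ext fun q => ?_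
    obtain ⟨h, rfl⟩ := Theta_surj n q
    exact hV h
  refine ⟨F, key _ _ fun h => ?_, key _ _ fun h => ?_, key _ _ fun h => ?_⟩
  · rw [← powT P F hF, Module.End.one_apply]
    refine congrArg (Theta p n) ?_
    apply Subtype.ext
    rw [res_pow]
    exact Phi_pow_eq hm hm0 hr h.2
  · rw [Module.End.mul_apply, Module.End.mul_apply, ← hF, ← hA, ← powT A _ hA, ← hF]
    congr 1
    apply Subtype.ext
    change lam p 0 (Phi p m h.1) = Phi p m ((A ^ m) h).1
    rw [res_pow, lam_Phi]
  · rw [Module.End.mul_apply, Module.End.mul_apply, ← hF, ← hZ, ← hZ, ← powT P F hF]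
    congr 1
    apply Subtype.ext
    rw [res_pow]
    exact TT_Phi m h.1

theorem quad_group {G : Type*} [Group G] (u0 u2 f s : G) (m N : ℕ) (hss : s * s = 1)
    (r0 : u0 * f = f * u0 ^ m) (r2 : u2 * f = f ^ m * u2) (rs : s * u0 = u2 * s)
    (q0 : u0 ^ N = 1) (q2 : u2 ^ N = 1) (qf : f ^ N = 1) :
    ∃ a : ZMod 4 → G, (∀ i, a (i + 1) * a i * (a (i + 1))⁻¹ = a i ^ m) ∧ (∀ i, a i ^ N = 1) ∧
      a 0 = u0 := by
  have hs : s⁻¹ = s := inv_eq_of_mul_eq_one_left hss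
  have t1 : f⁻¹ * u0 * f⁻¹⁻¹ = u0 ^ m := by
    rw [inv_inv, mul_assoc, r0, inv_mul_cancel_left]
  have t2 : u2 * f⁻¹ * u2⁻¹ = (f⁻¹) ^ m := by
    have : u2 * f * u2⁻¹ = f ^ m := by rw [r2, mul_inv_cancel_right]
    rw [inv_pow, ← this]; group
  have c0 : s * u0 * s⁻¹ = u2 := by rw [rs, mul_inv_cancel_right]
  have c2 : s * u2 * s⁻¹ = u0 := by
    rw [hs, mul_assoc, ← rs, ← mul_assoc, hss, one_mul]
  have t3 : (s * f⁻¹ * s⁻¹) * u2 * (s * f⁻¹ * s⁻¹)⁻¹ = u2 ^ m := by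
    rw [← c0, conj_pow, ← t1]; group
  have t4 : u0 * (s * f⁻¹ * s⁻¹) * u0⁻¹ = (s * f⁻¹ * s⁻¹) ^ m := by
    rw [← c2, conj_pow, ← t2]; group
  refine ⟨![u0, f⁻¹, u2, s * f⁻¹ * s⁻¹], ?_, ?_, rfl⟩
  · intro i
    fin_cases i
    · exact t1
    · exact t2
    · exact t3
    · exact t4
  · intro i
    fin_cases i
    · exact q0
    · change (f⁻¹) ^ N = 1
      rw [inv_pow, qf, inv_one]
    · exact q2
    · change (s * f⁻¹ * s⁻¹) ^ N = 1
      rw [conj_pow, inv_pow, qf]; group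

theorem quad_monoid {M : Type*} [Monoid M] (u0 u2 f s : M) (m N : ℕ) (hN : N ≠ 0)
    (hss : s * s = 1)
    (r0 : u0 * f = f * u0 ^ m) (r2 : u2 * f = f ^ m * u2) (rs : s * u0 = u2 * s)
    (q0 : u0 ^ N = 1) (q2 : u2 ^ N = 1) (qf : f ^ N = 1) :
    ∃ a : ZMod 4 → Mˣ, (∀ i, a (i + 1) * a i * (a (i + 1))⁻¹ = a i ^ m) ∧ (∀ i, a i ^ N = 1) ∧
      (a 0 : M) = u0 := by
  obtain ⟨a, h1, h2, h3⟩ := quad_group (Units.ofPowEqOne u0 N q0 hN) (Units.ofPowEqOne u2 N q2 hN)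
    (Units.ofPowEqOne f N qf hN) ⟨s, s, hss, hss⟩ m N (Units.ext hss)
    (Units.ext (by simpa using r0)) (Units.ext (by simpa using r2)) (Units.ext (by simpa using rs))
    (Units.pow_ofPowEqOne _ _) (Units.pow_ofPowEqOne _ _) (Units.pow_ofPowEqOne _ _)
  exact ⟨a, h1, h2, by rw [h3]; rfl⟩

theorem exists_quad (m : ℕ) (hm : m ≡ 1 [MOD p]) (hm0 : 0 < m) (K : ℕ) :
    ∃ (G : Type) (_ : Group G) (_ : Finite G) (a : ZMod 4 → G) (r : ℕ),
      (∀ i, a (i + 1) * a i * (a (i + 1))⁻¹ = a i ^ m) ∧ (∀ i, a i ^ p ^ r = 1) ∧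
      a 0 ^ p ^ K ≠ 1 := by
  obtain ⟨n, hn⟩ : ∃ n, n = p ^ K + 1 := ⟨_, rfl⟩
  obtain ⟨r, hr⟩ : ∃ r, n + 1 ≤ p ^ r :=
    ⟨n + 1, (Nat.lt_pow_self (Fact.out : p.Prime).one_lt).le⟩
  obtain ⟨F, hF, hA, hZ⟩ := ops (p := p) m n r hm hm0 hr
  have e : ∀ c, (1 + sh p n c) ^ p ^ r = 1 := fun c => by
    rw [add_sh_pow, sh_pow_eq_zero (by omega), add_zero]
  obtain ⟨a, h1, h2, h3⟩ := quad_monoid _ _ F (sw p n) m (p ^ r) (by omega) (sw_sw n) hA hZ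
    (by rw [mul_add, sw_sh, add_mul, mul_one, one_mul]; rfl) (e true) (e false) hF
  refine ⟨_, inferInstance, WWEnd_finite n, a, r, h1, h2, ?_⟩
  intro h
  have h4 := congrArg Units.val h
  rw [Units.val_pow_eq_pow_val, h3, Units.val_one, add_sh_pow] at h4
  exact sh_pow_ne_zero (p := p) (n := n) (k := p ^ K) (by omega) true (by simpa using h4)

/-- The finite group used for the main construction. -/
theorem exists_group (m : ℕ) (hm : m ≡ 1 [MOD p]) (hm0 : 0 < m) (K : ℕ) :
    ∃ (G : Type) (_ : Group G) (_ : Finite G) (a t : G) (k : ℕ),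
      t ^ 4 = 1 ∧ (t * a * t⁻¹) * a * (t * a * t⁻¹)⁻¹ = a ^ m ∧ orderOf a = p ^ k ∧ K ≤ k := by
  obtain ⟨G, _, _, a, r, h1, h2, h3⟩ := exists_quad (p := p) m hm hm0 K
  let A : Equiv.Perm (G × ZMod 4) :=
    { toFun := fun x => (a x.2 * x.1, x.2)
      invFun := fun x => ((a x.2)⁻¹ * x.1, x.2)
      left_inv := fun x => by simp
      right_inv := fun x => by simp }
  let t : Equiv.Perm (G × ZMod 4) :=
    { toFun := fun x => (x.1, x.2 - 1)
      invFun := fun x => (x.1, x.2 + 1)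
      left_inv := fun x => by simp
      right_inv := fun x => by simp }
  have hApow : ∀ k x, (A ^ k) x = (a x.2 ^ k * x.1, x.2) := by
    intro k
    induction k with
    | zero => intro x; simp
    | succ k ih => intro x; rw [pow_succ', Equiv.Perm.mul_apply, ih, pow_succ', mul_assoc]; rfl
  have hp : A ^ p ^ r = 1 := by
    ext x : 1
    rw [hApow, h2]; simp
  obtain ⟨k, hk, hk'⟩ := (Nat.dvd_prime_pow (Fact.out : p.Prime)).1 (orderOf_dvd_of_pow_eq_one hp)
  refine ⟨Equiv.Perm (G × ZMod 4), inferInstance, inferInstance, A, t, k, ?_, ?_, hk', ?_⟩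
  · ext x : 1
    rcases x with ⟨g, i⟩
    change (g, i - 1 - 1 - 1 - 1) = (g, i)
    revert i
    have : ∀ i : ZMod 4, i - 1 - 1 - 1 - 1 = i := by decide
    intro i; rw [this]
  · rw [mul_inv_eq_iff_eq_mul]
    ext x : 1
    rcases x with ⟨g, i⟩
    rw [Equiv.Perm.mul_apply _ A, Equiv.Perm.mul_apply (A ^ m), hApow]
    change (a (i + 1) * (a i * g), i + 1 - 1) = (a (i + 1 - 1) ^ m * (a (i + 1) * g), i + 1 - 1)
    rw [add_sub_cancel_right, ← h1]; simp [mul_assoc]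
  · by_contra hlt
    apply h3
    have h4 : A ^ p ^ K = 1 := orderOf_dvd_iff_pow_eq_one.1 (hk' ▸ pow_dvd_pow p (by omega))
    have h5 := hApow (p ^ K) (1, 0)
    rw [h4] at h5
    simpa using (congrArg Prod.fst h5).symm

end Gp
end HJ

namespace HJ

section Tile
variable {G : Type} [Group G]

theorem conj_rel {a b : G} {m : ℕ} (h : b * a * b⁻¹ = a ^ m) (j i : ℕ) :
    b ^ j * a ^ i = a ^ (i * m ^ j) * b ^ j := by
  have h1 : ∀ i, b * a ^ i = a ^ (i * m) * b := by
    intro i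
    rw [mul_comm i m, pow_mul, ← h, conj_pow]; group
  induction j generalizing i with
  | zero => simp
  | succ j ih =>
    rw [pow_succ', mul_assoc, ih, ← mul_assoc, h1, mul_assoc, pow_succ, mul_assoc i]

variable [Finite G]

def PP {a b : G} {m : ℕ} (h : b * a * b⁻¹ = a ^ m) : Subgroup G :=
  let M : Submonoid G :=
    { carrier := {g | ∃ i j : ℕ, g = a ^ i * b ^ j}
      one_mem' := ⟨0, 0, by simp⟩
      mul_mem' := by
        rintro _ _ ⟨i, j, rfl⟩ ⟨i', j', rfl⟩
        refine ⟨i + i' * m ^ j, j + j', ?_⟩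
        rw [mul_assoc, ← mul_assoc (b ^ j), conj_rel h, pow_add, pow_add]
        simp only [mul_assoc] }
  { M with
    inv_mem' := by
      intro x hx
      have hx' : x ∈ M := hx
      have : x⁻¹ = x ^ (orderOf x - 1) := by
        rw [inv_eq_iff_mul_eq_one, ← pow_succ', Nat.sub_add_cancel (orderOf_pos x),
          pow_orderOf_eq_one]
      change x⁻¹ ∈ M
      rw [this]
      exact pow_mem hx' _ }

theorem mem_PP {a b : G} {m : ℕ} (h : b * a * b⁻¹ = a ^ m) (g : G) :
    g ∈ PP h ↔ ∃ i j : ℕ, g = a ^ i * b ^ j := Iff.rfl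

theorem b_pow_mem {a b : G} {m p k l : ℕ} (hp : p.Prime) (hm : 1 < m)
    (h : b * a * b⁻¹ = a ^ m) (ha : orderOf a = p ^ k) (hb : orderOf b = p ^ k)
    (hL : m ^ p ^ l ≤ p ^ k) {j : ℤ} (hj : b ^ j ∈ Subgroup.zpowers a) : ((p ^ l : ℕ) : ℤ) ∣ j := by
  have h1 : b ^ (Int.gcd j (p ^ k : ℕ)) ∈ Subgroup.zpowers a := by
    have := Int.gcd_eq_gcd_ab j (p ^ k : ℕ)
    rw [← zpow_natCast, this, zpow_add, zpow_mul, zpow_mul, zpow_natCast b, ← hb,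
      pow_orderOf_eq_one, one_zpow, mul_one]
    exact Subgroup.zpow_mem _ hj _
  have h2 : Int.gcd j (p ^ k : ℕ) ∣ p ^ k := Int.gcd_dvd_natAbs_right _ _
  have h3 : ((Int.gcd j (p ^ k : ℕ) : ℕ) : ℤ) ∣ j := Int.gcd_dvd_left _ _
  obtain ⟨e, he, hd⟩ := (Nat.dvd_prime_pow hp).1 h2
  rw [hd] at h1 h3
  by_cases hel : l ≤ e
  · exact (Int.natCast_dvd_natCast.2 (pow_dvd_pow p hel)).trans h3
  · exfalso
    obtain ⟨z, hz⟩ := h1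
    have hz : a ^ z = b ^ p ^ e := hz
    have h4 := conj_rel h (p ^ e) 1
    rw [one_mul, ← hz, pow_one] at h4
    have h5 : a ^ (m ^ p ^ e) = a := by
      have : a ^ z * a = a * a ^ z := by rw [← zpow_add_one, ← zpow_one_add, add_comm]
      rw [this] at h4
      exact (mul_right_cancel h4).symm
    have hpe : 1 ≤ p ^ e := Nat.one_le_pow _ _ hp.pos
    have h6 : 1 < m ^ p ^ e := Nat.one_lt_pow (by omega) hm
    have h7 : a ^ (m ^ p ^ e - 1) = 1 := by
      have : a ^ (m ^ p ^ e - 1) * a = a := by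
        rw [← pow_succ, Nat.sub_add_cancel h6.le, h5]
      simpa using this
    have h8 := Nat.le_of_dvd (by omega) (orderOf_dvd_of_pow_eq_one h7)
    have h9 : m ^ p ^ e ≤ m ^ p ^ l :=
      Nat.pow_le_pow_right (by omega) (Nat.pow_le_pow_right hp.pos (by omega))
    omega

theorem exists_lam {a b : G} {m L : ℕ} (h : b * a * b⁻¹ = a ^ m)
    (hL : ∀ j : ℤ, b ^ j ∈ Subgroup.zpowers a → (L : ℤ) ∣ j) :
    ∃ lm : G → ZMod L, (∀ g, lm (a * g) = lm g) ∧ ∀ g, lm (b * g) = lm g + 1 := by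
  classical
  let s := QuotientGroup.rightRel (PP h)
  let ρ : G → G := fun g => (Quotient.mk s g).out
  have hρ : ∀ g, ∃ j : ℕ, ∃ i : ℕ, g = a ^ i * b ^ j * ρ g := by
    intro g
    have h1 : s (ρ g) g := Quotient.mk_out (s := s) g
    rw [QuotientGroup.rightRel_apply, mem_PP] at h1
    obtain ⟨i, j, e⟩ := h1
    exact ⟨j, i, by rw [← e, inv_mul_cancel_right]⟩
  have ha : ∀ g, ρ (a * g) = ρ g := by
    intro g
    refine congrArg Quotient.out (Quotient.sound (s := s) ?_)
    change s _ _
    rw [QuotientGroup.rightRel_apply]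
    have : a ∈ PP h := ⟨1, 0, by simp⟩
    simpa using this
  have hb : ∀ g, ρ (b * g) = ρ g := by
    intro g
    refine congrArg Quotient.out (Quotient.sound (s := s) ?_)
    change s _ _
    rw [QuotientGroup.rightRel_apply]
    have : b ∈ PP h := ⟨0, 1, by simp⟩
    simpa using this
  choose J I hJ using hρ
  have key : ∀ (g : G) (i j : ℕ), g = a ^ i * b ^ j * ρ g → ((J g : ℕ) : ZMod L) = j := by
    intro g i j hg
    have h1 : a ^ i * b ^ j = a ^ I g * b ^ J g := by
      have := hg.symm.trans (hJ g)
      exact mul_right_cancel this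
    have h2 : b ^ ((J g : ℤ) - j) ∈ Subgroup.zpowers a := by
      refine ⟨(i : ℤ) - I g, ?_⟩
      change a ^ ((i : ℤ) - I g) = _
      have : a ^ (-(I g : ℤ) + i) = b ^ ((J g : ℤ) + -j) := by
        rw [zpow_add, zpow_add, zpow_neg, zpow_neg, zpow_natCast, zpow_natCast, zpow_natCast,
          zpow_natCast, inv_mul_eq_iff_eq_mul, ← mul_assoc, ← h1, mul_inv_cancel_right]
      rw [sub_eq_neg_add, this, sub_eq_add_neg]
    have h3 := (ZMod.intCast_zmod_eq_zero_iff_dvd _ L).2 (hL _ h2)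
    push_cast at h3
    exact sub_eq_zero.1 h3
  refine ⟨fun g => (J g : ZMod L), fun g => ?_, fun g => ?_⟩
  · refine key (a * g) (I g + 1) (J g) ?_
    rw [ha, pow_succ', mul_assoc, mul_assoc, ← mul_assoc _ _ (ρ g), ← hJ]
  · have := key (b * g) (I g * m) (J g + 1) ?_
    · simpa using this
    · have e := conj_rel h 1 (I g)
      rw [pow_one, pow_one] at e
      rw [hb, pow_succ', ← mul_assoc (a ^ _), ← e]
      conv_lhs => rw [hJ g]
      simp only [mul_assoc]

theorem exists_tile {a b : G} {m L : ℕ} [NeZero L] (h : b * a * b⁻¹ = a ^ m)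
    (hL : ∀ j : ℤ, b ^ j ∈ Subgroup.zpowers a → (L : ℤ) ∣ j) :
    ∃ D : Set G, Function.Bijective
      (fun x : D × Fin L × Fin (orderOf a) => (b ^ (x.2.1 : ℕ))⁻¹ * (a ^ (x.2.2 : ℕ) * x.1.1)) := by
  obtain ⟨lm, la, lb⟩ := exists_lam h hL
  have la' : ∀ (i : ℕ) g, lm (a ^ i * g) = lm g := by
    intro i
    induction i with
    | zero => simp
    | succ i ih => intro g; rw [pow_succ', mul_assoc, la, ih]
  have lb' : ∀ (i : ℕ) g, lm (b ^ i * g) = lm g + i := by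
    intro i
    induction i with
    | zero => simp
    | succ i ih => intro g; rw [pow_succ', mul_assoc, lb, ih]; push_cast; ring
  let s := QuotientGroup.rightRel (Subgroup.zpowers a)
  let ρ : G → G := fun g => (Quotient.mk s g).out
  have hρ : ∀ g, ∃ i < orderOf a, g = a ^ i * ρ g := by
    intro g
    have h1 : s (ρ g) g := Quotient.mk_out (s := s) g
    rw [QuotientGroup.rightRel_apply] at h1
    obtain ⟨z, e⟩ := h1
    have e : a ^ z = g * (ρ g)⁻¹ := e
    refine ⟨(z % (orderOf a : ℤ)).toNat, ?_, ?_⟩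
    · have h2 := Int.emod_lt_of_pos z (b := orderOf a) (by exact_mod_cast orderOf_pos a)
      have h3 := Int.emod_nonneg z (b := orderOf a) (by exact_mod_cast (orderOf_pos a).ne')
      omega
    · have h3 := Int.emod_nonneg z (b := orderOf a) (by exact_mod_cast (orderOf_pos a).ne')
      rw [← zpow_natCast, Int.toNat_of_nonneg h3, zpow_mod_orderOf, e, inv_mul_cancel_right]
  have ha : ∀ (i : ℕ) g, ρ (a ^ i * g) = ρ g := by
    intro i g
    refine congrArg Quotient.out (Quotient.sound (s := s) ?_)
    change s _ _
    rw [QuotientGroup.rightRel_apply]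
    have : a ^ i ∈ Subgroup.zpowers a := ⟨i, by simp⟩
    simpa using this
  have hρρ : ∀ g, ρ (ρ g) = ρ g := by
    intro g
    obtain ⟨i, _, e⟩ := hρ g
    conv_rhs => rw [e, ha]
  refine ⟨{d | lm d = 0 ∧ ρ d = d}, ?_, ?_⟩
  · rintro ⟨⟨d, hd, hd'⟩, j, i⟩ ⟨⟨e, he, he'⟩, j', i'⟩ hx
    have hx : (b ^ (j : ℕ))⁻¹ * (a ^ (i : ℕ) * d) = (b ^ (j' : ℕ))⁻¹ * (a ^ (i' : ℕ) * e) := hx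
    have lb'' : ∀ (i : ℕ) g, lm ((b ^ i)⁻¹ * g) = lm g - i := by
      intro i g
      have := lb' i ((b ^ i)⁻¹ * g)
      rw [mul_inv_cancel_left] at this
      rw [this]; ring
    have h1 := congrArg lm hx
    rw [lb'', lb'', la', la', hd, he, zero_sub, zero_sub, neg_inj,
      ZMod.natCast_eq_natCast_iff', Nat.mod_eq_of_lt j.2, Nat.mod_eq_of_lt j'.2] at h1
    obtain rfl : j = j' := Fin.ext h1
    have h2 := mul_left_cancel hx
    have h3 := congrArg ρ h2
    rw [ha, ha, hd', he'] at h3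
    subst h3
    have h4 := pow_injOn_Iio_orderOf (x := a) i.2 i'.2 (mul_right_cancel h2)
    obtain rfl : i = i' := Fin.ext h4
    rfl
  · intro g
    let j := (-lm g).val
    obtain ⟨i, hi, e⟩ := hρ (b ^ j * g)
    have h1 : lm (b ^ j * g) = 0 := by
      rw [lb', ZMod.natCast_zmod_val]; ring
    refine ⟨⟨⟨ρ (b ^ j * g), ?_, hρρ _⟩, ⟨j, ZMod.val_lt _⟩, ⟨i, hi⟩⟩, ?_⟩
    · rw [← h1]; conv_rhs => rw [e, la']
    · change (b ^ j)⁻¹ * (a ^ i * ρ (b ^ j * g)) = g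
      rw [← e, inv_mul_cancel_left]

end Tile
end HJ

namespace HJ

section Tower
open Classical Finset
variable {X : Type*}

def Cond (T : Equiv.Perm X) (E : X → Prop) (L R : ℕ) (x : X) : Prop :=
  ∃ k, 1 ≤ k ∧ k * L < R ∧ E ((T ^ (k * L)) x) ∧ ∀ r < k * L, ¬ E ((T ^ r) x)

theorem Cond_disj {T : Equiv.Perm X} {E : X → Prop} {L R : ℕ} {x : X} {j : ℕ} (hj : j < L)
    (h : Cond T E L R x) (h' : Cond T E L R ((T ^ j) x)) : j = 0 := by
  obtain ⟨k, hk, -, e, ne⟩ := h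
  obtain ⟨k', hk', -, e', ne'⟩ := h'
  have hkL : L ≤ k * L := Nat.le_mul_of_pos_left L hk
  rw [← Equiv.Perm.mul_apply, ← pow_add] at e'
  have h1 : k * L ≤ k' * L + j := by
    by_contra hc
    exact ne _ (by omega) e'
  have h2 : k' * L ≤ k * L - j := by
    by_contra hc
    apply ne' (k * L - j) (by omega)
    rw [← Equiv.Perm.mul_apply, ← pow_add, Nat.sub_add_cancel (by omega)]
    exact e
  have h3 : k' * L + j = k * L := by omega
  have h4 := congrArg (· % L) h3
  simp only [Nat.mul_add_mod_self_right, Nat.mul_mod_left] at h4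
  rwa [Nat.mod_eq_of_lt hj] at h4

theorem Cond_inj {T : Equiv.Perm X} {E : X → Prop} {L R : ℕ} {x y : X} {i j : ℕ} (hi : i < L)
    (hj : j < L) (hx : Cond T E L R x) (hy : Cond T E L R y)
    (h : (T ^ i)⁻¹ x = (T ^ j)⁻¹ y) : i = j ∧ x = y := by
  have main : ∀ (x y : X) (i j : ℕ), i ≤ j → j < L → Cond T E L R x → Cond T E L R y →
      (T ^ i)⁻¹ x = (T ^ j)⁻¹ y → i = j ∧ x = y := by
    intro x y i j hij hj hx hy h
    have e : (T ^ (j - i)) x = y := by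
      rw [← Nat.sub_add_cancel hij, pow_add, mul_inv_rev, Equiv.Perm.mul_apply] at h
      rw [Equiv.Perm.eq_inv_iff_eq] at h
      rw [← Equiv.Perm.mul_apply, mul_inv_cancel, Equiv.Perm.one_apply, Equiv.Perm.eq_inv_iff_eq] at h
      exact h
    have h0 := Cond_disj (j := j - i) (by omega) hx (by rw [e]; exact hy)
    rw [h0] at e
    exact ⟨by omega, e⟩
  rcases le_total i j with hij | hij
  · exact main x y i j hij hj hx hy h
  · obtain ⟨h1, h2⟩ := main y x j i hij hi hy hx h.symm
    exact ⟨h1.symm, h2.symm⟩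

variable [Fintype X]

theorem card_preim (T : Equiv.Perm X) (P : X → Prop) [DecidablePred P] :
    (univ.filter fun x => P (T x)).card = (univ.filter P).card := by
  refine card_bij (fun x _ => T x) ?_ ?_ ?_
  · intro x hx; simpa using hx
  · intro x _ y _ h; exact T.injective h
  · intro y hy
    exact ⟨T.symm y, by simpa using hy, by simp⟩

theorem Cond_card (T : Equiv.Perm X) (E : X → Prop) (L R : ℕ) (hL : 0 < L) :
    Fintype.card X ≤ L * (univ.filter (Cond T E L R)).card + L * (univ.filter E).card +
      (univ.filter fun x => ∀ r < R, ¬ E ((T ^ r) x)).card := by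
  have hsub : (univ : Finset X) ⊆
      ((range L).biUnion fun j => univ.filter fun x => Cond T E L R ((T ^ j) x)) ∪
      ((range L).biUnion fun j => univ.filter fun x => E ((T ^ j) x)) ∪
      (univ.filter fun x => ∀ r < R, ¬ E ((T ^ r) x)) := by
    intro x _
    by_cases hN : ∀ r < R, ¬ E ((T ^ r) x)
    · exact mem_union_right _ (by simpa using hN)
    · apply mem_union_left
      have hex : ∃ r, E ((T ^ r) x) := by
        by_contra hc
        exact hN fun r _ hr => hc ⟨r, hr⟩
      have hmin := fun r (hr : r < Nat.find hex) => Nat.find_min hex hr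
      have hspec := Nat.find_spec hex
      have hlt : Nat.find hex < R := by
        by_contra hc
        exact hN fun r hr => hmin r (by omega)
      generalize Nat.find hex = r at hmin hspec hlt
      by_cases hr : r < L
      · apply mem_union_right
        simp only [mem_biUnion, mem_range, mem_filter, mem_univ, true_and]
        exact ⟨r, hr, hspec⟩
      · apply mem_union_left
        simp only [mem_biUnion, mem_range, mem_filter, mem_univ, true_and]
        have e : r / L * L + r % L = r := Nat.div_add_mod' r L
        refine ⟨r % L, Nat.mod_lt _ hL, r / L, Nat.div_pos (by omega) hL, by omega, ?_, ?_⟩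
        · rw [← Equiv.Perm.mul_apply, ← pow_add, e]; exact hspec
        · intro s hs
          rw [← Equiv.Perm.mul_apply, ← pow_add]
          exact hmin _ (by omega)
  have h1 := card_le_card hsub
  refine (h1.trans (card_union_le _ _)).trans (Nat.add_le_add_right ?_ _)
  refine (card_union_le _ _).trans (Nat.add_le_add ?_ ?_)
  · refine card_biUnion_le.trans ?_
    rw [sum_congr rfl (fun j _ => card_preim (T ^ j) (Cond T E L R))]
    simp
  · refine card_biUnion_le.trans ?_
    rw [sum_congr rfl (fun j _ => card_preim (T ^ j) E)]
    simp

end Tower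
end HJ

namespace HJ

section NonHit
open Classical Finset

/-- the short interval -/
def EE (n q : ℕ) (y : ZMod n) : Prop := y.val * q < n

/-- integers below `q ^ I` with no zero digit in base `q` -/
def SS (q : ℕ) : ℕ → Finset ℕ
  | 0 => {0}
  | I + 1 => (SS q I ×ˢ Finset.Ico 1 q).image fun x => x.1 * q + x.2

theorem SS_card (q I : ℕ) : (SS q I).card ≤ (q - 1) ^ I := by
  induction I with
  | zero => simp [SS]
  | succ I ih =>
    refine card_image_le.trans ?_
    rw [card_product, Nat.card_Ico, pow_succ]
    exact Nat.mul_le_mul_right _ ih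

theorem SS_mem {n q : ℕ} [NeZero n] (hq : 0 < q) (x : ZMod n) (I : ℕ)
    (h : ∀ s < I, ¬ EE n q ((q : ZMod n) ^ s * x)) : q ^ I * x.val / n ∈ SS q I := by
  have hn : 0 < n := NeZero.pos n
  induction I with
  | zero =>
    simp only [pow_zero, one_mul, SS, mem_singleton]
    exact Nat.div_eq_of_lt (ZMod.val_lt x)
  | succ I ih =>
    have h1 := ih fun s hs => h s (by omega)
    have h2 := h I (by omega)
    have hv : ((q : ZMod n) ^ I * x).val = (q ^ I * x.val) % n := by
      have : (q : ZMod n) ^ I * x = ((q ^ I * x.val : ℕ) : ZMod n) := by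
        push_cast; rw [ZMod.natCast_zmod_val]
      rw [this, ZMod.val_natCast]
    unfold EE at h2
    rw [hv, not_lt] at h2
    simp only [SS, mem_image, mem_product, Prod.exists, mem_Ico]
    refine ⟨q ^ I * x.val / n, (q ^ I * x.val) % n * q / n, ⟨h1, ?_, ?_⟩, ?_⟩
    · exact (Nat.one_le_div_iff hn).2 h2
    · rw [Nat.div_lt_iff_lt_mul hn, mul_comm]
      exact Nat.mul_lt_mul_of_pos_left (Nat.mod_lt _ hn) hq
    · have e : q ^ (I + 1) * x.val = (q ^ I * x.val) % n * q + n * (q ^ I * x.val / n * q) := by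
        have := Nat.mod_add_div (q ^ I * x.val) n
        calc q ^ (I + 1) * x.val = (q ^ I * x.val) * q := by ring
          _ = ((q ^ I * x.val) % n + n * (q ^ I * x.val / n)) * q := by rw [this]
          _ = _ := by ring
      rw [e, Nat.add_mul_div_left _ _ hn, add_comm]

theorem fiber_card {n Q Y : ℕ} [NeZero n] (hQ : 0 < Q) :
    (univ.filter fun x : ZMod n => Q * x.val / n = Y).card ≤ n / Q + 1 := by
  have hn : 0 < n := NeZero.pos n
  by_cases hne : (univ.filter fun x : ZMod n => Q * x.val / n = Y).Nonempty
  · obtain ⟨x0, hx0, hmin⟩ := exists_min_image _ (fun x : ZMod n => x.val) hne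
    have : (univ.filter fun x : ZMod n => Q * x.val / n = Y).card ≤
        (Finset.Icc x0.val (x0.val + n / Q)).card := by
      refine card_le_card_of_injOn (fun x => x.val) ?_ ?_
      · intro x hx
        have h1 := hmin x hx
        simp only [coe_filter, mem_univ, true_and, Set.mem_ofPred_eq, mem_filter] at hx hx0
        simp only [coe_Icc, Set.mem_Icc]
        refine ⟨h1, ?_⟩
        have a1 : Y * n ≤ Q * x0.val := by rw [← hx0]; exact Nat.div_mul_le_self _ _
        have a2 : Q * x.val < (Y + 1) * n := by
          rw [← hx]; exact Nat.lt_mul_of_div_lt (Nat.lt_succ_self _) hn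
        have a3 : (x.val - x0.val) * Q ≤ n := by
          rw [Nat.sub_mul]
          have : (Y + 1) * n = Y * n + n := by ring
          rw [mul_comm x.val, mul_comm x0.val]; omega
        have := (Nat.le_div_iff_mul_le hQ).2 a3
        omega
      · intro x _ y _ h
        exact ZMod.val_injective n h
    rw [Nat.card_Icc, add_assoc, Nat.add_sub_cancel_left] at this
    exact this
  · rw [not_nonempty_iff_eq_empty] at hne
    rw [hne]; simp

theorem nonhit_card {n q : ℕ} [NeZero n] (hq : 0 < q) (I : ℕ) :
    (univ.filter fun x : ZMod n => ∀ s < I, ¬ EE n q ((q : ZMod n) ^ s * x)).card ≤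
      (q - 1) ^ I * (n / q ^ I + 1) := by
  have hsub : (univ.filter fun x : ZMod n => ∀ s < I, ¬ EE n q ((q : ZMod n) ^ s * x)) ⊆
      (SS q I).biUnion fun Y => univ.filter fun x : ZMod n => q ^ I * x.val / n = Y := by
    intro x hx
    simp only [mem_filter, mem_univ, true_and] at hx
    simp only [mem_biUnion, mem_filter, mem_univ, true_and]
    exact ⟨_, SS_mem hq x I hx, rfl⟩
  refine (card_le_card hsub).trans (card_biUnion_le.trans ?_)
  refine (sum_le_sum fun Y _ => fiber_card (n := n) (Q := q ^ I) (Y := Y) (by positivity)).trans ?_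
  rw [sum_const, smul_eq_mul]
  exact Nat.mul_le_mul_right _ (SS_card q I)

theorem EE_card {n q : ℕ} [NeZero n] (hq : 0 < q) :
    (univ.filter (EE n q)).card ≤ n / q + 1 := by
  have hn : 0 < n := NeZero.pos n
  have : (univ.filter (EE n q)).card ≤ (Finset.range (n / q + 1)).card := by
    refine card_le_card_of_injOn (fun x => x.val) ?_ ?_
    · intro x hx
      simp only [coe_filter, mem_univ, true_and, Set.mem_ofPred_eq, EE] at hx
      simp only [coe_range, Set.mem_Iio]
      have := (Nat.le_div_iff_mul_le hq).2 hx.le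
      omega
    · intro x _ y _ h
      exact ZMod.val_injective n h
  simpa using this

theorem shift_one {n q : ℕ} [NeZero n] (hq : 0 < q) :
    (univ.filter fun y : ZMod n => ¬ (EE n q (y + 1) ↔ EE n q y)).card ≤ 2 := by
  have hn : 0 < n := NeZero.pos n
  have hsub : (univ.filter fun y : ZMod n => ¬ (EE n q (y + 1) ↔ EE n q y)) ⊆
      {((-1 : ZMod n)), (((n - 1) / q : ℕ) : ZMod n)} := by
    intro y hy
    simp only [mem_filter, mem_univ, true_and] at hy
    simp only [mem_insert, mem_singleton]
    by_cases h1 : y.val + 1 = n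
    · left
      have : ((y.val + 1 : ℕ) : ZMod n) = 0 := by rw [h1, ZMod.natCast_self]
      push_cast at this
      rw [ZMod.natCast_zmod_val] at this
      exact eq_neg_of_add_eq_zero_left this
    · right
      have hv : (y + 1).val = y.val + 1 := by
        have h2 := ZMod.val_lt y
        have : y + 1 = ((y.val + 1 : ℕ) : ZMod n) := by
          push_cast; rw [ZMod.natCast_zmod_val]
        rw [this, ZMod.val_natCast, Nat.mod_eq_of_lt (by omega)]
      unfold EE at hy
      rw [hv, add_mul, one_mul] at hy
      have h3 : y.val * q < n ∧ n ≤ y.val * q + q := by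
        by_contra hc
        apply hy
        constructor <;> intro h <;> by_contra h' <;> omega
      have h4 : (n - 1) / q = y.val := by
        rw [Nat.div_eq_iff hq]; constructor
        · omega
        · omega
      rw [h4, ZMod.natCast_zmod_val]
  exact (card_le_card hsub).trans card_le_two

theorem shift_card {n q : ℕ} [NeZero n] (hq : 0 < q) (s : ℕ) :
    (univ.filter fun y : ZMod n => ¬ (EE n q (y + s) ↔ EE n q y)).card ≤ 2 * s := by
  induction s with
  | zero => simp
  | succ s ih =>
    have hsub : (univ.filter fun y : ZMod n => ¬ (EE n q (y + (s + 1 : ℕ)) ↔ EE n q y)) ⊆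
        (univ.filter fun y : ZMod n => ¬ (EE n q (y + s + 1) ↔ EE n q (y + s))) ∪
        (univ.filter fun y : ZMod n => ¬ (EE n q (y + s) ↔ EE n q y)) := by
      intro y hy
      simp only [mem_union, mem_filter, mem_univ, true_and] at hy ⊢
      push_cast at hy
      rw [← add_assoc] at hy
      tauto
    have h1 := card_preim (Equiv.addRight (s : ZMod n))
      (fun y => ¬ (EE n q (y + 1) ↔ EE n q y))
    have h2 := shift_one (n := n) hq
    have h3 := (card_le_card hsub).trans (card_union_le _ _)
    have h4 : (univ.filter fun y : ZMod n =>
        ¬ (EE n q (y + s + 1) ↔ EE n q (y + s))).card ≤ 2 := h1.le.trans h2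
    omega

end NonHit
end HJ

namespace HJ

section Blocks
open Classical Finset

def Stab (m n q H R : ℕ) (x : ZMod n) : Prop :=
  ∀ r < R, ∀ i < H, (EE n q ((m : ZMod n) ^ r * (x + (i : ℕ))) ↔ EE n q ((m : ZMod n) ^ r * x))

theorem Cond_stab {m n q H R L : ℕ} {T : Equiv.Perm (ZMod n)}
    (hT : ∀ r x, (T ^ r) x = (m : ZMod n) ^ r * x) {x : ZMod n} (hx : Stab m n q H R x)
    {i : ℕ} (hi : i < H) : Cond T (EE n q) L R (x + i) ↔ Cond T (EE n q) L R x := by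
  unfold Cond
  refine exists_congr fun k => and_congr_right fun _ => and_congr_right fun hk => ?_
  rw [hT, hT]
  refine and_congr (hx _ hk i hi) ?_
  refine forall₂_congr fun r hr => ?_
  rw [hT, hT]
  exact not_congr (hx _ (by omega) i hi)

theorem unstab_card {m n q H R : ℕ} [NeZero n] (hq : 0 < q) (hm : 0 < m) {T : Equiv.Perm (ZMod n)}
    (hT : ∀ r x, (T ^ r) x = (m : ZMod n) ^ r * x) :
    (univ.filter fun x => ¬ Stab m n q H R x).card ≤ R * (H * (2 * (m ^ R * H))) := by
  have hsub : (univ.filter fun x => ¬ Stab m n q H R x) ⊆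
      (range R).biUnion fun r => (range H).biUnion fun i => univ.filter fun x : ZMod n =>
        ¬ (EE n q ((T ^ r) x + (m ^ r * i : ℕ)) ↔ EE n q ((T ^ r) x)) := by
    intro x hx
    simp only [mem_filter, mem_univ, true_and, Stab, not_forall] at hx
    obtain ⟨r, hr, i, hi, h⟩ := hx
    simp only [mem_biUnion, mem_range, mem_filter, mem_univ, true_and]
    refine ⟨r, hr, i, hi, ?_⟩
    rw [hT]
    push_cast
    rw [← mul_add]
    exact h
  refine (card_le_card hsub).trans (card_biUnion_le.trans ?_)
  have : ∀ r ∈ range R, ((range H).biUnion fun i => univ.filter fun x : ZMod n =>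
        ¬ (EE n q ((T ^ r) x + (m ^ r * i : ℕ)) ↔ EE n q ((T ^ r) x))).card ≤
        H * (2 * (m ^ R * H)) := by
    intro r hr
    refine card_biUnion_le.trans ?_
    have : ∀ i ∈ range H, (univ.filter fun x : ZMod n =>
        ¬ (EE n q ((T ^ r) x + (m ^ r * i : ℕ)) ↔ EE n q ((T ^ r) x))).card ≤
        2 * (m ^ R * H) := by
      intro i hi
      have h1 := card_preim (T ^ r) (fun y => ¬ (EE n q (y + (m ^ r * i : ℕ)) ↔ EE n q y))
      have h2 := shift_card (n := n) hq (m ^ r * i)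
      refine (h1.le.trans h2).trans ?_
      refine Nat.mul_le_mul_left _ (Nat.mul_le_mul ?_ (mem_range.1 hi).le)
      exact Nat.pow_le_pow_right hm (mem_range.1 hr).le
    refine (sum_le_sum this).trans ?_
    simp
  refine (sum_le_sum this).trans ?_
  simp

noncomputable def DD (m n q H R L : ℕ) [NeZero n] (T : Equiv.Perm (ZMod n)) : Finset (ZMod n) :=
  univ.filter fun x => H ∣ x.val ∧ x.val + H ≤ n ∧ Stab m n q H R x ∧ Cond T (EE n q) L R x

theorem val_add_lt {n H : ℕ} [NeZero n] {x : ZMod n} (h : x.val + H ≤ n) {i : ℕ} (hi : i < H) :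
    (x + i).val = x.val + i := by
  have : x + i = ((x.val + i : ℕ) : ZMod n) := by push_cast; rw [ZMod.natCast_zmod_val]
  rw [this, ZMod.val_natCast, Nat.mod_eq_of_lt (by omega)]

theorem DD_inj {m n q H R L : ℕ} [NeZero n] {T : Equiv.Perm (ZMod n)}
    (hT : ∀ r x, (T ^ r) x = (m : ZMod n) ^ r * x) {c c' : ZMod n} (hc : c ∈ DD m n q H R L T)
    (hc' : c' ∈ DD m n q H R L T) {j j' i i' : ℕ} (hj : j < L) (hj' : j' < L) (hi : i < H)
    (hi' : i' < H) (h : (T ^ j)⁻¹ (c + i) = (T ^ j')⁻¹ (c' + i')) : c = c' ∧ j = j' ∧ i = i' := by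
  simp only [DD, mem_filter, mem_univ, true_and] at hc hc'
  obtain ⟨d, b, s, e⟩ := hc
  obtain ⟨d', b', s', e'⟩ := hc'
  obtain ⟨h1, h2⟩ := Cond_inj hj hj' ((Cond_stab hT s hi).2 e) ((Cond_stab hT s' hi').2 e') h
  have h3 := congrArg ZMod.val h2
  rw [val_add_lt b hi, val_add_lt b' hi'] at h3
  have h4 : i = i' := by
    obtain ⟨u, hu⟩ := d
    obtain ⟨u', hu'⟩ := d'
    have := congrArg (· % H) h3
    simp only [hu, hu', Nat.mul_add_mod] at this
    rwa [Nat.mod_eq_of_lt hi, Nat.mod_eq_of_lt hi'] at this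
  subst h4
  exact ⟨add_right_cancel h2, h1, rfl⟩

theorem DD_card {m n q H R L : ℕ} [NeZero n] (hH : 0 < H) {T : Equiv.Perm (ZMod n)}
    (hT : ∀ r x, (T ^ r) x = (m : ZMod n) ^ r * x) :
    (univ.filter (Cond T (EE n q) L R)).card ≤ H * (DD m n q H R L T).card +
      H * (univ.filter fun x => ¬ Stab m n q H R x).card + H := by
  have hsub : univ.filter (Cond T (EE n q) L R) ⊆
      ((range H).biUnion fun i => (DD m n q H R L T).image fun x => x + (i : ℕ)) ∪
      ((range H).biUnion fun i => (univ.filter fun x => ¬ Stab m n q H R x).image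
        fun x => x + (i : ℕ)) ∪
      ((range H).image fun i => ((n - 1 - i : ℕ) : ZMod n)) := by
    intro x hx
    simp only [mem_filter, mem_univ, true_and] at hx
    have hlt := ZMod.val_lt x
    have hmod := Nat.mod_lt x.val hH
    have hdm := Nat.div_add_mod x.val H
    set c : ZMod n := ((H * (x.val / H) : ℕ) : ZMod n) with hc
    have hcv : c.val = H * (x.val / H) := by
      rw [hc, ZMod.val_natCast, Nat.mod_eq_of_lt (by omega)]
    have hxc : c + (x.val % H : ℕ) = x := by
      rw [hc, ← Nat.cast_add, hdm, ZMod.natCast_zmod_val]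
    by_cases hb : c.val + H ≤ n
    · apply mem_union_left
      by_cases hs : Stab m n q H R c
      · apply mem_union_left
        simp only [mem_biUnion, mem_range, mem_image]
        refine ⟨x.val % H, hmod, c, ?_, hxc⟩
        simp only [DD, mem_filter, mem_univ, true_and]
        refine ⟨⟨_, hcv⟩, hb, hs, ?_⟩
        rw [← hxc] at hx
        exact (Cond_stab hT hs hmod).1 hx
      · apply mem_union_right
        simp only [mem_biUnion, mem_range, mem_image]
        refine ⟨x.val % H, hmod, c, ?_, hxc⟩
        simpa using hs
    · apply mem_union_right
      simp only [mem_image, mem_range]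
      refine ⟨n - 1 - x.val, by omega, ?_⟩
      have : n - 1 - (n - 1 - x.val) = x.val := by omega
      rw [this, ZMod.natCast_zmod_val]
  refine (card_le_card hsub).trans ((card_union_le _ _).trans (Nat.add_le_add
    ((card_union_le _ _).trans (Nat.add_le_add ?_ ?_)) ?_))
  · refine card_biUnion_le.trans ?_
    refine (sum_le_sum fun i _ => card_image_le).trans ?_
    simp
  · refine card_biUnion_le.trans ?_
    refine (sum_le_sum fun i _ => card_image_le).trans ?_
    rw [sum_const, card_range, smul_eq_mul]
  · refine card_image_le.trans ?_
    simp

theorem tile_nat {m L H g I : ℕ} (hm : 0 < m) (hL : 0 < L) (hH : 0 < H) {n : ℕ} [NeZero n]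
    (hn : n.Coprime m) :
    ∃ D : Finset (ZMod n), (∀ c ∈ D, ∀ c' ∈ D, ∀ j < L, ∀ j' < L, ∀ i < H, ∀ i' < H,
      ((m : ZMod n)⁻¹) ^ j * (c + (i : ℕ)) = ((m : ZMod n)⁻¹) ^ j' * (c' + (i' : ℕ)) →
        c = c' ∧ j = j' ∧ i = i') ∧
      n ≤ L * (H * D.card + H * ((g * I + 1) * (H * (2 * (m ^ (g * I + 1) * H)))) + H) +
        L * (n / m ^ g + 1) + (m ^ g - 1) ^ I * (n / (m ^ g) ^ I + 1) := by
  have hmw : (m : ZMod n) * (m : ZMod n)⁻¹ = 1 := ZMod.coe_mul_inv_eq_one m hn.symm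
  let T : Equiv.Perm (ZMod n) :=
    { toFun := fun x => (m : ZMod n) * x
      invFun := fun x => (m : ZMod n)⁻¹ * x
      left_inv := fun x => by
        change (m : ZMod n)⁻¹ * ((m : ZMod n) * x) = x
        rw [← mul_assoc, mul_comm _ (m : ZMod n), hmw, one_mul]
      right_inv := fun x => by
        change (m : ZMod n) * ((m : ZMod n)⁻¹ * x) = x
        rw [← mul_assoc, hmw, one_mul] }
  have hT : ∀ r x, (T ^ r) x = (m : ZMod n) ^ r * x := by
    intro r
    induction r with
    | zero => intro x; simp
    | succ r ih => intro x; rw [pow_succ', Equiv.Perm.mul_apply, ih, pow_succ', mul_assoc]; rfl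
  have hT' : ∀ r x, (T ^ r)⁻¹ x = ((m : ZMod n)⁻¹) ^ r * x := by
    intro r x
    rw [Equiv.Perm.inv_eq_iff_eq, hT, ← mul_assoc, ← mul_pow, hmw, one_pow, one_mul]
  have hq : 0 < m ^ g := by positivity
  have hR := Cond_card T (EE n (m ^ g)) L (g * I + 1) hL
  refine ⟨DD m n (m ^ g) H (g * I + 1) L T, ?_, ?_⟩
  · intro c hc c' hc' j hj j' hj' i hi i' hi' h
    rw [← hT', ← hT'] at h
    exact DD_inj hT hc hc' hj hj' hi hi' h
  · rw [ZMod.card] at hR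
    refine hR.trans (Nat.add_le_add (Nat.add_le_add (Nat.mul_le_mul_left _ ?_)
      (Nat.mul_le_mul_left _ (EE_card hq))) ?_)
    · refine (DD_card hH hT).trans ?_
      have := unstab_card (n := n) (H := H) (R := g * I + 1) hq hm hT
      gcongr
    · refine le_trans (card_le_card ?_) (nonhit_card (n := n) hq I)
      intro x hx
      simp only [mem_filter, mem_univ, true_and] at hx ⊢
      intro s hs
      have h1 := hx (g * s) (Nat.lt_succ_of_le (Nat.mul_le_mul_left _ hs.le))
      rw [hT, pow_mul] at h1
      push_cast
      exact h1

theorem tile_real {m L H : ℕ} (hm : 1 < m) (hL : 0 < L) (hH : 0 < H) {δ : ℝ} (hδ : 0 < δ) :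
    ∃ C : ℕ, ∀ n : ℕ, n > C → n.Coprime m →
    ∃ D : Finset (ZMod n), (∀ c ∈ D, ∀ c' ∈ D, ∀ j < L, ∀ j' < L, ∀ i < H, ∀ i' < H,
      ((m : ZMod n)⁻¹) ^ j * (c + (i : ℕ)) = ((m : ZMod n)⁻¹) ^ j' * (c' + (i' : ℕ)) →
        c = c' ∧ j = j' ∧ i = i') ∧ (1 - δ) * n ≤ (D.card : ℝ) * (L * H) := by
  have hm' : (1 : ℝ) < m := by exact_mod_cast hm
  obtain ⟨g, hg⟩ := pow_unbounded_of_one_lt (L / (δ / 4)) hm'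
  have hq : (0 : ℝ) < (m : ℝ) ^ g := by positivity
  have hq1 : (1 : ℝ) ≤ (m : ℝ) ^ g := one_le_pow₀ hm'.le
  have hg' : (L : ℝ) / (m : ℝ) ^ g ≤ δ / 4 := by
    rw [div_le_iff₀ hq]
    rw [div_lt_iff₀ (by positivity)] at hg
    linarith
  obtain ⟨I, hI⟩ := exists_pow_lt_of_lt_one (show 0 < δ / 4 by positivity)
    (show ((m : ℝ) ^ g - 1) / (m : ℝ) ^ g < 1 by rw [div_lt_one hq]; linarith)
  set B : ℝ := L * (H * ((g * I + 1) * (H * (2 * (m ^ (g * I + 1) * H)))) + H) + L +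
    ((m : ℝ) ^ g - 1) ^ I with hB
  obtain ⟨C, hC⟩ := exists_nat_ge (B / (δ / 2))
  refine ⟨C, fun n hn hcop => ?_⟩
  have : NeZero n := ⟨by omega⟩
  obtain ⟨D, h1, h2⟩ := tile_nat (g := g) (I := I) (by omega : 0 < m) hL hH hcop
  refine ⟨D, h1, ?_⟩
  have hn0 : (0 : ℝ) ≤ n := by positivity
  have hnB : B ≤ n * (δ / 2) := by
    rw [div_le_iff₀ (by positivity)] at hC
    have : (C : ℝ) ≤ n := by exact_mod_cast hn.le
    nlinarith
  have hmg : 1 ≤ m ^ g := Nat.one_le_pow _ _ (by omega)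
  have h3 : (n : ℝ) ≤ L * (H * D.card + H * ((g * I + 1) * (H * (2 * (m ^ (g * I + 1) * H)))) + H) +
      L * ((n / m ^ g : ℕ) + 1) + ((m : ℝ) ^ g - 1) ^ I * ((n / (m ^ g) ^ I : ℕ) + 1) := by
    have : ((m ^ g - 1 : ℕ) : ℝ) = (m : ℝ) ^ g - 1 := by push_cast [Nat.cast_sub hmg]; ring
    rw [← this]
    exact_mod_cast h2
  have h4 : ((n / m ^ g : ℕ) : ℝ) ≤ n / (m : ℝ) ^ g := by
    refine Nat.cast_div_le.trans ?_
    push_cast; exact le_rfl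
  have h5 : ((n / (m ^ g) ^ I : ℕ) : ℝ) ≤ n / ((m : ℝ) ^ g) ^ I := by
    refine Nat.cast_div_le.trans ?_
    push_cast; exact le_rfl
  have h6 : (L : ℝ) * (n / m ^ g : ℕ) ≤ δ / 4 * n := by
    calc (L : ℝ) * (n / m ^ g : ℕ) ≤ L * (n / (m : ℝ) ^ g) := by gcongr
      _ = L / (m : ℝ) ^ g * n := by ring
      _ ≤ _ := by gcongr
  have h7 : ((m : ℝ) ^ g - 1) ^ I * (n / (m ^ g) ^ I : ℕ) ≤ δ / 4 * n := by
    have h0 : 0 ≤ ((m : ℝ) ^ g - 1) ^ I := pow_nonneg (by linarith) _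
    calc ((m : ℝ) ^ g - 1) ^ I * (n / (m ^ g) ^ I : ℕ)
        ≤ ((m : ℝ) ^ g - 1) ^ I * (n / ((m : ℝ) ^ g) ^ I) := by gcongr
      _ = (((m : ℝ) ^ g - 1) / (m : ℝ) ^ g) ^ I * n := by rw [div_pow]; ring
      _ ≤ _ := by gcongr
  have e1 : (L : ℝ) * (H * D.card + H * ((g * I + 1) * (H * (2 * (m ^ (g * I + 1) * H)))) + H) +
      L * ((n / m ^ g : ℕ) + 1) + ((m : ℝ) ^ g - 1) ^ I * ((n / (m ^ g) ^ I : ℕ) + 1) =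
      D.card * (L * H) + B + L * (n / m ^ g : ℕ) + ((m : ℝ) ^ g - 1) ^ I * (n / (m ^ g) ^ I : ℕ) := by
    rw [hB]; ring
  rw [e1] at h3
  linarith

end Blocks
end HJ

namespace HJ

section Assemble
open Classical Finset

theorem assemble {G : Type} [Group G] [Fintype G] {a t : G} {m L H n : ℕ} [NeZero n]
    (hn : n.Coprime m) (hm : 0 < m) (ht : t ^ 4 = 1)
    (hab : (t * a * t⁻¹) * a * (t * a * t⁻¹)⁻¹ = a ^ m)
    (D : Type) [Fintype D] [Nonempty D] (ρ : D → G) (e : D × Fin L × Fin H ≃ G)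
    (he : ∀ d j i, e (d, j, i) = ((t * a * t⁻¹) ^ (j : ℕ))⁻¹ * (a ^ (i : ℕ) * ρ d))
    (E : Finset (ZMod n))
    (hE : ∀ c ∈ E, ∀ c' ∈ E, ∀ j < L, ∀ j' < L, ∀ i < H, ∀ i' < H,
      ((m : ZMod n)⁻¹) ^ j * (c + (i : ℕ)) = ((m : ZMod n)⁻¹) ^ j' * (c' + (i' : ℕ)) →
        c = c' ∧ j = j' ∧ i = i') :
    ∃ f : Equiv.Perm (ZMod n), f ^ 4 = 1 ∧ ∃ N : ℕ, N * (L * H) ≤ n ∧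
      E.card ≤ N + Fintype.card D ∧
      N * (L * H) ≤ ({x : ZMod n | f (x + 1) = (m : ZMod n) * f x}).ncard +
        N * (L * m ^ L + H) := by
  have hmw : (m : ZMod n) * (m : ZMod n)⁻¹ = 1 := ZMod.coe_mul_inv_eq_one m hn.symm
  set w : ZMod n := (m : ZMod n)⁻¹ with hw
  set b := t * a * t⁻¹ with hb
  have hmwj : ∀ j : ℕ, w ^ j * (m : ZMod n) ^ j = 1 := by
    intro j; rw [← mul_pow, mul_comm, hmw, one_pow]
  obtain ⟨N', hN'⟩ : ∃ N', N' = E.card / Fintype.card D := ⟨_, rfl⟩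
  have hD : 0 < Fintype.card D := Fintype.card_pos
  have hcard : Fintype.card (Fin N' × D) ≤ Fintype.card E := by
    rw [Fintype.card_prod, Fintype.card_fin, Fintype.card_coe, hN']
    exact Nat.div_mul_le_self _ _
  obtain ⟨ι⟩ := Function.Embedding.nonempty_of_card_le hcard
  let ψ : Fin N' × G → ZMod n := fun x =>
    w ^ ((e.symm x.2).2.1 : ℕ) * ((ι (x.1, (e.symm x.2).1) : ZMod n) + ((e.symm x.2).2.2 : ℕ))
  have hψe : ∀ τ d j i, ψ (τ, e (d, j, i)) =
      w ^ (j : ℕ) * ((ι (τ, d) : ZMod n) + ((i : ℕ) : ZMod n)) := by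
    intro τ d j i
    simp only [ψ, Equiv.symm_apply_apply]
  have hψ : Function.Injective ψ := by
    rintro ⟨τ, g⟩ ⟨τ', g'⟩ h
    obtain ⟨⟨d, j, i⟩, rfl⟩ := e.surjective g
    obtain ⟨⟨d', j', i'⟩, rfl⟩ := e.surjective g'
    rw [hψe, hψe] at h
    obtain ⟨h1, h2, h3⟩ := hE _ (ι (τ, d)).2 _ (ι (τ', d')).2 j j.2 j' j'.2 i i.2 i' i'.2 h
    have h4 := ι.injective (Subtype.ext h1)
    obtain rfl := Fin.ext h2
    obtain rfl := Fin.ext h3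
    obtain ⟨rfl, rfl⟩ := Prod.mk.inj h4
    rfl
  let σ : Equiv.Perm (Fin N' × G) :=
    { toFun := fun x => (x.1, t * x.2)
      invFun := fun x => (x.1, t⁻¹ * x.2)
      left_inv := fun x => by simp
      right_inv := fun x => by simp }
  have hσ : σ ^ 4 = 1 := by
    ext x : 1
    rcases x with ⟨τ, g⟩
    change (τ, t * (t * (t * (t * g)))) = (τ, g)
    have : t * (t * (t * (t * g))) = t ^ 4 * g := by simp only [pow_succ, pow_zero, one_mul, mul_assoc]
    rw [this, ht, one_mul]
  let f : Equiv.Perm (ZMod n) := σ.extendDomain (Equiv.ofInjective ψ hψ)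
  have hf : ∀ x, f (ψ x) = ψ (σ x) := fun x =>
    Equiv.Perm.extendDomain_apply_image σ (Equiv.ofInjective ψ hψ) x
  have hcG : Fintype.card G = Fintype.card D * (L * H) := by
    rw [← Fintype.card_congr e]; simp
  refine ⟨f, ?_, N' * Fintype.card D, ?_, ?_, ?_⟩
  · rw [← Equiv.Perm.extendDomain_pow, hσ, Equiv.Perm.extendDomain_one]
  · have := Fintype.card_le_of_injective ψ hψ
    rw [Fintype.card_prod, Fintype.card_fin, hcG, ZMod.card, ← mul_assoc] at this
    exact this
  · have := Nat.lt_div_mul_add (a := E.card) hD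
    rw [hN']; omega
  · -- counting good points
    have ha : ∀ (d : D) (j : Fin L) (i : Fin H) (hi : (i : ℕ) + m ^ (j : ℕ) < H),
        a * e (d, j, i) = e (d, j, ⟨(i : ℕ) + m ^ (j : ℕ), hi⟩) := by
      intro d j i hi
      rw [he, he]
      have h1 := conj_rel hab (j : ℕ) 1
      rw [pow_one, one_mul] at h1
      have h2 : a * (b ^ (j : ℕ))⁻¹ = (b ^ (j : ℕ))⁻¹ * a ^ (m ^ (j : ℕ)) := by
        rw [eq_inv_mul_iff_mul_eq, ← mul_assoc, h1, mul_inv_cancel_right]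
      rw [← mul_assoc, h2, mul_assoc, ← mul_assoc (a ^ _), ← pow_add, add_comm]
    have hbb : ∀ d i (j : ℕ) (hj : j + 1 < L) (hj' : j < L),
        b * e (d, ⟨j + 1, hj⟩, i) = e (d, ⟨j, hj'⟩, i) := by
      intro d i j hj hj'
      rw [he, he]
      simp only [pow_succ b j, mul_inv_rev]
      rw [mul_assoc b⁻¹, mul_inv_cancel_left]
    let bad1 : Finset G := univ.filter fun g => H ≤ ((e.symm g).2.2 : ℕ) + m ^ L
    let bad2 : Finset G := univ.filter fun g => ((e.symm (t * g)).2.1 : ℕ) = 0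
    have hbad1 : bad1.card ≤ Fintype.card D * (L * m ^ L) := by
      have h1 : bad1.card ≤ ((univ : Finset D) ×ˢ ((univ : Finset (Fin L)) ×ˢ
          (univ.filter fun i : Fin H => H ≤ (i : ℕ) + m ^ L))).card := by
        refine card_le_card_of_injOn e.symm ?_ (e.symm.injective.injOn)
        intro g hg
        simpa [bad1] using hg
      have h2 : (univ.filter fun i : Fin H => H ≤ (i : ℕ) + m ^ L).card ≤ m ^ L := by
        have : (univ.filter fun i : Fin H => H ≤ (i : ℕ) + m ^ L).card ≤ (range (m ^ L)).card := by
          refine card_le_card_of_injOn (fun i => H - 1 - (i : ℕ)) ?_ ?_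
          · intro i hi
            have hi' : H ≤ (i : ℕ) + m ^ L := by simpa using hi
            have := i.2
            simp only [coe_range, Set.mem_Iio]
            omega
          · intro i _ i' _ h
            have := i.2
            have := i'.2
            have h : H - 1 - (i : ℕ) = H - 1 - (i' : ℕ) := h
            exact Fin.ext (by omega)
        simpa using this
      rw [card_product, card_product, card_univ, card_univ, Fintype.card_fin] at h1
      exact h1.trans (by gcongr)
    have hbad2 : bad2.card ≤ Fintype.card D * H := by
      have : bad2.card ≤ (univ : Finset (D × Fin H)).card := by
        refine card_le_card_of_injOn
          (fun g => ((e.symm (t * g)).1, (e.symm (t * g)).2.2)) (fun _ _ => by simp) ?_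
        intro g hg g' hg' h
        have hg : ((e.symm (t * g)).2.1 : ℕ) = 0 := by simpa [bad2] using hg
        have hg' : ((e.symm (t * g')).2.1 : ℕ) = 0 := by simpa [bad2] using hg'
        have h1 := (Prod.mk.inj h).1
        have h2 := (Prod.mk.inj h).2
        have h3 : (e.symm (t * g)).2.1 = (e.symm (t * g')).2.1 := Fin.ext (hg.trans hg'.symm)
        exact mul_left_cancel (e.symm.injective (Prod.ext h1 (Prod.ext h3 h2)))
      simpa using this
    have hgood : ∀ τ g, g ∉ bad1 → g ∉ bad2 →
        f (ψ (τ, g) + 1) = (m : ZMod n) * f (ψ (τ, g)) := by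
      intro τ g h1 h2
      have e1 : ψ (τ, g) + 1 = ψ (τ, a * g) := by
        obtain ⟨⟨d, j, i⟩, rfl⟩ := e.surjective g
        simp only [bad1, mem_filter, mem_univ, true_and, Equiv.symm_apply_apply, not_le] at h1
        have h3 : m ^ (j : ℕ) ≤ m ^ L := Nat.pow_le_pow_right hm j.2.le
        rw [ha d j i (by omega), hψe, hψe]
        push_cast
        rw [← add_assoc, mul_add _ _ ((m : ZMod n) ^ (j : ℕ)), hmwj]
      have e2 : ψ (τ, b * (t * g)) = (m : ZMod n) * ψ (τ, t * g) := by
        simp only [bad2, mem_filter, mem_univ, true_and] at h2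
        generalize t * g = g' at h2
        obtain ⟨⟨d, ⟨j, hj⟩, i⟩, rfl⟩ := e.surjective g'
        rw [Equiv.symm_apply_apply] at h2
        obtain ⟨j, rfl⟩ := Nat.exists_eq_succ_of_ne_zero h2
        rw [hbb d i j hj (by omega), hψe, hψe]
        simp only [Nat.succ_eq_add_one, pow_succ']
        rw [← mul_assoc, ← mul_assoc, hmw, one_mul]
      rw [e1, hf, hf]
      change ψ (τ, t * (a * g)) = (m : ZMod n) * ψ (τ, t * g)
      rw [← e2]
      congr 2
      rw [hb]; group
    have hsub : (univ : Finset (Fin N' × G)) ⊆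
        (univ.filter fun x : Fin N' × G => f (ψ x + 1) = (m : ZMod n) * f (ψ x)) ∪
          ((univ : Finset (Fin N')) ×ˢ (bad1 ∪ bad2)) := by
      rintro ⟨τ, g⟩ _
      by_cases h : g ∈ bad1 ∪ bad2
      · exact mem_union_right _ (by simp only [mem_product, mem_univ, true_and]; exact h)
      · rw [mem_union, not_or] at h
        exact mem_union_left _ (by
          simp only [mem_filter, mem_univ, true_and]; exact hgood τ g h.1 h.2)
    have hc := (card_le_card hsub).trans (card_union_le _ _)
    rw [card_product, card_univ, card_univ, Fintype.card_prod, Fintype.card_fin, hcG] at hc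
    have hc2 : (univ.filter fun x : Fin N' × G => f (ψ x + 1) = (m : ZMod n) * f (ψ x)).card ≤
        ({x : ZMod n | f (x + 1) = (m : ZMod n) * f x}).ncard := by
      rw [← Set.ncard_coe_finset]
      refine Set.ncard_le_ncard_of_injOn ψ ?_ hψ.injOn (Set.toFinite _)
      intro x hx
      simpa using hx
    have hc3 : (bad1 ∪ bad2).card ≤ Fintype.card D * (L * m ^ L + H) := by
      rw [mul_add]
      exact (card_union_le _ _).trans (Nat.add_le_add hbad1 hbad2)
    calc N' * Fintype.card D * (L * H) = N' * (Fintype.card D * (L * H)) := by ring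
      _ ≤ _ := hc
      _ ≤ _ := Nat.add_le_add hc2 (Nat.mul_le_mul_left _ hc3)
      _ = _ := by ring

theorem main_result (m : ℕ) (hm : 2 < m) (ε : ℝ) (hε : 0 < ε) :
    ∃ C : ℕ, ∀ n : ℕ, n > C → Nat.Coprime n m →
      ∃ f : Equiv.Perm (ZMod n), f ^ 4 = 1 ∧
        (1 - ε) * n ≤ (({x : ZMod n | f (x + 1) = (m : ZMod n) * f x}).ncard : ℝ) := by
  obtain ⟨p, hp, hpm⟩ := Nat.exists_prime_and_dvd (n := m - 1) (by omega)
  have : Fact p.Prime := ⟨hp⟩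
  have hm1 : m ≡ 1 [MOD p] := ((Nat.modEq_iff_dvd' (by omega)).2 hpm).symm
  have hp1 : (1 : ℝ) < p := by exact_mod_cast hp.one_lt
  obtain ⟨l, hl⟩ := pow_unbounded_of_one_lt (4 / ε) hp1
  obtain ⟨K, hK⟩ := pow_unbounded_of_one_lt (max ((m : ℝ) ^ p ^ l) (4 * (m : ℝ) ^ p ^ l / ε)) hp1
  obtain ⟨G, _, _, a, t, k, ht, hab, hak, hKk⟩ := exists_group (p := p) m hm1 (by omega) K
  have := Fintype.ofFinite G
  obtain ⟨L, hLdef⟩ : ∃ L, L = p ^ l := ⟨_, rfl⟩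
  have hL0 : 0 < L := by rw [hLdef]; exact Nat.pow_pos hp.pos
  have hH0 : 0 < orderOf a := orderOf_pos a
  have hHK : (p : ℝ) ^ K ≤ (orderOf a : ℝ) := by
    rw [hak]; push_cast; exact pow_le_pow_right₀ hp1.le hKk
  have hmH : (m : ℝ) ^ L ≤ (orderOf a : ℝ) := by
    rw [hLdef]; exact ((le_max_left _ _).trans hK.le).trans hHK
  have hmH' : 4 * (m : ℝ) ^ L / ε ≤ (orderOf a : ℝ) := by
    rw [hLdef]; exact ((le_max_right _ _).trans hK.le).trans hHK
  have hbo : orderOf (t * a * t⁻¹) = p ^ k := by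
    rw [← hak]
    exact orderOf_injective (MulAut.conj t).toMonoidHom (MulAut.conj t).injective a
  have : NeZero L := ⟨hL0.ne'⟩
  obtain ⟨D, hD⟩ := exists_tile (L := L) hab (fun j hj => by
    rw [hLdef]
    refine b_pow_mem hp (by omega) hab hak hbo ?_ hj
    rw [← hak, ← hLdef]
    exact_mod_cast hmH)
  have := Fintype.ofFinite D
  have hDne : Nonempty D := by
    obtain ⟨x, -⟩ := hD.2 1
    exact ⟨x.1⟩
  obtain ⟨C1, hC1⟩ := tile_real (m := m) (L := L) (H := orderOf a) (by omega) hL0 hH0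
    (δ := ε / 4) (by positivity)
  obtain ⟨C2, hC2⟩ := exists_nat_ge ((Fintype.card D : ℝ) * (L * orderOf a) / (ε / 4))
  refine ⟨max C1 C2, fun n hn hcop => ?_⟩
  have hn1 : n > C1 := lt_of_le_of_lt (le_max_left _ _) hn
  have hn2 : n > C2 := lt_of_le_of_lt (le_max_right _ _) hn
  have : NeZero n := ⟨by omega⟩
  obtain ⟨E, hE, hEc⟩ := hC1 n hn1 hcop
  obtain ⟨f, hf, N, h1, h2, h3⟩ := assemble hcop (by omega) ht hab D (fun d => d.1)
    (Equiv.ofBijective _ hD) (fun d j i => rfl) E hE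
  refine ⟨f, hf, ?_⟩
  generalize ({x : ZMod n | f (x + 1) = (m : ZMod n) * f x}).ncard = Q at h3 ⊢
  generalize orderOf a = H at *
  generalize Fintype.card D = d at *
  have h1' : (N : ℝ) * (L * H) ≤ n := by exact_mod_cast h1
  have h2' : (E.card : ℝ) ≤ N + d := by exact_mod_cast h2
  have h3' : (N : ℝ) * (L * H) ≤ Q + N * (L * (m : ℝ) ^ L + H) := by exact_mod_cast h3
  have hLr : (0 : ℝ) < L := by exact_mod_cast hL0
  have hHr : (0 : ℝ) < H := by exact_mod_cast hH0
  have hNr : (0 : ℝ) ≤ N := Nat.cast_nonneg N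
  have g1 : (d : ℝ) * (L * H) ≤ ε / 4 * n := by
    rw [div_le_iff₀ (by positivity)] at hC2
    have : (C2 : ℝ) ≤ n := by exact_mod_cast hn2.le
    nlinarith
  have g2 : (m : ℝ) ^ L ≤ ε / 4 * H := by
    rw [div_le_iff₀ hε] at hmH'
    linarith
  have g3 : 1 ≤ ε / 4 * L := by
    rw [← Nat.cast_pow, ← hLdef, div_lt_iff₀ hε] at hl
    linarith
  have g4 : (N : ℝ) * (L * (m : ℝ) ^ L + H) ≤ ε / 2 * n := by
    have i1 : (L : ℝ) * (m : ℝ) ^ L ≤ L * (ε / 4 * H) := by gcongr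
    have i2 : (H : ℝ) ≤ (ε / 4 * L) * H := by nlinarith
    calc (N : ℝ) * (L * (m : ℝ) ^ L + H) ≤ N * (L * (ε / 4 * H) + (ε / 4 * L) * H) := by gcongr
      _ = ε / 2 * (N * (L * H)) := by ring
      _ ≤ _ := by gcongr
  have g5 : (E.card : ℝ) * (L * H) ≤ (N + d) * (L * H) := by gcongr
  linarith

end Assemble
end HJ

theorem exists_perm_order_four_conjugating_shift_to_mul (m : ℕ) (hm : 2 < m)
    (ε : ℝ) (hε : 0 < ε) :
    ∃ C : ℕ, ∀ n : ℕ, n > C → Nat.Coprime n m →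
      ∃ f : Equiv.Perm (ZMod n), f ^ 4 = 1 ∧
        (1 - ε) * n ≤ (({x : ZMod n | f (x + 1) = (m : ZMod n) * f x}).ncard : ℝ) := by
  exact HJ.main_result m hm ε hε
end

section
/- Let G be an amenable group, let A, B ≤ G be subgroups, let φ: B → A be a group isomorphism, and let k ≥ 1 be an integer. Suppose that for every finite subset S ⊆ G and all δ, ε > 0 there exist n ∈ ℕ, an (S,δ,n)-approximation ψ of G, and f ∈ Sym(n) with f^k = id such that d(ψ(b) ∘ f, f ∘ ψ(φ(b))) < ε for every b ∈ S ∩ B with φ(b) ∈ S. Then for every finite subset S ⊆ G and every ε > 0 there exist a finite subset S' ⊆ G with S ⊆ S', δ > 0, and an integer N such that: whenever ψ is an (S',δ,n)-approximation of G with n > N, there exists a permutation f ∈ Sym(n) with f^k = id such that d(ψ(b) ∘ f, f ∘ ψ(φ(b))) < ε for every b ∈ S ∩ B with φ(b) ∈ S. -/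
open scoped symmDiff

/-- The normalized Hamming distance on the symmetric group `Sym(n)`. -/
noncomputable def permDist {n : ℕ} (ρ σ : Equiv.Perm (Fin n)) : ℝ :=
  ((Finset.univ.filter fun i => ρ i ≠ σ i).card : ℝ) / n

/-- `ψ : G → Sym(n)` is an `(S, δ, n)`-approximation of `G`. -/
def IsApprox {G : Type*} [Group G] (S : Set G) (δ : ℝ) {n : ℕ}
    (ψ : G → Equiv.Perm (Fin n)) : Prop :=
  (∀ g ∈ S, ∀ h ∈ S, g * h ∈ S → permDist (ψ g * ψ h) (ψ (g * h)) < δ) ∧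
  (∀ g ∈ S, g ≠ 1 → 1 - δ < permDist (ψ g) 1)

/-- A group is amenable when it satisfies the Følner condition: for every finite `S ⊆ G` and
`ε > 0` there is a nonempty finite `Φ ⊆ G` with `|gΦ ∆ Φ| < ε|Φ|` for all `g ∈ S`. -/
def FolnerAmenable (G : Type*) [Group G] : Prop :=
  ∀ S : Set G, S.Finite → ∀ ε : ℝ, 0 < ε →
    ∃ Φ : Set G, Φ.Finite ∧ Φ.Nonempty ∧
      ∀ g ∈ S, ((((g * ·) '' Φ) ∆ Φ).ncard : ℝ) < ε * Φ.ncard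

section Helpers

open Classical Finset

variable {G : Type*} [Group G] {V V₁ V₂ : Type} [Fintype V] [Fintype V₁] [Fintype V₂]

/-- Points at which `ψ` behaves like a free action as far as `K` sees. -/
def GoodPt (ψ : G → Equiv.Perm V) (K : Finset G) (x : V) : Prop :=
  (∀ g ∈ K, ∀ h ∈ K, g * h ∈ K → ψ g (ψ h x) = ψ (g * h) x) ∧ (∀ g ∈ K, g ≠ 1 → ψ g x ≠ x)

/-- Number of bad points. -/
noncomputable def badCount (ψ : G → Equiv.Perm V) (K : Finset G) : ℕ :=
  #{x : V | ¬ GoodPt ψ K x}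

/-- Size of the `s`-boundary of `D`. -/
noncomputable def bdry (ψ : G → Equiv.Perm V) (D : Finset V) (s : G) : ℕ :=
  #{v ∈ D | ψ s v ∉ D}

/-- A partial almost equivariant matching. -/
structure St (ψ₁ : G → Equiv.Perm V₁) (ψ₂ : G → Equiv.Perm V₂) (S : Finset G) (ε : ℝ)
    (D₁ : Finset V₁) (D₂ : Finset V₂) (M : Finset (V₁ × V₂)) : Prop where
  inj1 : ∀ p ∈ M, ∀ q ∈ M, p.1 = q.1 → p = q
  inj2 : ∀ p ∈ M, ∀ q ∈ M, p.2 = q.2 → p = q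
  sub1 : ∀ p ∈ M, p.1 ∈ D₁
  sub2 : ∀ p ∈ M, p.2 ∈ D₂
  big1 : (1 - ε) * (#D₁ : ℝ) ≤ #M
  big2 : (1 - ε) * (#D₂ : ℝ) ≤ #M
  qual : ∀ s ∈ S, (#{p ∈ M | (ψ₁ s p.1, ψ₂ s p.2) ∉ M} : ℝ) ≤ 4 * ε * #M

lemma bdry_ext (ψ : G → Equiv.Perm V) (D : Finset V) (F : Finset G) (s : G) (x : V)
    (hmul : ∀ g ∈ F, s * g ∈ F → ψ s (ψ g x) = ψ (s * g) x) :
    bdry ψ (D ∪ F.image (fun g => ψ g x)) s ≤ bdry ψ D s + #{g ∈ F | s * g ∉ F} := by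
  unfold bdry
  have h : {v ∈ D ∪ F.image (fun g => ψ g x) | ψ s v ∉ D ∪ F.image (fun g => ψ g x)} ⊆
      {v ∈ D | ψ s v ∉ D} ∪ ({g ∈ F | s * g ∉ F}).image (fun g => ψ g x) := by
    intro v hv
    simp only [mem_filter, mem_union, mem_image, not_or, not_exists, not_and] at hv ⊢
    obtain ⟨hv | ⟨g, hg, rfl⟩, h1, h2⟩ := hv
    · exact Or.inl ⟨hv, h1⟩
    · refine Or.inr ⟨g, ⟨hg, fun hsg => ?_⟩, rfl⟩
      exact h2 _ hsg (hmul g hg hsg).symm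
  exact (card_le_card h).trans ((card_union_le _ _).trans (Nat.add_le_add_left card_image_le _))

lemma St.ext {ψ₁ : G → Equiv.Perm V₁} {ψ₂ : G → Equiv.Perm V₂} {S : Finset G} {ε : ℝ}
    {D₁ : Finset V₁} {D₂ : Finset V₂} {M : Finset (V₁ × V₂)} (st : St ψ₁ ψ₂ S ε D₁ D₂ M)
    (hε : 0 < ε) (hε2 : ε ≤ 1 / 2)
    (F : Finset G) (x : V₁) (y : V₂)
    (hF : ∀ s ∈ S, (#{g ∈ F | s * g ∉ F} : ℝ) ≤ ε * #F)
    (hm1 : ∀ s ∈ S, ∀ g ∈ F, s * g ∈ F → ψ₁ s (ψ₁ g x) = ψ₁ (s * g) x)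
    (hm2 : ∀ s ∈ S, ∀ g ∈ F, s * g ∈ F → ψ₂ s (ψ₂ g y) = ψ₂ (s * g) y)
    (hi1 : ∀ g ∈ F, ∀ h ∈ F, ψ₁ g x = ψ₁ h x → g = h)
    (hi2 : ∀ g ∈ F, ∀ h ∈ F, ψ₂ g y = ψ₂ h y → g = h)
    (hbig : (#{g ∈ F | ψ₁ g x ∈ D₁ ∨ ψ₂ g y ∈ D₂} : ℝ) ≤ ε * #F) :
    ∃ M' : Finset (V₁ × V₂), (#M : ℝ) + (1 - ε) * #F ≤ #M' ∧
      St ψ₁ ψ₂ S ε (D₁ ∪ F.image (fun g => ψ₁ g x)) (D₂ ∪ F.image (fun g => ψ₂ g y)) M' := by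
  set F' := {g ∈ F | ¬ (ψ₁ g x ∈ D₁ ∨ ψ₂ g y ∈ D₂)} with hF'
  have hcF : (#{g ∈ F | ψ₁ g x ∈ D₁ ∨ ψ₂ g y ∈ D₂} : ℝ) + #F' = #F := by
    exact_mod_cast card_filter_add_card_filter_not (s := F) _
  have hF'F : ∀ g ∈ F', g ∈ F := fun g hg => (mem_filter.1 hg).1
  have hF'1 : ∀ g ∈ F', ψ₁ g x ∉ D₁ := fun g hg h => (mem_filter.1 hg).2 (Or.inl h)
  have hF'2 : ∀ g ∈ F', ψ₂ g y ∉ D₂ := fun g hg h => (mem_filter.1 hg).2 (Or.inr h)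
  set P := F'.image (fun g => (ψ₁ g x, ψ₂ g y)) with hP
  have hPc : #P = #F' := by
    apply card_image_of_injOn
    intro g hg h hh hgh
    exact hi1 g (hF'F g hg) h (hF'F h hh) (Prod.ext_iff.1 hgh).1
  have hdis : Disjoint M P := by
    rw [Finset.disjoint_left]
    intro p hp hpP
    obtain ⟨g, hg, rfl⟩ := mem_image.1 hpP
    exact hF'1 g hg (st.sub1 _ hp)
  have hc : (#(M ∪ P) : ℝ) = #M + #F' := by
    rw [card_union_of_disjoint hdis, hPc]; push_cast; ring
  have hF'big : (1 - ε) * #F ≤ #F' := by linarith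
  refine ⟨M ∪ P, by linarith, ?_⟩
  refine ⟨?_, ?_, ?_, ?_, ?_, ?_, ?_⟩
  · intro p hp q hq hpq
    rcases mem_union.1 hp with hp | hp <;> rcases mem_union.1 hq with hq | hq
    · exact st.inj1 p hp q hq hpq
    · obtain ⟨g, hg, rfl⟩ := mem_image.1 hq
      exact absurd (show _ ∈ _ from (show p.1 = ψ₁ g x from hpq) ▸ st.sub1 _ hp) (hF'1 g hg)
    · obtain ⟨g, hg, rfl⟩ := mem_image.1 hp
      exact absurd (show _ ∈ _ from (show q.1 = ψ₁ g x from hpq.symm) ▸ st.sub1 _ hq) (hF'1 g hg)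
    · obtain ⟨g, hg, rfl⟩ := mem_image.1 hp
      obtain ⟨h, hh, rfl⟩ := mem_image.1 hq
      rw [hi1 g (hF'F g hg) h (hF'F h hh) hpq]
  · intro p hp q hq hpq
    rcases mem_union.1 hp with hp | hp <;> rcases mem_union.1 hq with hq | hq
    · exact st.inj2 p hp q hq hpq
    · obtain ⟨g, hg, rfl⟩ := mem_image.1 hq
      exact absurd (show _ ∈ _ from (show p.2 = ψ₂ g y from hpq) ▸ st.sub2 _ hp) (hF'2 g hg)
    · obtain ⟨g, hg, rfl⟩ := mem_image.1 hp
      exact absurd (show _ ∈ _ from (show q.2 = ψ₂ g y from hpq.symm) ▸ st.sub2 _ hq) (hF'2 g hg)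
    · obtain ⟨g, hg, rfl⟩ := mem_image.1 hp
      obtain ⟨h, hh, rfl⟩ := mem_image.1 hq
      rw [hi2 g (hF'F g hg) h (hF'F h hh) hpq]
  · intro p hp
    rcases mem_union.1 hp with hp | hp
    · exact mem_union_left _ (st.sub1 _ hp)
    · obtain ⟨g, hg, rfl⟩ := mem_image.1 hp
      exact mem_union_right _ (mem_image_of_mem _ (hF'F g hg))
  · intro p hp
    rcases mem_union.1 hp with hp | hp
    · exact mem_union_left _ (st.sub2 _ hp)
    · obtain ⟨g, hg, rfl⟩ := mem_image.1 hp
      exact mem_union_right _ (mem_image_of_mem _ (hF'F g hg))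
  · have h1 : (#(D₁ ∪ F.image (fun g => ψ₁ g x)) : ℝ) ≤ #D₁ + #F := by
      exact_mod_cast (card_union_le _ _).trans (Nat.add_le_add_left card_image_le _)
    have := st.big1
    nlinarith
  · have h1 : (#(D₂ ∪ F.image (fun g => ψ₂ g y)) : ℝ) ≤ #D₂ + #F := by
      exact_mod_cast (card_union_le _ _).trans (Nat.add_le_add_left card_image_le _)
    have := st.big2
    nlinarith
  · intro s hs
    have hsub : {p ∈ M ∪ P | (ψ₁ s p.1, ψ₂ s p.2) ∉ M ∪ P} ⊆
        {p ∈ M | (ψ₁ s p.1, ψ₂ s p.2) ∉ M} ∪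
          (({g ∈ F | s * g ∉ F}).image (fun g => (ψ₁ g x, ψ₂ g y)) ∪
          (({g ∈ F | ψ₁ g x ∈ D₁ ∨ ψ₂ g y ∈ D₂}).image
            (fun g => (ψ₁ (s⁻¹ * g) x, ψ₂ (s⁻¹ * g) y)))) := by
      intro p hp
      rw [mem_filter] at hp
      obtain ⟨hp, hn⟩ := hp
      rw [mem_union, not_or] at hn
      rcases mem_union.1 hp with hp | hp
      · exact mem_union_left _ (mem_filter.2 ⟨hp, hn.1⟩)
      · apply mem_union_right
        obtain ⟨g, hg, rfl⟩ := mem_image.1 hp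
        by_cases hsg : s * g ∈ F
        · apply mem_union_right
          refine mem_image.2 ⟨s * g, mem_filter.2 ⟨hsg, ?_⟩, by simp⟩
          by_contra hcon
          apply hn.2
          refine mem_image.2 ⟨s * g, mem_filter.2 ⟨hsg, hcon⟩, ?_⟩
          rw [hm1 s hs g (hF'F g hg) hsg, hm2 s hs g (hF'F g hg) hsg]
        · exact mem_union_left _ (mem_image_of_mem _ (mem_filter.2 ⟨hF'F g hg, hsg⟩))
    have h1 : (#{p ∈ M ∪ P | (ψ₁ s p.1, ψ₂ s p.2) ∉ M ∪ P} : ℝ) ≤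
        #{p ∈ M | (ψ₁ s p.1, ψ₂ s p.2) ∉ M} + (#{g ∈ F | s * g ∉ F} +
          #{g ∈ F | ψ₁ g x ∈ D₁ ∨ ψ₂ g y ∈ D₂}) := by
      exact_mod_cast (card_le_card hsub).trans ((card_union_le _ _).trans
        (Nat.add_le_add_left ((card_union_le _ _).trans
          (Nat.add_le_add card_image_le card_image_le)) _))
    have h2 := st.qual s hs
    have h3 := hF s hs
    have h4 : (0:ℝ) ≤ #F := by positivity
    rw [hc]
    nlinarith

lemma GoodPt.inj {ψ : G → Equiv.Perm V} {K F : Finset G} {x : V} (h : GoodPt ψ K x)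
    (hFK : F ⊆ K) (hFF : ∀ g ∈ F, ∀ h ∈ F, g⁻¹ * h ∈ K) :
    ∀ g ∈ F, ∀ h ∈ F, ψ g x = ψ h x → g = h := by
  intro g hg k hk hgk
  by_contra hne
  refine h.2 (g⁻¹ * k) (hFF g hg k hk) (fun h1 => hne ?_) ?_
  · exact (inv_mul_eq_one.1 h1)
  · apply (ψ g).injective
    rw [h.1 g (hFK hg) _ (hFF g hg k hk) (by simpa using hFK hk), hgk]
    simp

/-- Decay of the uncovered set. -/
lemma decay (ψ : G → Equiv.Perm V) (F K : Finset G) (hFK : F ⊆ K) (hFn : F.Nonempty)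
    (D D' : Finset V) (hDD : D ⊆ D') (ε β : ℝ) (hε : 0 < ε) (hε2 : ε ≤ 1 / 2)
    (hβ : β ≤ ε ^ 2 / 8)
    (hbad : (badCount ψ K : ℝ) ≤ β * Fintype.card V)
    (hb : ∀ g ∈ F, (bdry ψ D g : ℝ) ≤ β * Fintype.card V)
    (hU : ε * Fintype.card V ≤ Fintype.card V - (#D : ℝ))
    (hx : ∀ x, GoodPt ψ K x → ε / 2 * #F ≤ (#{g ∈ F | ψ g x ∈ D'} : ℝ)) :
    (Fintype.card V : ℝ) - #D' ≤ (1 - ε / 8) * (Fintype.card V - #D) := by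
  set n : ℝ := (Fintype.card V : ℝ) with hn
  have hn0 : 0 ≤ n := by positivity
  have hUc : (#(Dᶜ) : ℝ) = n - #D := by
    rw [card_compl, Nat.cast_sub (card_le_univ D)]
  have hF0 : (0:ℝ) < #F := by exact_mod_cast hFn.card_pos
  -- lower bound
  have hlow : ε / 2 * #F * ((n - #D) - β * n) ≤ ∑ x ∈ Dᶜ, (#{g ∈ F | ψ g x ∈ D'} : ℝ) := by
    have h1 : (n - #D) - β * n ≤ (#{x ∈ Dᶜ | GoodPt ψ K x} : ℝ) := by
      have h2 : #{x ∈ Dᶜ | GoodPt ψ K x} + #{x ∈ Dᶜ | ¬ GoodPt ψ K x} = #(Dᶜ) :=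
        card_filter_add_card_filter_not _
      have h3 : #{x ∈ Dᶜ | ¬ GoodPt ψ K x} ≤ badCount ψ K :=
        card_le_card (filter_subset_filter _ (subset_univ _))
      have h2' : (#{x ∈ Dᶜ | GoodPt ψ K x} : ℝ) + #{x ∈ Dᶜ | ¬ GoodPt ψ K x} = #(Dᶜ) := by
        exact_mod_cast h2
      have h3' : (#{x ∈ Dᶜ | ¬ GoodPt ψ K x} : ℝ) ≤ badCount ψ K := by exact_mod_cast h3
      linarith
    calc ε / 2 * #F * ((n - #D) - β * n) ≤ ε / 2 * #F * #{x ∈ Dᶜ | GoodPt ψ K x} := by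
          gcongr
      _ = ∑ x ∈ {x ∈ Dᶜ | GoodPt ψ K x}, ε / 2 * #F := by
          rw [sum_const, nsmul_eq_mul]; ring
      _ ≤ ∑ x ∈ {x ∈ Dᶜ | GoodPt ψ K x}, (#{g ∈ F | ψ g x ∈ D'} : ℝ) := by
          apply sum_le_sum
          intro x hx'
          exact hx x (mem_filter.1 hx').2
      _ ≤ _ := by
          apply sum_le_sum_of_subset_of_nonneg (filter_subset _ _)
          intros; positivity
  have hup : ∑ x ∈ Dᶜ, (#{g ∈ F | ψ g x ∈ D'} : ℝ) ≤ #F * (β * n + (#D' - #D)) := by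
    have hsw : ∑ x ∈ Dᶜ, (#{g ∈ F | ψ g x ∈ D'} : ℝ) = ∑ g ∈ F, (#{x ∈ Dᶜ | ψ g x ∈ D'} : ℝ) := by
      simp only [card_filter]
      push_cast
      exact sum_comm
    rw [hsw, ← nsmul_eq_mul]
    apply sum_le_card_nsmul
    intro g hg
    have h1 : #{x ∈ Dᶜ | ψ g x ∈ D'} ≤ #{x ∈ Dᶜ | ψ g x ∈ D} + #(D' \ D) := by
      have : {x ∈ Dᶜ | ψ g x ∈ D'} ⊆ {x ∈ Dᶜ | ψ g x ∈ D} ∪ (D' \ D).image (ψ g).symm := by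
        intro x hx
        rw [mem_filter] at hx
        by_cases h : ψ g x ∈ D
        · exact mem_union_left _ (mem_filter.2 ⟨hx.1, h⟩)
        · exact mem_union_right _ (mem_image.2 ⟨ψ g x, mem_sdiff.2 ⟨hx.2, h⟩, by simp⟩)
      exact (card_le_card this).trans ((card_union_le _ _).trans
        (Nat.add_le_add_left card_image_le _))
    have h2 : #{x ∈ Dᶜ | ψ g x ∈ D} = bdry ψ D g := by
      have ha : #{x ∈ D | ψ g x ∈ D} + #{x ∈ Dᶜ | ψ g x ∈ D} = #D := by
        rw [← card_union_of_disjoint (disjoint_filter_filter disjoint_compl_right), ← filter_union,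
          union_compl]
        rw [← card_image_of_injective D (ψ g).symm.injective]
        congr 1
        ext x
        simp [Equiv.symm_apply_eq]
      have hb : #{x ∈ D | ψ g x ∈ D} + #{x ∈ D | ψ g x ∉ D} = #D :=
        card_filter_add_card_filter_not _
      unfold bdry
      omega
    have h3 : (#(D' \ D) : ℝ) = #D' - #D := by
      rw [card_sdiff_of_subset hDD, Nat.cast_sub (card_le_card hDD)]
    have h4 := hb g hg
    have h5 : (#{x ∈ Dᶜ | ψ g x ∈ D'} : ℝ) ≤ #{x ∈ Dᶜ | ψ g x ∈ D} + #(D' \ D) := by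
      exact_mod_cast h1
    rw [h2, h3] at h5
    linarith
  have hfin : ε / 2 * ((n - #D) - β * n) ≤ β * n + (#D' - #D) := by
    have := hlow.trans hup
    by_contra hcon
    push Not at hcon
    nlinarith
  have hβn : β * n ≤ ε / 8 * (n - #D) := by nlinarith
  nlinarith

/-- Maximal packing step. -/
lemma packing (ψ₁ : G → Equiv.Perm V₁) (ψ₂ : G → Equiv.Perm V₂) (S K₀ K F : Finset G)
    (n : ℕ) (hn1 : Fintype.card V₁ = n) (hn2 : Fintype.card V₂ = n) (ε β η : ℝ)
    (hε : 0 < ε) (hε2 : ε ≤ 1 / 2) (hη0 : 0 ≤ η) (hη : η ≤ ε) (hβ : β ≤ ε ^ 2 / 8)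
    (hSK : S ⊆ K₀) (hK : K₀ ⊆ K) (hFK : F ⊆ K) (hFF : ∀ g ∈ F, ∀ h ∈ F, g⁻¹ * h ∈ K)
    (hFn : F.Nonempty)
    (hF : ∀ s ∈ K₀, (#{g ∈ F | s * g ∉ F} : ℝ) ≤ η * #F)
    (hbad1 : (badCount ψ₁ K : ℝ) ≤ β * n) (hbad2 : (badCount ψ₂ K : ℝ) ≤ β * n)
    (D₁ : Finset V₁) (D₂ : Finset V₂) (M : Finset (V₁ × V₂)) (st : St ψ₁ ψ₂ S ε D₁ D₂ M)
    (hb1 : ∀ g ∈ K, (bdry ψ₁ D₁ g : ℝ) ≤ β * n)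
    (hb2 : ∀ g ∈ K, (bdry ψ₂ D₂ g : ℝ) ≤ β * n)
    (hU1 : ε * n ≤ n - (#D₁ : ℝ)) (hU2 : ε * n ≤ n - (#D₂ : ℝ)) :
    ∃ D₁' D₂' M', St ψ₁ ψ₂ S ε D₁' D₂' M' ∧
      (∀ g ∈ K₀, (bdry ψ₁ D₁' g : ℝ) ≤ β * n + 2 * η * n) ∧
      (∀ g ∈ K₀, (bdry ψ₂ D₂' g : ℝ) ≤ β * n + 2 * η * n) ∧
      ((n : ℝ) - #D₁') * (n - #D₂') ≤ (1 - ε / 8) * ((n - #D₁) * (n - #D₂)) := by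
  let X : Set (Finset V₁ × Finset V₂ × Finset (V₁ × V₂)) :=
    {t | St ψ₁ ψ₂ S ε t.1 t.2.1 t.2.2 ∧ D₁ ⊆ t.1 ∧ D₂ ⊆ t.2.1 ∧
      (∀ g ∈ K₀, (bdry ψ₁ t.1 g : ℝ) ≤ β * n + 2 * η * #t.2.2) ∧
      (∀ g ∈ K₀, (bdry ψ₂ t.2.1 g : ℝ) ≤ β * n + 2 * η * #t.2.2)}
  have hXne : X.Nonempty := by
    refine ⟨(D₁, D₂, M), st, Subset.rfl, Subset.rfl, ?_, ?_⟩
    · intro g hg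
      have := hb1 g (hK hg)
      have : 0 ≤ 2 * η * #M := by positivity
      dsimp only; linarith
    · intro g hg
      have := hb2 g (hK hg)
      have : 0 ≤ 2 * η * #M := by positivity
      dsimp only; linarith
  obtain ⟨⟨D₁', D₂', M'⟩, ⟨st', hs1, hs2, hc1, hc2⟩, hmax⟩ :=
    Set.exists_max_image X (fun t => #t.2.2) (Set.toFinite X) hXne
  dsimp only at st' hs1 hs2 hc1 hc2 hmax
  have hF0 : (0:ℝ) < #F := by exact_mod_cast hFn.card_pos
  have hnopair : ∀ x y, GoodPt ψ₁ K x → GoodPt ψ₂ K y →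
      ε * #F < (#{g ∈ F | ψ₁ g x ∈ D₁' ∨ ψ₂ g y ∈ D₂'} : ℝ) := by
    intro x y hx hy
    by_contra hcon
    push Not at hcon
    have m1 : ∀ s ∈ K₀, ∀ g ∈ F, s * g ∈ F → ψ₁ s (ψ₁ g x) = ψ₁ (s * g) x :=
      fun s hs g hg hsg => hx.1 s (hK hs) g (hFK hg) (hFK hsg)
    have m2 : ∀ s ∈ K₀, ∀ g ∈ F, s * g ∈ F → ψ₂ s (ψ₂ g y) = ψ₂ (s * g) y :=
      fun s hs g hg hsg => hy.1 s (hK hs) g (hFK hg) (hFK hsg)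
    obtain ⟨M'', hM'', st''⟩ := st'.ext hε hε2 F x y
      (fun s hs => (hF s (hSK hs)).trans (by gcongr))
      (fun s hs => m1 s (hSK hs)) (fun s hs => m2 s (hSK hs))
      (hx.inj hFK hFF) (hy.inj hFK hFF) hcon
    have hmem : (D₁' ∪ F.image (fun g => ψ₁ g x), D₂' ∪ F.image (fun g => ψ₂ g y), M'') ∈ X := by
      refine ⟨st'', hs1.trans subset_union_left, hs2.trans subset_union_left, ?_, ?_⟩
      · intro g hg
        have h1 : (bdry ψ₁ (D₁' ∪ F.image (fun g => ψ₁ g x)) g : ℝ) ≤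
            bdry ψ₁ D₁' g + #{h ∈ F | g * h ∉ F} := by
          exact_mod_cast bdry_ext ψ₁ D₁' F g x (m1 g hg)
        have h2 := hF g hg
        have h3 := hc1 g hg
        dsimp only
        have h4 : η * #F ≤ 2 * η * (#M'' - #M') := by nlinarith
        linarith
      · intro g hg
        have h1 : (bdry ψ₂ (D₂' ∪ F.image (fun g => ψ₂ g y)) g : ℝ) ≤
            bdry ψ₂ D₂' g + #{h ∈ F | g * h ∉ F} := by
          exact_mod_cast bdry_ext ψ₂ D₂' F g y (m2 g hg)
        have h2 := hF g hg
        have h3 := hc2 g hg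
        dsimp only
        have h4 : η * #F ≤ 2 * η * (#M'' - #M') := by nlinarith
        linarith
    have h5 : (#M'' : ℝ) ≤ #M' := by exact_mod_cast hmax _ hmem
    nlinarith
  have hMn : (#M' : ℝ) ≤ n := by
    have : #M' ≤ Fintype.card V₁ := by
      rw [← card_image_of_injOn (s := M') (f := Prod.fst)
        (fun p hp q hq h => st'.inj1 p hp q hq h)]
      exact card_le_univ _
    rw [hn1] at this
    exact_mod_cast this
  have hle : 2 * η * #M' ≤ 2 * η * n := by gcongr
  refine ⟨D₁', D₂', M', st', fun g hg => (hc1 g hg).trans (by linarith),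
    fun g hg => (hc2 g hg).trans (by linarith), ?_⟩
  have hd1 : (#D₁ : ℝ) ≤ #D₁' := by exact_mod_cast card_le_card hs1
  have hd2 : (#D₂ : ℝ) ≤ #D₂' := by exact_mod_cast card_le_card hs2
  have hd1' : (#D₁' : ℝ) ≤ n := by rw [← hn1]; exact_mod_cast card_le_univ _
  have hd2' : (#D₂' : ℝ) ≤ n := by rw [← hn2]; exact_mod_cast card_le_univ _
  by_cases hcase : ∀ x, GoodPt ψ₁ K x → ε / 2 * #F ≤ (#{g ∈ F | ψ₁ g x ∈ D₁'} : ℝ)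
  · have := decay ψ₁ F K hFK hFn D₁ D₁' hs1 ε β hε hε2 hβ (by rwa [hn1])
      (fun g hg => by rw [hn1]; exact hb1 g (hFK hg)) (by rwa [hn1]) hcase
    rw [hn1] at this
    calc ((n : ℝ) - #D₁') * (n - #D₂') ≤ ((1 - ε / 8) * (n - #D₁)) * (n - #D₂) := by
          apply mul_le_mul this (by linarith) (by linarith)
          exact mul_nonneg (by linarith) (by linarith)
      _ = _ := by ring
  · push Not at hcase
    obtain ⟨x, hx, hxc⟩ := hcase
    have := decay ψ₂ F K hFK hFn D₂ D₂' hs2 ε β hε hε2 hβ (by rwa [hn2])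
      (fun g hg => by rw [hn2]; exact hb2 g (hFK hg)) (by rwa [hn2]) (by
        intro y hy
        have h1 := hnopair x y hx hy
        have h2 : (#{g ∈ F | ψ₁ g x ∈ D₁' ∨ ψ₂ g y ∈ D₂'} : ℝ) ≤
            #{g ∈ F | ψ₁ g x ∈ D₁'} + #{g ∈ F | ψ₂ g y ∈ D₂'} := by
          rw [filter_or]
          exact_mod_cast card_union_le _ _
        linarith)
    rw [hn2] at this
    calc ((n : ℝ) - #D₁') * (n - #D₂') ≤ (n - #D₁) * ((1 - ε / 8) * (n - #D₂)) := by
          apply mul_le_mul (by linarith) this (by linarith) (by linarith)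
      _ = _ := by ring

lemma folner_finset (hG : FolnerAmenable G) (K : Finset G) (η : ℝ) (hη : 0 < η) :
    ∃ F : Finset G, F.Nonempty ∧ ∀ s ∈ K, (#{g ∈ F | s * g ∉ F} : ℝ) ≤ η * #F := by
  obtain ⟨Φ, hfin, hne, hΦ⟩ := hG K K.finite_toSet η hη
  refine ⟨hfin.toFinset, by simpa using hne, fun s hs => ?_⟩
  have h1 := hΦ s (by exact_mod_cast hs)
  rw [Set.ncard_eq_toFinset_card Φ hfin] at h1
  refine le_trans ?_ h1.le
  rw [← card_image_of_injective _ (mul_right_injective s), ← Set.ncard_coe_finset]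
  rw [Nat.cast_le]
  apply Set.ncard_le_ncard
  · intro v hv
    simp only [coe_image, coe_filter, Set.mem_image, Set.mem_setOf_eq, Set.Finite.mem_toFinset] at hv
    obtain ⟨g, ⟨hg, hsg⟩, rfl⟩ := hv
    exact Or.inl ⟨⟨g, hg, rfl⟩, hsg⟩
  · exact (hfin.image _).symmDiff hfin

/-- `m` packing stages. -/
lemma stages (hG : FolnerAmenable G) (S : Finset G) (ε : ℝ) (hε : 0 < ε) (hε2 : ε ≤ 1 / 2)
    (m : ℕ) : ∃ (K : Finset G) (β : ℝ), S ⊆ K ∧ 0 < β ∧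
      ∀ (V₁ V₂ : Type) [Fintype V₁] [Fintype V₂] (n : ℕ)
        (_ : Fintype.card V₁ = n) (_ : Fintype.card V₂ = n)
        (ψ₁ : G → Equiv.Perm V₁) (ψ₂ : G → Equiv.Perm V₂),
        (badCount ψ₁ K : ℝ) ≤ β * n → (badCount ψ₂ K : ℝ) ≤ β * n →
        ∀ D₁ D₂ M, St ψ₁ ψ₂ S ε D₁ D₂ M →
          (∀ g ∈ K, (bdry ψ₁ D₁ g : ℝ) ≤ β * n) → (∀ g ∈ K, (bdry ψ₂ D₂ g : ℝ) ≤ β * n) →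
          ∃ D₁' D₂' M', St ψ₁ ψ₂ S ε D₁' D₂' M' ∧
            ((n - #D₁' : ℝ) < ε * n ∨ (n - #D₂' : ℝ) < ε * n ∨
              ((n : ℝ) - #D₁') * (n - #D₂') ≤ (1 - ε / 8) ^ m * ((n - #D₁) * (n - #D₂))) := by
  induction m with
  | zero =>
    refine ⟨S, 1, Subset.rfl, one_pos, ?_⟩
    intro V₁ V₂ _ _ n hn1 hn2 ψ₁ ψ₂ _ _ D₁ D₂ M st _ _
    exact ⟨D₁, D₂, M, st, Or.inr (Or.inr (by simp))⟩
  | succ m ih =>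
    obtain ⟨K₀, β₀, hSK, hβ₀, ih⟩ := ih
    set η := min ε (β₀ / 4) with hη
    have hη0 : 0 < η := by positivity
    obtain ⟨F, hFn, hF⟩ := folner_finset hG K₀ η hη0
    set K := K₀ ∪ (F ∪ (F ×ˢ F).image (fun p => p.1⁻¹ * p.2)) with hKdef
    have hK : K₀ ⊆ K := subset_union_left
    have hFK : F ⊆ K := subset_union_left.trans subset_union_right
    have hFF : ∀ g ∈ F, ∀ h ∈ F, g⁻¹ * h ∈ K := by
      intro g hg h hh
      apply mem_union_right
      apply mem_union_right
      exact mem_image.2 ⟨(g, h), mem_product.2 ⟨hg, hh⟩, rfl⟩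
    refine ⟨K, min (β₀ / 2) (ε ^ 2 / 8), hSK.trans hK, by positivity, ?_⟩
    set β := min (β₀ / 2) (ε ^ 2 / 8) with hβ
    intro V₁ V₂ _ _ n hn1 hn2 ψ₁ ψ₂ hbad1 hbad2 D₁ D₂ M st hb1 hb2
    by_cases hU1 : (n - #D₁ : ℝ) < ε * n
    · exact ⟨D₁, D₂, M, st, Or.inl hU1⟩
    by_cases hU2 : (n - #D₂ : ℝ) < ε * n
    · exact ⟨D₁, D₂, M, st, Or.inr (Or.inl hU2)⟩
    push Not at hU1 hU2
    obtain ⟨D₁', D₂', M', st', hb1', hb2', hdec⟩ := packing ψ₁ ψ₂ S K₀ K F n hn1 hn2 ε β η hε hε2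
      hη0.le (min_le_left _ _) (min_le_right _ _) hSK hK hFK hFF hFn hF hbad1 hbad2 D₁ D₂ M st
      hb1 hb2 hU1 hU2
    have hn0 : (0:ℝ) ≤ n := by positivity
    have hββ : β * n + 2 * η * n ≤ β₀ * n := by
      have h1 : β ≤ β₀ / 2 := min_le_left _ _
      have h2 : η ≤ β₀ / 4 := min_le_right _ _
      nlinarith
    have hmono : ∀ (V : Type) [Fintype V] (ψ : G → Equiv.Perm V),
        badCount ψ K₀ ≤ badCount ψ K := by
      intro V _ ψ
      apply card_le_card
      intro x hx
      simp only [mem_filter, mem_univ, true_and] at hx ⊢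
      intro hg
      exact hx ⟨fun g hg' h hh hgh => hg.1 g (hK hg') h (hK hh) (hK hgh),
        fun g hg' => hg.2 g (hK hg')⟩
    have hβle : β * n ≤ β₀ * n := by
      have : 0 ≤ 2 * η * n := by positivity
      linarith
    obtain ⟨D₁'', D₂'', M'', st'', h⟩ := ih V₁ V₂ n hn1 hn2 ψ₁ ψ₂
      ((Nat.cast_le.2 (hmono V₁ ψ₁)).trans (hbad1.trans hβle))
      ((Nat.cast_le.2 (hmono V₂ ψ₂)).trans (hbad2.trans hβle)) D₁' D₂' M' st'
      (fun g hg => (hb1' g hg).trans hββ) (fun g hg => (hb2' g hg).trans hββ)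
    refine ⟨D₁'', D₂'', M'', st'', h.imp_right (Or.imp_right fun h => h.trans ?_)⟩
    rw [pow_succ, mul_assoc]
    apply mul_le_mul_of_nonneg_left hdec
    apply pow_nonneg
    linarith

/-- Uniqueness of sofic approximations of amenable groups, up to almost conjugacy. -/
lemma uniqueness (hG : FolnerAmenable G) (S : Finset G) (ε : ℝ) (hε : 0 < ε) :
    ∃ (K : Finset G) (β : ℝ), S ⊆ K ∧ 0 < β ∧
      ∀ (V₁ V₂ : Type) [Fintype V₁] [Fintype V₂] (n : ℕ) (_ : 0 < n)
        (_ : Fintype.card V₁ = n) (_ : Fintype.card V₂ = n)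
        (ψ₁ : G → Equiv.Perm V₁) (ψ₂ : G → Equiv.Perm V₂),
        (badCount ψ₁ K : ℝ) ≤ β * n → (badCount ψ₂ K : ℝ) ≤ β * n →
        ∃ τ : V₁ ≃ V₂, ∀ s ∈ S, (#{v | τ (ψ₁ s v) ≠ ψ₂ s (τ v)} : ℝ) ≤ ε * n := by
  set ε' := min (1 / 2) (ε / 6) with hε'
  have hε'0 : 0 < ε' := by positivity
  have hε'2 : ε' ≤ 1 / 2 := min_le_left _ _
  have hε'6 : ε' ≤ ε / 6 := min_le_right _ _
  obtain ⟨m, hm⟩ := exists_pow_lt_of_lt_one (show 0 < ε' ^ 2 by positivity)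
    (show 1 - ε' / 8 < 1 by linarith)
  obtain ⟨K, β, hSK, hβ, h⟩ := stages hG S ε' hε'0 hε'2 m
  refine ⟨K, β, hSK, hβ, ?_⟩
  intro V₁ V₂ _ _ n hn hn1 hn2 ψ₁ ψ₂ hbad1 hbad2
  have hnr : (0:ℝ) < n := by exact_mod_cast hn
  obtain ⟨D₁, D₂, M, st, hD⟩ := h V₁ V₂ n hn1 hn2 ψ₁ ψ₂ hbad1 hbad2 ∅ ∅ ∅
    ⟨by simp, by simp, by simp, by simp, by simp, by simp, by simp⟩
    (fun g _ => by simp [bdry]; positivity) (fun g _ => by simp [bdry]; positivity)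
  have hMbig : (1 - 2 * ε') * n ≤ #M := by
    have key : ∀ d : ℝ, (1 - ε') * d ≤ #M → n - d < ε' * n → (1 - 2 * ε') * n ≤ #M := by
      intro d h1 h2
      nlinarith
    rcases hD with hD | hD | hD
    · exact key _ st.big1 hD
    · exact key _ st.big2 hD
    · by_cases h1 : (n - #D₁ : ℝ) < ε' * n
      · exact key _ st.big1 h1
      by_cases h2 : (n - #D₂ : ℝ) < ε' * n
      · exact key _ st.big2 h2
      push Not at h1 h2
      exfalso
      have h3 : (ε' * n) * (ε' * n) ≤ ((n : ℝ) - #D₁) * (n - #D₂) :=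
        mul_le_mul h1 h2 (by positivity) (le_trans (by positivity) h1)
      simp only [card_empty, Nat.cast_zero, sub_zero] at hD
      have h4 : (1 - ε' / 8) ^ m * (n * n : ℝ) < ε' ^ 2 * (n * n) := by gcongr
      nlinarith
  -- extend the matching to a bijection
  obtain ⟨f, hf⟩ : ∃ f : V₁ → V₂, ∀ p ∈ M, f p.1 = p.2 := by
    have : Nonempty V₂ := Fintype.card_pos_iff.1 (by omega)
    refine ⟨fun v => if h : ∃ w, (v, w) ∈ M then h.choose else Classical.arbitrary V₂, ?_⟩
    rintro ⟨v, w⟩ hp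
    have hex : ∃ w, (v, w) ∈ M := ⟨w, hp⟩
    simp only [hex, dif_pos]
    have := st.inj1 _ hex.choose_spec _ hp rfl
    exact (Prod.ext_iff.1 this).2
  obtain ⟨g, hg⟩ := Finset.exists_equiv_extend_of_card_eq (α := V₁) (t := (univ : Finset V₂))
    (by rw [card_univ, hn1, hn2]) (s := M.image Prod.fst) (f := f) (subset_univ _) (by
      intro a ha b hb hab
      simp only [coe_image, Set.mem_image, mem_coe] at ha hb
      obtain ⟨p, hp, rfl⟩ := ha
      obtain ⟨q, hq, rfl⟩ := hb
      rw [hf p hp, hf q hq] at hab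
      rw [st.inj2 p hp q hq hab])
  let τ : V₁ ≃ V₂ := g.trans (Equiv.subtypeUnivEquiv (fun x => mem_univ x))
  have hτ : ∀ p ∈ M, τ p.1 = p.2 := by
    intro p hp
    rw [← hf p hp, ← hg p.1 (mem_image_of_mem _ hp)]
    rfl
  refine ⟨τ, fun s hs => ?_⟩
  have hsub : ({v | τ (ψ₁ s v) ≠ ψ₂ s (τ v)} : Finset V₁) ⊆ (M.image Prod.fst)ᶜ ∪
      ({p ∈ M | (ψ₁ s p.1, ψ₂ s p.2) ∉ M}).image Prod.fst := by
    intro v hv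
    simp only [mem_filter, mem_univ, true_and] at hv
    by_cases hvM : v ∈ M.image Prod.fst
    · obtain ⟨p, hp, rfl⟩ := mem_image.1 hvM
      apply mem_union_right
      refine mem_image_of_mem _ (mem_filter.2 ⟨hp, fun hmem => hv ?_⟩)
      rw [hτ p hp]
      exact hτ _ hmem
    · exact mem_union_left _ (mem_compl.2 hvM)
  have hcM : #(M.image Prod.fst) = #M :=
    card_image_of_injOn (fun p hp q hq h => st.inj1 p hp q hq h)
  have h1 := (card_le_card hsub).trans ((card_union_le _ _).trans
        (Nat.add_le_add_left card_image_le _))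
  have hcn : #M ≤ n := by rw [← hcM, ← hn1]; exact card_le_univ _
  rw [card_compl, hcM, hn1] at h1
  have h2 : (#{v | τ (ψ₁ s v) ≠ ψ₂ s (τ v)} : ℝ) ≤
      (n - #M) + #{p ∈ M | (ψ₁ s p.1, ψ₂ s p.2) ∉ M} := by
    rw [← Nat.cast_sub hcn]
    exact_mod_cast h1
  have h3 := st.qual s hs
  have h4 : (#M : ℝ) ≤ n := by exact_mod_cast hcn
  nlinarith

lemma permDist_mul_card {n : ℕ} (hn : 0 < n) (ρ σ : Equiv.Perm (Fin n)) :
    permDist ρ σ * n = (#{i | ρ i ≠ σ i} : ℝ) := by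
  unfold permDist
  have : (n : ℝ) ≠ 0 := by positivity
  rw [div_mul_cancel₀ _ this]

lemma badCount_of_isApprox {n : ℕ} (hn : 0 < n) (K : Finset G) (δ : ℝ) (hδ : 0 < δ)
    (ψ : G → Equiv.Perm (Fin n)) (h : IsApprox (K : Set G) δ ψ) :
    (badCount ψ K : ℝ) ≤ ((#K : ℝ) * #K + #K) * δ * n := by
  have hnr : (0:ℝ) < n := by exact_mod_cast hn
  have hsub : ({x | ¬ GoodPt ψ K x} : Finset (Fin n)) ⊆
      ({p ∈ K ×ˢ K | p.1 * p.2 ∈ K}).biUnion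
        (fun p => ({x | (ψ p.1 * ψ p.2) x ≠ ψ (p.1 * p.2) x} : Finset (Fin n))) ∪
      ({g ∈ K | g ≠ 1}).biUnion (fun g => ({x | ψ g x = x} : Finset (Fin n))) := by
    intro x hx
    simp only [mem_filter, mem_univ, true_and, GoodPt, not_and_or] at hx
    rw [mem_union]
    rcases hx with hx | hx
    · push Not at hx
      obtain ⟨g, hg, k, hk, hgk, hx⟩ := hx
      left
      rw [mem_biUnion]
      exact ⟨(g, k), by simp [hg, hk, hgk], mem_filter.2 ⟨mem_univ _, hx⟩⟩
    · push Not at hx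
      obtain ⟨g, hg, hg1, hx⟩ := hx
      right
      rw [mem_biUnion]
      exact ⟨g, by simp [hg, hg1], mem_filter.2 ⟨mem_univ _, hx⟩⟩
  have h1 : (badCount ψ K : ℝ) ≤
      ∑ p ∈ {p ∈ K ×ˢ K | p.1 * p.2 ∈ K}, (#{x | (ψ p.1 * ψ p.2) x ≠ ψ (p.1 * p.2) x} : ℝ) +
      ∑ g ∈ {g ∈ K | g ≠ 1}, (#{x | ψ g x = x} : ℝ) := by
    exact_mod_cast (card_le_card hsub).trans ((card_union_le _ _).trans
      (Nat.add_le_add card_biUnion_le card_biUnion_le))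
  have h2 : ∑ p ∈ {p ∈ K ×ˢ K | p.1 * p.2 ∈ K},
      (#{x | (ψ p.1 * ψ p.2) x ≠ ψ (p.1 * p.2) x} : ℝ) ≤ (#K : ℝ) * #K * (δ * n) := by
    calc _ ≤ ∑ p ∈ {p ∈ K ×ˢ K | p.1 * p.2 ∈ K}, δ * n := by
          apply sum_le_sum
          intro p hp
          simp only [mem_filter, mem_product] at hp
          rw [← permDist_mul_card hn]
          have := h.1 p.1 hp.1.1 p.2 hp.1.2 hp.2
          gcongr
      _ = (#{p ∈ K ×ˢ K | p.1 * p.2 ∈ K} : ℝ) * (δ * n) := by rw [sum_const, nsmul_eq_mul]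
      _ ≤ _ := by
          gcongr
          exact_mod_cast (card_filter_le _ _).trans (card_product _ _).le
  have h3 : ∑ g ∈ {g ∈ K | g ≠ 1}, (#{x | ψ g x = x} : ℝ) ≤ (#K : ℝ) * (δ * n) := by
    calc _ ≤ ∑ g ∈ {g ∈ K | g ≠ 1}, δ * n := by
          apply sum_le_sum
          intro g hg
          simp only [mem_filter] at hg
          have h4 := h.2 g hg.1 hg.2
          have h5 : permDist (ψ g) 1 * n = (#{x | ψ g x ≠ x} : ℝ) :=
            permDist_mul_card hn (ψ g) 1
          have h6 : (#{x | ψ g x = x} : ℝ) + #{x | ψ g x ≠ x} = n := by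
            have := card_filter_add_card_filter_not (s := (univ : Finset (Fin n)))
              (fun x => ψ g x = x)
            rw [card_univ, Fintype.card_fin] at this
            exact_mod_cast this
          rw [← h5] at h6
          nlinarith
      _ = (#{g ∈ K | g ≠ 1} : ℝ) * (δ * n) := by rw [sum_const, nsmul_eq_mul]
      _ ≤ _ := by
          gcongr
          exact filter_subset _ _
  linarith

/-- `q` copies of a permutation together with `r` fixed points. -/
def copies (q r : ℕ) {n : ℕ} (ρ : Equiv.Perm (Fin n)) : Equiv.Perm ((Fin q × Fin n) ⊕ Fin r) :=
  Equiv.sumCongr (Equiv.prodCongr (Equiv.refl _) ρ) (Equiv.refl _)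

lemma copies_inl (q r : ℕ) {n : ℕ} (ρ : Equiv.Perm (Fin n)) (i : Fin q) (x : Fin n) :
    copies q r ρ (Sum.inl (i, x)) = Sum.inl (i, ρ x) := rfl

lemma copies_inr (q r : ℕ) {n : ℕ} (ρ : Equiv.Perm (Fin n)) (x : Fin r) :
    copies q r ρ (Sum.inr x) = Sum.inr x := rfl

lemma copies_one (q r : ℕ) {n : ℕ} : copies q r (1 : Equiv.Perm (Fin n)) = 1 := by
  ext x
  rcases x with ⟨i, x⟩ | x <;> rfl

lemma copies_pow (q r : ℕ) {n : ℕ} (ρ : Equiv.Perm (Fin n)) (k : ℕ) :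
    copies q r ρ ^ k = copies q r (ρ ^ k) := by
  induction k with
  | zero => simp [copies_one]
  | succ k ih =>
    rw [pow_succ, pow_succ, ih]
    ext x
    rcases x with ⟨i, x⟩ | x <;> rfl

lemma badCount_copies (q r : ℕ) {n : ℕ} (ψ : G → Equiv.Perm (Fin n)) (K : Finset G) :
    badCount (fun g => copies q r (ψ g)) K ≤ q * badCount ψ K + r := by
  unfold badCount
  have hsub : ({x | ¬ GoodPt (fun g => copies q r (ψ g)) K x} : Finset ((Fin q × Fin n) ⊕ Fin r)) ⊆
      ((univ : Finset (Fin q)) ×ˢ ({x | ¬ GoodPt ψ K x} : Finset (Fin n))).image Sum.inl ∪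
      (univ : Finset (Fin r)).image Sum.inr := by
    intro x hx
    simp only [mem_filter, mem_univ, true_and] at hx
    rcases x with ⟨i, x⟩ | x
    · apply mem_union_left
      refine mem_image_of_mem _ (mem_product.2 ⟨mem_univ _, ?_⟩)
      simp only [mem_filter, mem_univ, true_and]
      intro hg
      apply hx
      refine ⟨fun g hg' h hh hgh => ?_, fun g hg' hg1 => ?_⟩
      · simp only [copies_inl]
        rw [hg.1 g hg' h hh hgh]
      · simp only [copies_inl]
        intro heq
        apply hg.2 g hg' hg1
        simpa using heq
    · exact mem_union_right _ (mem_image_of_mem _ (mem_univ _))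
  refine (card_le_card hsub).trans ((card_union_le _ _).trans
    (Nat.add_le_add (card_image_le.trans ?_) (card_image_le.trans ?_)))
  · rw [card_product]; simp
  · simp

lemma count_copies (q r : ℕ) {n : ℕ} (ρ σ f : Equiv.Perm (Fin n)) :
    #{v | copies q r ρ (copies q r f v) ≠ copies q r f (copies q r σ v)} ≤
      q * #{x | (ρ * f) x ≠ (f * σ) x} := by
  have hsub : ({v | copies q r ρ (copies q r f v) ≠ copies q r f (copies q r σ v)} :
      Finset ((Fin q × Fin n) ⊕ Fin r)) ⊆
      ((univ : Finset (Fin q)) ×ˢ ({x | (ρ * f) x ≠ (f * σ) x} : Finset (Fin n))).image Sum.inl := by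
    intro x hx
    simp only [mem_filter, mem_univ, true_and] at hx
    rcases x with ⟨i, x⟩ | x
    · refine mem_image_of_mem _ (mem_product.2 ⟨mem_univ _, ?_⟩)
      simp only [mem_filter, mem_univ, true_and]
      intro hg
      apply hx
      simp only [copies_inl]
      simp only [Equiv.Perm.mul_apply] at hg
      rw [hg]
    · exact absurd rfl hx
  refine (card_le_card hsub).trans (card_image_le.trans ?_)
  rw [card_product]; simp

lemma conj_count {n : ℕ} (τ : V ≃ Fin n) (f ρ σ : Equiv.Perm V) (ρ' σ' : Equiv.Perm (Fin n)) :
    #{i | (ρ' * τ.permCongr f) i ≠ (τ.permCongr f * σ') i} ≤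
      #{v | τ (ρ v) ≠ ρ' (τ v)} + (#{v | ρ (f v) ≠ f (σ v)} + #{v | τ (σ v) ≠ σ' (τ v)}) := by
  have hsub : ({i | (ρ' * τ.permCongr f) i ≠ (τ.permCongr f * σ') i} : Finset (Fin n)) ⊆
      ({v | τ (ρ v) ≠ ρ' (τ v)} : Finset V).image (fun v => τ (f.symm v)) ∪
      (({v | ρ (f v) ≠ f (σ v)} : Finset V).image τ ∪
       ({v | τ (σ v) ≠ σ' (τ v)} : Finset V).image τ) := by
    intro i hi
    obtain ⟨u, rfl⟩ := τ.surjective i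
    simp only [mem_filter, mem_univ, true_and] at hi
    simp only [Equiv.Perm.mul_apply, Equiv.permCongr_apply, Equiv.symm_apply_apply] at hi
    by_contra hcon
    simp only [mem_union, mem_image, mem_filter, mem_univ, true_and, not_or, not_exists, not_and]
      at hcon
    obtain ⟨h1, h2, h3⟩ := hcon
    have e1 : τ (ρ (f u)) = ρ' (τ (f u)) := by
      by_contra h; exact h1 _ h (by simp)
    have e2 : ρ (f u) = f (σ u) := by
      by_contra h; exact h2 _ h rfl
    have e3 : τ (σ u) = σ' (τ u) := by
      by_contra h; exact h3 _ h rfl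
    apply hi
    rw [← e1, e2, ← e3]
    simp
  exact (card_le_card hsub).trans ((card_union_le _ _).trans
    (Nat.add_le_add card_image_le ((card_union_le _ _).trans
      (Nat.add_le_add card_image_le card_image_le))))

end Helpers

/-- **Theorem.** Let `G` be amenable and `φ : B → A` an isomorphism of subgroups. If some
sofic approximations of `G` admit permutations of order dividing `k` almost conjugating `B`
to `A`, then all sofic approximations of `G` into sufficiently large symmetric groups do. -/
theorem almost_conjugating_of_amenable {G : Type*} [Group G]
    (hG : FolnerAmenable G) (A B : Subgroup G) (φ : B ≃* A) (k : ℕ) (hk : 1 ≤ k)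
    (h2 : ∀ S : Set G, S.Finite → ∀ δ ε : ℝ, 0 < δ → 0 < ε →
      ∃ (n : ℕ) (ψ : G → Equiv.Perm (Fin n)) (f : Equiv.Perm (Fin n)),
        IsApprox S δ ψ ∧ f ^ k = 1 ∧
        ∀ b : B, (b : G) ∈ S → (φ b : G) ∈ S →
          permDist (ψ (b : G) * f) (f * ψ ((φ b : G))) < ε) :
    ∀ S : Set G, S.Finite → ∀ ε : ℝ, 0 < ε →
      ∃ S' : Set G, S'.Finite ∧ S ⊆ S' ∧ ∃ δ : ℝ, 0 < δ ∧ ∃ N : ℕ,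
        ∀ n : ℕ, n > N → ∀ ψ : G → Equiv.Perm (Fin n), IsApprox S' δ ψ →
          ∃ f : Equiv.Perm (Fin n), f ^ k = 1 ∧
            ∀ b : B, (b : G) ∈ S → (φ b : G) ∈ S →
              permDist (ψ (b : G) * f) (f * ψ ((φ b : G))) < ε := by
  classical
  intro S hS ε hε
  rcases subsingleton_or_nontrivial G with hsub | hnt
  · refine ⟨S, hS, subset_rfl, 1, one_pos, 0, fun n _ ψ _ => ⟨1, one_pow k, fun b _ _ => ?_⟩⟩
    have : (φ b : G) = (b : G) := Subsingleton.elim _ _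
    rw [this, mul_one, one_mul]
    simpa [permDist] using hε
  obtain ⟨g₀, hg₀⟩ := exists_ne (1 : G)
  obtain ⟨K, β, hSK, hβ, huniq⟩ := uniqueness hG hS.toFinset (ε / 4) (by positivity)
  set c : ℝ := (K.card : ℝ) * K.card + K.card with hc
  have hc0 : 0 ≤ c := by positivity
  set δ : ℝ := min 1 (β / 2 / (c + 1)) with hδ
  have hδ0 : 0 < δ := by positivity
  have hcδ : c * δ ≤ β / 2 := by
    have h1 : δ ≤ β / 2 / (c + 1) := min_le_right _ _
    rw [le_div_iff₀ (by positivity)] at h1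
    nlinarith
  obtain ⟨n₀, ψ₀, f₀, happ, hf₀, hconj⟩ := h2 ((K : Set G) ∪ {g₀})
    (K.finite_toSet.union (Set.finite_singleton g₀)) δ (ε / 4) hδ0 (by positivity)
  have hn₀ : 0 < n₀ := by
    rcases Nat.eq_zero_or_pos n₀ with h | h
    · subst h
      have h1 := happ.2 g₀ (Or.inr rfl) hg₀
      have h3 : δ ≤ 1 := min_le_left _ _
      simp [permDist] at h1
      linarith
    · exact h
  have happK : IsApprox (K : Set G) δ ψ₀ :=
    ⟨fun g hg h hh hgh => happ.1 g (Or.inl hg) h (Or.inl hh) (Or.inl hgh),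
      fun g hg => happ.2 g (Or.inl hg)⟩
  obtain ⟨N, hN⟩ := exists_nat_gt ((n₀ : ℝ) / (β / 2))
  refine ⟨K, K.finite_toSet, fun s hs => hSK (by simpa using hs), δ, hδ0, N, ?_⟩
  intro n hn ψ hψ
  have hn0 : 0 < n := by omega
  have hnr : (0:ℝ) < n := by exact_mod_cast hn0
  have hnN : (n₀ : ℝ) ≤ β / 2 * n := by
    rw [div_lt_iff₀ (by positivity)] at hN
    have : (N : ℝ) ≤ n := by exact_mod_cast hn.le
    nlinarith
  set q := n / n₀ with hq
  set r := n % n₀ with hr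
  have hqr : q * n₀ + r = n := by rw [mul_comm]; exact Nat.div_add_mod n n₀
  have hr' : r < n₀ := Nat.mod_lt _ hn₀
  have hqn : (q : ℝ) * n₀ ≤ n := by
    have : q * n₀ ≤ n := by omega
    exact_mod_cast this
  have hb0 := badCount_of_isApprox hn₀ K δ hδ0 ψ₀ happK
  have hb := badCount_of_isApprox hn0 K δ hδ0 ψ hψ
  have hbc : (badCount (fun g => copies q r (ψ₀ g)) K : ℝ) ≤ β * n := by
    have h1 : (badCount (fun g => copies q r (ψ₀ g)) K : ℝ) ≤ q * badCount ψ₀ K + r := by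
      exact_mod_cast badCount_copies q r ψ₀ K
    have h3 : (r : ℝ) ≤ n₀ := by exact_mod_cast hr'.le
    have h4 : (q : ℝ) * badCount ψ₀ K ≤ q * (β / 2 * n₀) := by
      apply mul_le_mul_of_nonneg_left _ (by positivity)
      refine hb0.trans ?_
      exact mul_le_mul_of_nonneg_right hcδ (by positivity)
    nlinarith
  have hbψ : (badCount ψ K : ℝ) ≤ β * n := by
    refine hb.trans ?_
    exact mul_le_mul_of_nonneg_right (by linarith) (by positivity)
  obtain ⟨τ, hτ⟩ := huniq ((Fin q × Fin n₀) ⊕ Fin r) (Fin n) n hn0 (by simp [hqr]) (by simp)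
    (fun g => copies q r (ψ₀ g)) ψ hbc hbψ
  refine ⟨τ.permCongr (copies q r f₀), ?_, ?_⟩
  · have h1 : ∀ j : ℕ, τ.permCongr (copies q r f₀) ^ j = τ.permCongr (copies q r f₀ ^ j) := by
      intro j
      exact (map_pow τ.permCongrHom (copies q r f₀) j).symm
    rw [h1, copies_pow, hf₀, copies_one]
    ext x
    simp
  · intro b hb1 hb2
    have h1 := hτ b (by simpa using hb1)
    have h3 := hτ (φ b) (by simpa using hb2)
    have h4 := hconj b (Or.inl (hSK (by simpa using hb1))) (Or.inl (hSK (by simpa using hb2)))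
    have h5 := conj_count τ (copies q r f₀) (copies q r (ψ₀ b)) (copies q r (ψ₀ (φ b)))
      (ψ b) (ψ (φ b))
    have h6 := count_copies q r (ψ₀ b) (ψ₀ (φ b)) f₀
    have h7 := permDist_mul_card hn₀ (ψ₀ (b : G) * f₀) (f₀ * ψ₀ (φ b : G))
    have h8 := permDist_mul_card hn0 (ψ (b : G) * τ.permCongr (copies q r f₀))
      (τ.permCongr (copies q r f₀) * ψ (φ b : G))
    have h5' := (Nat.cast_le (α := ℝ)).2 h5
    have h6' := (Nat.cast_le (α := ℝ)).2 h6
    simp only [Nat.cast_add, Nat.cast_mul] at h5' h6'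
    rw [← h8] at h5'
    rw [← h7] at h6'
    have h9 : (q : ℝ) * (permDist (ψ₀ (b : G) * f₀) (f₀ * ψ₀ (φ b : G)) * n₀) ≤ ε / 4 * n := by
      calc _ = permDist (ψ₀ (b : G) * f₀) (f₀ * ψ₀ (φ b : G)) * (q * n₀) := by ring
        _ ≤ ε / 4 * (q * n₀) := by gcongr
        _ ≤ _ := by gcongr
    by_contra hcon
    push Not at hcon
    have h10 := mul_le_mul_of_nonneg_right hcon hnr.le
    have h11 : 0 < ε * n := by positivity
    have h12 := h5'.trans (add_le_add (b := ε / 4 * n) (by refine le_trans (le_of_eq ?_) h1; congr!)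
      (add_le_add (a := _) (b := ε / 4 * n) (d := ε / 4 * n)
        (by refine le_trans ?_ (h6'.trans h9); apply le_of_eq; congr!) (by refine le_trans (le_of_eq ?_) h3; congr!)))
    linarith
end

section
/- Let G be a group, let A, B ≤ G be subgroups with A ∩ B = {1}, let φ: B → A be a group isomorphism, and let k ≥ 4 be an integer. Then the natural map ι: G → Hig_k(G,φ) is injective, and Hig_k(G,φ) contains a subgroup isomorphic to the free product A * A. -/
universe u

variable (G : Type u) [Group G] (A B : Subgroup G) (φ : B ≃* A) (k : ℕ)

/-- The stable generator `t` inside the free product `G ∗ ⟨t⟩`. -/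
def higT : Monoid.Coprod G (FreeGroup Unit) := Monoid.Coprod.inr (FreeGroup.of ())

/-- Defining relators of `Hig_k(G, φ)`:  `t^k` and `t⁻¹ b t φ(b)⁻¹` for `b ∈ B`. -/
def higRels : Set (Monoid.Coprod G (FreeGroup Unit)) :=
  {higT G ^ k} ∪
    ⋃ b : B, {(higT G)⁻¹ * Monoid.Coprod.inl (b : G) * higT G *
      (Monoid.Coprod.inl ((φ b : G)) : Monoid.Coprod G (FreeGroup Unit))⁻¹}

/-- `Hig_k(G, φ) = ⟨G, t ∣ t^k = 1, b^t = φ(b) ∀ b ∈ B⟩`. -/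
def Hig : Type u :=
  Monoid.Coprod G (FreeGroup Unit) ⧸ Subgroup.normalClosure (higRels G A B φ k)

instance : Group (Hig G A B φ k) :=
  inferInstanceAs (Group (Monoid.Coprod G (FreeGroup Unit) ⧸
    Subgroup.normalClosure (higRels G A B φ k)))

/-- The natural map `ι : G → Hig_k(G, φ)`. -/
def higIota : G →* Hig G A B φ k :=
  (QuotientGroup.mk' (Subgroup.normalClosure (higRels G A B φ k))).comp Monoid.Coprod.inl

namespace HigAux

open Monoid

/-- Subgroups of the factors meeting the amalgamated subgroup trivially generate a free product. -/
theorem coprodI_lift_injective {ι : Type*} {X : ι → Type*} [∀ i, Group (X i)] {H : Type*} [Group H]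
    {p : ∀ i, H →* X i} (hp : ∀ i, Function.Injective (p i))
    {K : ι → Type*} [∀ i, Group (K i)] (v : ∀ i, K i →* X i)
    (hv : ∀ i a h, v i a = p i h → a = 1) :
    Function.Injective (CoprodI.lift (fun i => (PushoutI.of (φ := p) i).comp (v i))) := by
  classical
  rw [injective_iff_map_eq_one]
  intro x hx
  obtain ⟨w, rfl⟩ : ∃ w : CoprodI.Word K, w.prod = x :=
    ⟨CoprodI.Word.equiv x, CoprodI.Word.equiv.symm_apply_apply x⟩
  let w' : CoprodI.Word X :=
    { toList := w.toList.map (fun s => ⟨s.1, v s.1 s.2⟩)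
      ne_one := by
        intro s hs
        obtain ⟨r, hr, rfl⟩ := List.mem_map.1 hs
        intro h
        exact w.ne_one r hr (hv r.1 r.2 1 (by simpa using h))
      chain_ne := by
        rw [List.isChain_map]
        exact w.chain_ne }
  have hred : PushoutI.Reduced p w' := by
    intro s hs
    obtain ⟨r, hr, rfl⟩ := List.mem_map.1 hs
    rintro ⟨h, hh⟩
    exact w.ne_one r hr (hv r.1 r.2 h hh.symm)
  have hprod : (PushoutI.ofCoprodI w'.prod : PushoutI p) =
      CoprodI.lift (fun i => (PushoutI.of (φ := p) i).comp (v i)) w.prod := by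
    simp only [CoprodI.Word.prod, map_list_prod, List.map_map, w']
    congr 1
  have := hred.eq_empty_of_mem_range hp (by rw [hprod, hx]; exact one_mem _)
  have hl : w.toList = [] := by
    have h2 : w'.toList = [] := by rw [this]; rfl
    simpa [w'] using h2
  simp [CoprodI.Word.prod, hl]

/-- Binary families indexed by `Bool`. -/
def Fam (X Y : Type u) : Bool → Type u
  | false => X
  | true => Y

instance (X Y : Type u) [Group X] [Group Y] : ∀ b, Group (Fam X Y b)
  | false => inferInstanceAs (Group X)
  | true => inferInstanceAs (Group Y)

/-- A homomorphism into each member of a binary family. -/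
def famHom {H X Y : Type u} [Group H] [Group X] [Group Y] (p : H →* X) (q : H →* Y) :
    ∀ b, H →* Fam X Y b
  | false => p
  | true => q

theorem amalg {H X Y : Type u} [Group H] [Group X] [Group Y] (p : H →* X) (q : H →* Y)
    (hp : Function.Injective p) (hq : Function.Injective q) :
    ∃ (Q : Type u) (_ : Group Q) (i : X →* Q) (j : Y →* Q),
      Function.Injective i ∧ Function.Injective j ∧ (∀ h, i (p h) = j (q h)) ∧
      ∀ (K : Type u) [Group K] (v : K →* X) (w : K →* Y),
        (∀ a h, v a = p h → a = 1) → (∀ a h, w a = q h → a = 1) →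
        Function.Injective (Coprod.lift (i.comp v) (j.comp w)) := by
  have hf : ∀ b, Function.Injective (famHom p q b) := by
    rintro (_ | _)
    · exact hp
    · exact hq
  refine ⟨PushoutI (famHom p q), inferInstance, PushoutI.of (φ := famHom p q) false,
    PushoutI.of (φ := famHom p q) true, PushoutI.of_injective hf false,
    PushoutI.of_injective hf true, ?_, ?_⟩
  · intro h
    exact (PushoutI.of_apply_eq_base (famHom p q) false h).trans
      (PushoutI.of_apply_eq_base (famHom p q) true h).symm
  · intro K _ v w hv hw
    have key := coprodI_lift_injective hf (K := fun _ => K) (famHom v w) (by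
      rintro (_ | _)
      · exact hv
      · exact hw)
    let θ : Coprod K K →* CoprodI (fun _ : Bool => K) :=
      Coprod.lift (CoprodI.of (M := fun _ : Bool => K) (i := false))
        (CoprodI.of (M := fun _ : Bool => K) (i := true))
    let η : CoprodI (fun _ : Bool => K) →* Coprod K K :=
      CoprodI.lift (fun b => match b with | false => Coprod.inl | true => Coprod.inr)
    have hηθ : η.comp θ = MonoidHom.id _ := by
      ext a <;> simp [η, θ]
    have hθ : Function.Injective θ := by
      apply Function.LeftInverse.injective (g := η)
      intro x
      exact DFunLike.congr_fun hηθ x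
    have heq : Coprod.lift ((PushoutI.of (φ := famHom p q) false : X →* _).comp v)
        ((PushoutI.of (φ := famHom p q) true : Y →* _).comp w) =
        (CoprodI.lift (fun i => (PushoutI.of (φ := famHom p q) i).comp (famHom v w i))).comp θ := by
      apply Coprod.hom_ext
      · ext a
        simp only [MonoidHom.comp_apply, Coprod.lift_apply_inl, θ, CoprodI.lift_of]
        rfl
      · ext a
        simp only [MonoidHom.comp_apply, Coprod.lift_apply_inr, θ, CoprodI.lift_of]
        rfl
    have hfin := key.comp hθ
    rw [← MonoidHom.coe_comp, ← heq] at hfin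
    exact hfin

variable {G A B}

/-- The chain of `n + 2` copies of `G`. -/
theorem chain (φ : B ≃* A) (hAB : A ⊓ B = ⊥) (n : ℕ) :
    ∃ (L : Type u) (_ : Group L) (f : ℕ → G →* L),
      Function.Injective (f 0) ∧ Function.Injective (f (n + 1)) ∧
      (∀ i < n + 1, ∀ b : B, f (i + 1) b = f i (φ b)) ∧
      Function.Injective (Coprod.lift ((f 0).comp (B.subtype.comp φ.symm.toMonoidHom))
        ((f (n + 1)).comp A.subtype)) := by
  have hdis : ∀ (a : A) (b : B), (a : G) = b → a = 1 := by
    intro a b h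
    have : (a : G) ∈ A ⊓ B := ⟨a.2, h ▸ b.2⟩
    rw [hAB] at this
    exact Subtype.ext this
  have hinj : Function.Injective (B.subtype.comp φ.symm.toMonoidHom) :=
    B.subtype_injective.comp φ.symm.injective
  -- generic extension step
  have step : ∀ (m : ℕ) (L : Type u) (_ : Group L) (f : ℕ → G →* L),
      Function.Injective (f 0) → Function.Injective (f m) →
      (∀ i < m, ∀ b : B, f (i + 1) b = f i (φ b)) →
      (∀ a a' : A, f 0 (φ.symm a) = f m a' → a = 1) →
      ∃ (L' : Type u) (_ : Group L') (f' : ℕ → G →* L'),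
        Function.Injective (f' 0) ∧ Function.Injective (f' (m + 1)) ∧
        (∀ i < m + 1, ∀ b : B, f' (i + 1) b = f' i (φ b)) ∧
        Function.Injective (Coprod.lift ((f' 0).comp (B.subtype.comp φ.symm.toMonoidHom))
          ((f' (m + 1)).comp A.subtype)) := by
    intro m L _ f h0 hm hc ht
    obtain ⟨Q, _, i, j, hi, hj, hij, hfree⟩ := amalg ((f m).comp A.subtype)
      (B.subtype.comp φ.symm.toMonoidHom) (hm.comp A.subtype_injective) hinj
    refine ⟨Q, inferInstance, fun r => if r ≤ m then i.comp (f r) else j, ?_, ?_, ?_, ?_⟩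
    · simpa using hi.comp h0
    · simpa using hj
    · intro r hr b
      rcases Nat.lt_succ_iff_lt_or_eq.1 hr with h | rfl
      · simp [h.le, Nat.succ_le_of_lt h, hc r h b]
      · simpa using (hij (φ b)).symm
    · simp only [Nat.zero_le, if_true, Nat.not_succ_le_self, if_false]
      exact hfree A ((f 0).comp (B.subtype.comp φ.symm.toMonoidHom)) A.subtype
        (fun a h hh => ht a h hh) (fun a h hh => hdis a (φ.symm h) hh)
  induction n with
  | zero =>
    refine step 0 G inferInstance (fun _ => MonoidHom.id G) (fun _ _ h => h) (fun _ _ h => h)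
      (by intro i hi; omega) ?_
    intro a a' h
    have h1 := hdis a' (φ.symm a) h.symm
    subst h1
    have : φ.symm a = 1 := Subtype.ext h
    simpa using this
  | succ n ih =>
    obtain ⟨L, _, f, h0, hm, hc, hfree⟩ := ih
    refine step (n + 1) L inferInstance f h0 hm hc ?_
    intro a a' h
    have h1 : (Coprod.inl a : Coprod A A) = Coprod.inr a' := by
      apply hfree
      simpa using h
    have h2 := congrArg (Coprod.lift (MonoidHom.id A) (1 : A →* A)) h1
    simpa using h2

/-- The cycle of `n + 4` copies of `G`. -/
theorem cycle (φ : B ≃* A) (hAB : A ⊓ B = ⊥) (n : ℕ) :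
    ∃ (Q : Type u) (_ : Group Q) (f : ℕ → G →* Q),
      Function.Injective (f 0) ∧
      (∀ i < n + 3, ∀ b : B, f (i + 1) b = f i (φ b)) ∧
      (∀ b : B, f 0 b = f (n + 3) (φ b)) ∧
      Function.Injective (Coprod.lift ((f 0).comp (B.subtype.comp φ.symm.toMonoidHom))
        ((f 1).comp A.subtype)) := by
  obtain ⟨L, _, f, h0, -, hc, hfree⟩ := chain φ hAB 0
  obtain ⟨M, _, g, -, -, gc, gfree⟩ := chain φ hAB n
  have hq : Function.Injective (Coprod.lift ((g (n + 1)).comp A.subtype)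
      ((g 0).comp (B.subtype.comp φ.symm.toMonoidHom))) := by
    have : Coprod.lift ((g (n + 1)).comp A.subtype)
      ((g 0).comp (B.subtype.comp φ.symm.toMonoidHom)) =
      (Coprod.lift ((g 0).comp (B.subtype.comp φ.symm.toMonoidHom))
        ((g (n + 1)).comp A.subtype)).comp (Coprod.swap A A) := by
      ext <;> simp
    rw [this]
    exact gfree.comp Coprod.swap_injective
  obtain ⟨Q, _, i, j, hi, hj, hij, -⟩ := amalg _ _ hfree hq
  refine ⟨Q, inferInstance, fun r => if r < 2 then i.comp (f r) else j.comp (g (r - 2)),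
    ?_, ?_, ?_, ?_⟩
  · simpa using hi.comp h0
  · intro r hr b
    match r, hr with
    | 0, _ => simpa using congrArg i (hc 0 (by omega) b)
    | 1, _ => simpa using (hij (Coprod.inr (φ b))).symm
    | r + 2, hr =>
      have := gc r (by omega) b
      simpa using congrArg j this
  · intro b
    simpa using hij (Coprod.inl (φ b))
  · have := hi.comp hfree
    convert this using 1
    rw [← MonoidHom.coe_comp]
    congr 1
    ext <;> simp

end HigAux

/-- **Lemma.** If `A ∩ B = {1}` and `k ≥ 4`, then `G` embeds in `Hig_k(G,φ)` via the natural
map, and `Hig_k(G,φ)` contains a copy of the free product `A ∗ A`. -/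
theorem higIota_injective_and_free_product_embeds
    (hAB : A ⊓ B = ⊥) (hk : 4 ≤ k) :
    Function.Injective (higIota G A B φ k) ∧
    ∃ e : Monoid.Coprod A A →* Hig G A B φ k, Function.Injective e := by
  obtain ⟨n, rfl⟩ : ∃ n, k = n + 4 := ⟨k - 4, by omega⟩
  obtain ⟨Q, _, f, h0, hc, hl, hfree⟩ := HigAux.cycle φ hAB n
  -- the cyclic condition, indexed by `Fin`
  have hcyc : ∀ (i : Fin (n + 4)) (b : B), f (i + 1 : Fin (n + 4)).val b = f i.val (φ b) := by
    intro i b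
    rw [Fin.val_add_one]
    split_ifs with h
    · subst h
      simpa using hl b
    · exact hc i.val (by have := i.2; have h3 : i.val ≠ n + 3 := fun h4 => h (Fin.ext h4); omega) b
  -- the action on `Fin (n + 4) × Q`
  let gact : G →* Equiv.Perm (Fin (n + 4) × Q) :=
    { toFun := fun g =>
        { toFun := fun x => (x.1, f x.1.val g * x.2)
          invFun := fun x => (x.1, f x.1.val g⁻¹ * x.2)
          left_inv := fun x => by simp
          right_inv := fun x => by simp }
      map_one' := by ext x <;> simp
      map_mul' := fun g h => by ext x <;> simp [mul_assoc] }
  let τ : Equiv.Perm (Fin (n + 4) × Q) := (Equiv.addRight 1).prodCongr (Equiv.refl Q)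
  have hτ : ∀ (m : ℕ) (x : Fin (n + 4) × Q), (τ ^ m) x = (x.1 + m • (1 : Fin (n + 4)), x.2) := by
    intro m
    induction m with
    | zero => intro x; simp
    | succ m ih =>
      intro x
      rw [pow_succ, Equiv.Perm.mul_apply, ih]
      simp only [τ, Equiv.prodCongr_apply, Prod.map, Equiv.coe_addRight, Equiv.refl_apply]
      rw [add_assoc, succ_nsmul']
  let Ψ : Monoid.Coprod G (FreeGroup Unit) →* Equiv.Perm (Fin (n + 4) × Q) :=
    Monoid.Coprod.lift gact (FreeGroup.lift (fun _ => τ))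
  have hΨT : Ψ (higT G) = τ := by simp [Ψ, higT]
  have hker : Subgroup.normalClosure (higRels G A B φ (n + 4)) ≤ Ψ.ker := by
    apply Subgroup.normalClosure_le_normal
    rintro r (hr | hr)
    · rw [Set.mem_singleton_iff] at hr
      subst hr
      change Ψ _ = 1
      rw [map_pow, hΨT]
      ext1 x
      rw [hτ]
      have : (n + 4) • (1 : Fin (n + 4)) = 0 := by
        simpa using card_nsmul_eq_zero (G := Fin (n + 4)) (x := 1)
      rw [this]
      simp
    · obtain ⟨b, hr⟩ := Set.mem_iUnion.1 hr
      rw [Set.mem_singleton_iff] at hr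
      subst hr
      change Ψ _ = 1
      rw [map_mul, map_inv, mul_inv_eq_one, map_mul, map_mul, map_inv, hΨT, mul_assoc,
        inv_mul_eq_iff_eq_mul]
      ext1 x
      simp only [Ψ, Monoid.Coprod.lift_apply_inl, Equiv.Perm.mul_apply]
      simp [gact, τ, hcyc x.1 b]
  let Φ : Hig G A B φ (n + 4) →* Equiv.Perm (Fin (n + 4) × Q) := QuotientGroup.lift _ Ψ hker
  let T : Hig G A B φ (n + 4) := QuotientGroup.mk' _ (higT G)
  have hΦι : ∀ g, Φ (higIota G A B φ (n + 4) g) = gact g := by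
    intro g
    change Ψ (Monoid.Coprod.inl g) = _
    simp [Ψ]
  have hΦT : Φ T = τ := hΨT
  refine ⟨?_, ?_⟩
  · intro g h hgh
    have h1 := congrArg (fun y => (Φ y (0, 1)).2) hgh
    simp only [hΦι] at h1
    apply h0
    simpa [gact] using h1
  · let e : Monoid.Coprod A A →* Hig G A B φ (n + 4) :=
      Monoid.Coprod.lift
        ((higIota G A B φ (n + 4)).comp (B.subtype.comp φ.symm.toMonoidHom))
        (((MulAut.conj T⁻¹).toMonoidHom.comp (higIota G A B φ (n + 4))).comp A.subtype)
    refine ⟨e, ?_⟩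
    rw [injective_iff_map_eq_one]
    intro x hx
    apply (injective_iff_map_eq_one _).1 hfree
    have key : ∀ (y : Monoid.Coprod A A) (q : Q), Φ (e y) (0, q) =
        (0, Monoid.Coprod.lift ((f 0).comp (B.subtype.comp φ.symm.toMonoidHom))
          ((f 1).comp A.subtype) y * q) := by
      intro y
      induction y using Monoid.Coprod.induction_on with
      | inl a =>
        intro q
        simp only [e, Monoid.Coprod.lift_apply_inl, MonoidHom.comp_apply, hΦι]
        simp [gact]
      | inr a =>
        intro q
        have h1 : Φ (e (Monoid.Coprod.inr a)) = τ⁻¹ * gact a * τ := by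
          simp [e, hΦι, hΦT]
        rw [h1, mul_assoc, Equiv.Perm.mul_apply, Equiv.Perm.inv_eq_iff_eq, Equiv.Perm.mul_apply]
        simp [gact, τ]
      | mul y z hy hz =>
        intro q
        rw [map_mul, map_mul, Equiv.Perm.mul_apply, hz, hy, map_mul, mul_assoc]
    have h2 := key x 1
    rw [hx] at h2
    simpa using (congrArg Prod.snd h2).symm
end
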